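/- arXiv:2111.03802 — 2 statements merged into one kernel-verified Lean document; each statement's English description precedes it below -/
import Mathlib

section
/- Let M be an o-minimal structure and let S be a definable family of subsets of M^n. If S is 2^n-consistent, then S has a finite tame transversal, i.e., S can be covered by finitely many subfamilies, each of which extends to a definable type. -/
open FirstOrder Set

/-- `M` is an o-minimal `L`-structure: a densely linearly ordered structure without endpoints,
whose order is `∅`-definable, and in which every definable (with parameters) subset of `M`
is a finite union of points and open intervals with endpoints in `M ∪ {±∞}`. -/
def IsOMinimal (L : FirstOrder.Language) (M : Type*) [L.Structure M] [LinearOrder M] : Prop :=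
  Nonempty M ∧ DenselyOrdered M ∧ NoMinOrder M ∧ NoMaxOrder M ∧
  Set.Definable (∅ : Set M) L {v : Fin 2 → M | v 0 < v 1} ∧
  ∀ s : Set M, Set.Definable₁ (Set.univ : Set M) L s →
    ∃ F : Finset (Set M), s = ⋃₀ (F : Set (Set M)) ∧
      ∀ t ∈ F, (∃ a : M, t = {a}) ∨ (∃ a b : M, t = Set.Ioo a b) ∨
        (∃ a : M, t = Set.Ioi a) ∨ (∃ a : M, t = Set.Iio a) ∨ t = Set.univ

/-- The fiber over `u` of a set `D ⊆ M^{m+n}`, i.e. the set `φ(u, M^n)`. -/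
def famFiber {M : Type*} {m n : ℕ} (D : Set (Fin m ⊕ Fin n → M)) (u : Fin m → M) :
    Set (Fin n → M) :=
  {v | Sum.elim u v ∈ D}

/-- An `A`-definable family of subsets of `M^n`: the family of fibers `φ(u, M^n)` for `u`
ranging over an `A`-definable index set `Ω`, where `φ` is `A`-definable. -/
def IsDefFamily (L : FirstOrder.Language) {M : Type*} [L.Structure M] (A : Set M) (n : ℕ)
    (S : Set (Set (Fin n → M))) : Prop :=
  ∃ (m : ℕ) (Ω : Set (Fin m → M)) (D : Set (Fin m ⊕ Fin n → M)),
    Set.Definable A L Ω ∧ Set.Definable A L D ∧ S = famFiber D '' Ω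

/-- A family of sets is downward directed: it does not contain `∅` and any two members
contain a common member. -/
def DirectedFam {α : Type*} (S : Set (Set α)) : Prop :=
  ∅ ∉ S ∧ ∀ X ∈ S, ∀ Y ∈ S, ∃ Z ∈ S, Z ⊆ X ∩ Y

/-- `S` is finer than `F`: every member of `F` contains a member of `S`. -/
def FinerThan {α : Type*} (S F : Set (Set α)) : Prop :=
  ∀ X ∈ F, ∃ Y ∈ S, Y ⊆ X

/-- A (complete) `n`-type over `M`: an ultrafilter on the Boolean algebra of definable
subsets of `M^n`. -/
def IsTypeOn (L : FirstOrder.Language) {M : Type*} [L.Structure M] (n : ℕ)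
    (p : Set (Set (Fin n → M))) : Prop :=
  (∀ X ∈ p, Set.Definable (Set.univ : Set M) L X) ∧
  ∅ ∉ p ∧
  (∀ X ∈ p, ∀ Y ∈ p, X ∩ Y ∈ p) ∧
  (∀ X ∈ p, ∀ Y : Set (Fin n → M), Set.Definable (Set.univ : Set M) L Y → X ⊆ Y → Y ∈ p) ∧
  (∀ X : Set (Fin n → M), Set.Definable (Set.univ : Set M) L X → X ∈ p ∨ Xᶜ ∈ p)

/-- A type `p` is `A`-definable if for every `∅`-definable `D ⊆ M^{m+n}` the set of
parameters `u` with `φ(u, M^n) ∈ p` is `A`-definable. -/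
def IsDefTypeOver (L : FirstOrder.Language) {M : Type*} [L.Structure M] (A : Set M) (n : ℕ)
    (p : Set (Set (Fin n → M))) : Prop :=
  ∀ (m : ℕ) (D : Set (Fin m ⊕ Fin n → M)), Set.Definable (∅ : Set M) L D →
    Set.Definable A L {u : Fin m → M | famFiber D u ∈ p}

/-- A family `F` is complete for a family `X` if each member of `X` either contains a member
of `F` or is disjoint from one. -/
def CompleteFor {α : Type*} (F X : Set (Set α)) : Prop :=
  ∀ Y ∈ X, ∃ Z ∈ F, Z ⊆ Y ∨ Z ∩ Y = ∅

/-- A family of subsets of `M^n` is complete if it decides every definable set. -/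
def IsCompleteFam (L : FirstOrder.Language) {M : Type*} [L.Structure M] (n : ℕ)
    (S : Set (Set (Fin n → M))) : Prop :=
  ∀ X : Set (Fin n → M), Set.Definable (Set.univ : Set M) L X → ∃ Z ∈ S, Z ⊆ X ∨ Z ∩ X = ∅

/-- `B` is a basis for the type `p`: a downward directed subfamily generating `p`. -/
def IsBasisOfType {α : Type*} (B p : Set (Set α)) : Prop :=
  B ⊆ p ∧ DirectedFam B ∧ ∀ Y ∈ p, ∃ Z ∈ B, Z ⊆ Y

/-- `p` has an `A`-definable basis. -/
def HasDefBasis (L : FirstOrder.Language) {M : Type*} [L.Structure M] (A : Set M) (n : ℕ)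
    (p : Set (Set (Fin n → M))) : Prop :=
  ∃ B, IsDefFamily L A n B ∧ IsBasisOfType B p

/-- `S` has a finite tame transversal: it is covered by finitely many subfamilies, each of
which extends to a definable type. -/
def HasFTT (L : FirstOrder.Language) {M : Type*} [L.Structure M] (n : ℕ)
    (S : Set (Set (Fin n → M))) : Prop :=
  ∃ (N : ℕ) (p : Fin N → Set (Set (Fin n → M))),
    (∀ i, IsTypeOn L n (p i) ∧ IsDefTypeOver L (Set.univ : Set M) n (p i)) ∧
    ∀ X ∈ S, ∃ i, X ∈ p i

/-- The `(m,n)`-property: among any `m` members of the family, some `n` have nonempty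
intersection. -/
def HasMNProperty {α : Type*} (S : Set (Set α)) (m n : ℕ) : Prop :=
  ∀ F : Finset (Set α), ↑F ⊆ S → F.card = m →
    ∃ G ⊆ F, G.card = n ∧ (⋂₀ (G : Set (Set α))).Nonempty


universe u u1 u2
section
set_option synthInstance.maxHeartbeats 400000
set_option synthInstance.maxSize 40000
set_option linter.unusedVariables false
set_option linter.style.longLine false
set_option linter.unusedSectionVars false
namespace OMin

/-- A space over `M`: a type identified with a finite power of `M`. -/
class MSp (M : Type u) (X : Type u) where
  ι : Type
  fin : Finite ι
  e : X ≃ (ι → M)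

instance mspSelf (M : Type u) : MSp M M where
  ι := Unit
  fin := inferInstance
  e := (Equiv.funUnique Unit M).symm

instance mspUnit (M : Type u) : MSp M PUnit.{u+1} where
  ι := Empty
  fin := inferInstance
  e := ⟨fun _ => Empty.elim, fun _ => PUnit.unit, fun _ => rfl, fun _ => funext fun x => x.elim⟩

instance mspProd (M : Type u) (X Y : Type u) [hX : MSp M X] [hY : MSp M Y] : MSp M (X × Y) where
  ι := hX.ι ⊕ hY.ι
  fin := by have := hX.fin; have := hY.fin; infer_instance
  e := (Equiv.prodCongr hX.e hY.e).trans (Equiv.sumArrowEquivProdArrow _ _ _).symm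

instance mspFin (M : Type u) (n : ℕ) : MSp M (Fin n → M) where
  ι := Fin n
  fin := inferInstance
  e := Equiv.refl _

section defs
variable (L : FirstOrder.Language.{u1,u2}) (M : Type u) [L.Structure M]

/-- `P` is a definable predicate on the space `X`. -/
class Dfn {X : Type u} [hX : MSp M X] (P : X → Prop) : Prop where
  out : Set.Definable (Set.univ : Set M) L {v : hX.ι → M | P (hX.e.symm v)}

/-- Definable maps between spaces, via graphs. -/
class DMap {X Y : Type u} [MSp M X] [MSp M Y] (f : X → Y) : Prop where
  out : Dfn L M (fun p : X × Y => p.2 = f p.1)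

class Dfn1 {X : Type u} [MSp M X] (P : X → Prop) : Prop where
  out : Dfn L M P
class Dfn2 {X Y : Type u} [MSp M X] [MSp M Y] (P : X → Y → Prop) : Prop where
  out : Dfn L M (fun p : X × Y => P p.1 p.2)
class Dfn3 {X Y Z : Type u} [MSp M X] [MSp M Y] [MSp M Z] (P : X → Y → Z → Prop) : Prop where
  out : Dfn L M (fun p : X × Y × Z => P p.1 p.2.1 p.2.2)
class Dfn4 {X Y Z W : Type u} [MSp M X] [MSp M Y] [MSp M Z] [MSp M W]
    (P : X → Y → Z → W → Prop) : Prop where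
  out : Dfn L M (fun p : X × Y × Z × W => P p.1 p.2.1 p.2.2.1 p.2.2.2)

end defs

section inst
variable {L : FirstOrder.Language.{u1,u2}} {M : Type u} [L.Structure M]
variable {X Y Z W V : Type u} [hX : MSp M X] [hY : MSp M Y] [hZ : MSp M Z] [hW : MSp M W] [MSp M V]

theorem Dfn.congr {P Q : X → Prop} (h : Dfn L M P) (hPQ : ∀ x, P x ↔ Q x) : Dfn L M Q := by
  have : P = Q := funext fun x => propext (hPQ x)
  exact this ▸ h

instance dfnAnd (P Q : X → Prop) [h : Dfn L M P] [h' : Dfn L M Q] :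
    Dfn L M (fun x => P x ∧ Q x) := ⟨h.out.inter h'.out⟩
instance dfnOr (P Q : X → Prop) [h : Dfn L M P] [h' : Dfn L M Q] :
    Dfn L M (fun x => P x ∨ Q x) := ⟨h.out.union h'.out⟩
instance dfnNot (P : X → Prop) [h : Dfn L M P] :
    Dfn L M (fun x => ¬ P x) := ⟨h.out.compl⟩
instance dfnImp (P Q : X → Prop) [h : Dfn L M P] [h' : Dfn L M Q] :
    Dfn L M (fun x => P x → Q x) :=
  Dfn.congr (P := fun x => ¬ P x ∨ Q x) inferInstance fun x => by tauto
instance dfnIff (P Q : X → Prop) [h : Dfn L M P] [h' : Dfn L M Q] :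
    Dfn L M (fun x => P x ↔ Q x) :=
  Dfn.congr (P := fun x => (P x → Q x) ∧ (Q x → P x)) inferInstance fun x => by tauto
instance dfnConst (p : Prop) : Dfn L M (fun _ : X => p) := by
  by_cases hp : p
  · constructor; simp only [hp]; exact definable_univ
  · constructor; simp only [hp]; exact definable_empty

/-- coordinate reindexing maps -/
def CMap (f : X → Y) : Prop := ∃ σ : hY.ι → hX.ι, ∀ x, hY.e (f x) = hX.e x ∘ σ

theorem CMap.pre {f : X → Y} (hf : CMap (M := M) f) (P : Y → Prop) (h : Dfn L M P) :
    Dfn L M (fun x => P (f x)) := by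
  obtain ⟨σ, hσ⟩ := hf
  constructor
  convert h.out.preimage_comp σ using 1
  ext v
  simp only [mem_ofPred_eq, mem_preimage]
  rw [show v ∘ σ = hY.e (f (hX.e.symm v)) by rw [hσ]; simp]
  simp

theorem cmapId : CMap (M := M) (fun x : X => x) := ⟨fun i => i, fun _ => rfl⟩
theorem cmapFst : CMap (M := M) (fun x : X × Y => x.1) := ⟨Sum.inl, fun _ => rfl⟩
theorem cmapSnd : CMap (M := M) (fun x : X × Y => x.2) := ⟨Sum.inr, fun _ => rfl⟩
theorem CMap.pair {f : X → Y} {g : X → Z} (hf : CMap (M := M) f) (hg : CMap (M := M) g) :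
    CMap (M := M) (fun x => (f x, g x)) := by
  obtain ⟨σ, hσ⟩ := hf
  obtain ⟨τ, hτ⟩ := hg
  refine ⟨Sum.elim σ τ, fun x => ?_⟩
  ext (i | i)
  · exact congrFun (hσ x) i
  · exact congrFun (hτ x) i
theorem CMap.comp {f : X → Y} {g : Y → Z} (hg : CMap (M := M) g) (hf : CMap (M := M) f) :
    CMap (M := M) (fun x => g (f x)) := by
  obtain ⟨σ, hσ⟩ := hf
  obtain ⟨τ, hτ⟩ := hg
  exact ⟨σ ∘ τ, fun x => by rw [hτ, hσ]; rfl⟩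

instance dfnEx (P : X → Y → Prop) [h : Dfn L M (fun p : X × Y => P p.1 p.2)] :
    Dfn L M (fun x => ∃ y, P x y) := by
  constructor
  have := hY.fin
  have := h.out.exists_of_finite
  convert this using 1
  ext v
  simp only [mem_ofPred_eq]
  constructor
  · rintro ⟨y, hy⟩
    refine ⟨hY.e y, ?_⟩
    change P (hX.e.symm v) (hY.e.symm (hY.e y))
    simpa using hy
  · rintro ⟨y, hy⟩; exact ⟨hY.e.symm y, hy⟩

instance dfnAll (P : X → Y → Prop) [h : Dfn L M (fun p : X × Y => P p.1 p.2)] :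
    Dfn L M (fun x => ∀ y, P x y) :=
  Dfn.congr (P := fun x => ¬ ∃ y, ¬ P x y) inferInstance fun x => by simp

theorem dfnEqBase : Dfn L M (fun p : X × X => p.1 = p.2) := by
  constructor
  have := hX.fin
  have h2 : ∀ i : hX.ι, Set.Definable (Set.univ : Set M) L
      {v : hX.ι ⊕ hX.ι → M | v (Sum.inl i) = v (Sum.inr i)} := by
    intro i
    have := (Definable.diagonal (L := L) (M := M) univ).preimage_comp
      (fun j : Fin 2 => if j = 0 then (Sum.inl i : hX.ι ⊕ hX.ι) else Sum.inr i)
    simpa using this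
  refine (congrArg (Set.Definable univ L) ?_).mp (definable_iInter_of_finite h2)
  ext v
  simp only [mem_ofPred_eq, mem_iInter]
  symm
  constructor
  · intro h i
    have := congrFun (hX.e.symm.injective h) i
    exact this
  · intro h
    exact congrArg hX.e.symm (funext h)

theorem dfnEqConst (a : X) : Dfn L M (fun x : X => x = a) := by
  constructor
  have := hX.fin
  have h2 : ∀ i : hX.ι, Set.Definable (Set.univ : Set M) L
      {v : hX.ι → M | v i = hX.e a i} := by
    intro i
    have := (Definable.singleton (L := L) (M := M) (hX.e a i)).preimage_comp
      (fun _ : Fin 1 => i)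
    exact this.mono (subset_univ _)
  convert definable_iInter_of_finite h2 using 1
  ext v
  simp only [mem_ofPred_eq, mem_iInter]
  rw [Equiv.symm_apply_eq]
  exact funext_iff

theorem CMap.dmap {f : X → Y} (hf : CMap (M := M) f) : DMap L M f := 
  ⟨(cmapSnd.pair (hf.comp cmapFst) : CMap (M := M) (fun p : X × Y => (p.2, f p.1))).pre _ dfnEqBase⟩

theorem Dfn.comp {P : Y → Prop} (h : Dfn L M P) (f : X → Y) [hf : DMap L M f] :
    Dfn L M (fun x => P (f x)) := by
  have h1 := hf.out
  have h2 : Dfn L M (fun p : X × Y => P p.2) := cmapSnd.pre _ h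
  exact Dfn.congr (P := fun x => ∃ y, y = f x ∧ P y) inferInstance fun x => by simp

instance dmapId : DMap L M (fun x : X => x) := cmapId.dmap
instance dmapConst (a : Y) : DMap L M (fun _ : X => a) :=
  ⟨cmapSnd.pre (M := M) (fun y => y = a) (dfnEqConst a)⟩
theorem DMap.comp' {f : X → Y} {g : Y → Z} (hf : DMap L M f) (hg : DMap L M g) :
    DMap L M (fun x => g (f x)) := by
  constructor
  have h1 : Dfn L M (fun p : (X × Z) × Y => p.2 = f p.1.1) :=
    ((cmapFst.comp cmapFst).pair cmapSnd : CMap (M := M) (fun p : (X × Z) × Y => (p.1.1, p.2))).pre _ hf.out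
  have h2 : Dfn L M (fun p : (X × Z) × Y => p.1.2 = g p.2) :=
    (cmapSnd.pair (cmapSnd.comp cmapFst) : CMap (M := M) (fun p : (X × Z) × Y => (p.2, p.1.2))).pre _ hg.out
  exact Dfn.congr (P := fun q : X × Z => ∃ y, y = f q.1 ∧ q.2 = g y) inferInstance fun x => by simp
instance dmapFst (f : X → Y × Z) [h : DMap L M f] : DMap L M (fun x => (f x).1) :=
  h.comp' cmapFst.dmap
instance dmapSnd (f : X → Y × Z) [h : DMap L M f] : DMap L M (fun x => (f x).2) :=
  h.comp' cmapSnd.dmap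
instance dmapPair (f : X → Y) (g : X → Z) [hf : DMap L M f] [hg : DMap L M g] :
    DMap L M (fun x => (f x, g x)) := by
  constructor
  have h1 : Dfn L M (fun p : X × Y × Z => p.2.1 = f p.1) :=
    (cmapFst.pair (cmapFst.comp cmapSnd) : CMap (M := M) (fun p : X × Y × Z => (p.1, p.2.1))).pre _ hf.out
  have h2 : Dfn L M (fun p : X × Y × Z => p.2.2 = g p.1) :=
    (cmapFst.pair (cmapSnd.comp cmapSnd) : CMap (M := M) (fun p : X × Y × Z => (p.1, p.2.2))).pre _ hg.out
  exact Dfn.congr (P := fun p : X × Y × Z => p.2.1 = f p.1 ∧ p.2.2 = g p.1) inferInstance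
    fun x => by simp [Prod.ext_iff]
instance (priority := low) dmapComp (g : Y → Z) (f : X → Y) [hg : DMap L M g] [hf : DMap L M f] :
  DMap L M (fun x => g (f x)) := hf.comp' hg

instance dfnEq (f g : X → Y) [hf : DMap L M f] [hg : DMap L M g] :
    Dfn L M (fun x => f x = g x) := dfnEqBase.comp (fun x => (f x, g x))

instance (priority := 900) dfn1 (P : X → Prop) (f : W → X) [h : Dfn1 L M P] [DMap L M f] :
  Dfn L M (fun w => P (f w)) := h.out.comp f
instance (priority := 900) dfn2 (P : X → Y → Prop) (f : W → X) (g : W → Y) [h : Dfn2 L M P] [DMap L M f] [DMap L M g] :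
  Dfn L M (fun w => P (f w) (g w)) := h.out.comp (fun w => (f w, g w))
instance (priority := 900) dfn3 (P : X → Y → Z → Prop) (f : W → X) (g : W → Y) (k : W → Z)
  [h : Dfn3 L M P] [DMap L M f] [DMap L M g] [DMap L M k] :
  Dfn L M (fun w => P (f w) (g w) (k w)) := h.out.comp (fun w => (f w, g w, k w))
instance (priority := 900) dfn4 (P : X → Y → Z → V → Prop) (f : W → X) (g : W → Y) (k : W → Z) (l : W → V)
  [h : Dfn4 L M P] [DMap L M f] [DMap L M g] [DMap L M k] [DMap L M l] :
  Dfn L M (fun w => P (f w) (g w) (k w) (l w)) := h.out.comp (fun w => (f w, g w, k w, l w))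

/-- The standing hypotheses: the order is definable and definable sets are tame. -/
class OM (L : FirstOrder.Language.{u1,u2}) (M : Type u) [L.Structure M] [LinearOrder M] : Prop where
  lt : Dfn L M (fun p : M × M => p.1 < p.2)
  om : ∀ s : Set M, Set.Definable₁ (Set.univ : Set M) L s →
    ∃ F : Finset (Set M), s = ⋃₀ (F : Set (Set M)) ∧
      ∀ t ∈ F, (∃ a : M, t = {a}) ∨ (∃ a b : M, t = Set.Ioo a b) ∨
        (∃ a : M, t = Set.Ioi a) ∨ (∃ a : M, t = Set.Iio a) ∨ t = Set.univ

variable [LinearOrder M] [hOM : OM L M]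
instance dfnLt (f g : X → M) [DMap L M f] [DMap L M g] : Dfn L M (fun x => f x < g x) :=
  hOM.lt.comp (fun x => (f x, g x))
instance dfnLe (f g : X → M) [DMap L M f] [DMap L M g] : Dfn L M (fun x => f x ≤ g x) :=
  Dfn.congr (P := fun x => ¬ (g x < f x)) inferInstance fun x => by simp

instance dfnLtEta (a : M) : Dfn L M (fun x : M => a < x) := dfnLt (fun _ => a) (fun x => x)
instance dfnLeEta (a : M) : Dfn L M (fun x : M => a ≤ x) := dfnLe (fun _ => a) (fun x => x)
instance dfnEqEta (a : X) : Dfn L M (fun x : X => a = x) := dfnEq (fun _ => a) (fun x => x)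
instance dmapPairEta (a : X) : DMap L M (fun y : Y => (a, y)) := dmapPair (fun _ => a) (fun x => x)
instance dmapFstEta : DMap L M (fun p : X × Y => p.1) := dmapFst (fun x => x)
instance dmapSndEta : DMap L M (fun p : X × Y => p.2) := dmapSnd (fun x => x)
instance (priority := low) dfn1Eta (P : X → Prop) [h : Dfn1 L M P] : Dfn L M (fun x => P x) := h.out
instance (priority := low) dfn2Eta (P : Y → X → Prop) (y : Y) [h : Dfn2 L M P] : Dfn L M (fun x => P y x) :=
  dfn2 P (fun _ => y) (fun x => x)
instance (priority := low) dfn3Eta (P : Y → Z → X → Prop) (y : Y) (z : Z) [h : Dfn3 L M P] : Dfn L M (fun x => P y z x) :=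
  dfn3 P (fun _ => y) (fun _ => z) (fun x => x)
instance (priority := low) dfn4Eta (P : Y → Z → W → X → Prop) (y : Y) (z : Z) (w : W) [h : Dfn4 L M P] : Dfn L M (fun x => P y z w x) :=
  dfn4 P (fun _ => y) (fun _ => z) (fun _ => w) (fun x => x)

end inst
end OMin

end
section
set_option synthInstance.maxHeartbeats 400000
set_option synthInstance.maxSize 40000
set_option linter.unusedVariables false
set_option linter.unusedSectionVars false
namespace OMin
section one
variable (L : FirstOrder.Language.{u1,u2}) {M : Type u} [L.Structure M] [LinearOrder M] [OM L M]
  [DenselyOrdered M] [NoMinOrder M] [NoMaxOrder M] [Nonempty M]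
variable {X Y Z W : Type u} [hX : MSp M X] [hY : MSp M Y] [hZ : MSp M Z] [hW : MSp M W]

omit [NoMinOrder M] [NoMaxOrder M] [DenselyOrdered M] [Nonempty M] [L.Structure M] [OM L M] in
/-- `P` contains an interval. -/
def Big (P : M → Prop) : Prop := ∃ a b, a < b ∧ ∀ c, a < c → c < b → P c
/-- `P` holds in a neighbourhood of `a`. -/
def Near (a : M) (P : M → Prop) : Prop := ∃ u v, u < a ∧ a < v ∧ ∀ e, u < e → e < v → P e

variable {L} in
instance dfnBig (P : X → M → Prop) [h : Dfn L M (fun p : X × M => P p.1 p.2)] :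
    Dfn L M (fun x => Big (P x)) := by
  have : Dfn2 L M P := ⟨h⟩
  unfold Big; infer_instance
variable {L} in
instance dfnNear (f : X → M) [DMap L M f] (P : X → M → Prop) [h : Dfn L M (fun p : X × M => P p.1 p.2)] :
    Dfn L M (fun x => Near (f x) (P x)) := by
  have : Dfn2 L M P := ⟨h⟩
  unfold Near; infer_instance

theorem Big.mono {P Q : M → Prop} (h : Big P) (hPQ : ∀ x, P x → Q x) : Big Q := by
  obtain ⟨a, b, hab, h⟩ := h
  exact ⟨a, b, hab, fun c h1 h2 => hPQ _ (h c h1 h2)⟩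
theorem Near.mono {a : M} {P Q : M → Prop} (h : Near a P) (hPQ : ∀ x, P x → Q x) : Near a Q := by
  obtain ⟨u, v, h1, h2, h⟩ := h
  exact ⟨u, v, h1, h2, fun c h1 h2 => hPQ _ (h c h1 h2)⟩
theorem Near.self {a : M} {P : M → Prop} (h : Near a P) : P a := by
  obtain ⟨u, v, h1, h2, h⟩ := h
  exact h a h1 h2
theorem Near.and {a : M} {P Q : M → Prop} (h : Near a P) (h' : Near a Q) :
    Near a (fun e => P e ∧ Q e) := by
  obtain ⟨u, v, h1, h2, h⟩ := h
  obtain ⟨u', v', h1', h2', h'⟩ := h'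
  refine ⟨max u u', min v v', max_lt h1 h1', lt_min h2 h2', fun e he1 he2 => ⟨h e ?_ ?_, h' e ?_ ?_⟩⟩
  · exact (le_max_left _ _).trans_lt he1
  · exact he2.trans_le (min_le_left _ _)
  · exact (le_max_right _ _).trans_lt he1
  · exact he2.trans_le (min_le_right _ _)
theorem Near.near {a : M} {P : M → Prop} (h : Near a P) : Near a (fun e => Near e P) := by
  obtain ⟨u, v, h1, h2, h⟩ := h
  exact ⟨u, v, h1, h2, fun e he1 he2 => ⟨u, v, he1, he2, h⟩⟩
theorem near_lt {a b : M} (h : a < b) : Near a (fun e => e < b) := by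
  obtain ⟨c, hc⟩ := exists_lt a
  exact ⟨c, b, hc, h, fun e _ h => h⟩
theorem near_gt {a b : M} (h : b < a) : Near a (fun e => b < e) := by
  obtain ⟨c, hc⟩ := exists_gt a
  exact ⟨b, c, h, hc, fun e h _ => h⟩
theorem Big.infinite {P : M → Prop} (h : Big P) : {x | P x}.Infinite := by
  obtain ⟨a, b, hab, h⟩ := h
  exact (Set.Ioo_infinite hab).mono fun c hc => h c hc.1 hc.2
theorem Big.exists {P : M → Prop} (h : Big P) : ∃ x, P x := h.infinite.nonempty
/-- there is a point of `P` near which `P` holds -/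
theorem Big.near {P : M → Prop} (h : Big P) : ∃ x, Near x P := by
  obtain ⟨a, b, hab, h⟩ := h
  obtain ⟨c, h1, h2⟩ := exists_between hab
  exact ⟨c, a, b, h1, h2, h⟩
theorem Near.big {a : M} {P : M → Prop} (h : Near a P) : Big P := by
  obtain ⟨u, v, h1, h2, h⟩ := h
  exact ⟨u, v, h1.trans h2, h⟩
/-- shrink a Big set -/
theorem Big.near_big {P Q : M → Prop} (h : Big P) (hn : ∀ x, Near x P → Q x) : Big Q := by
  obtain ⟨a, b, hab, h⟩ := h
  exact ⟨a, b, hab, fun c h1 h2 => hn c ⟨a, b, h1, h2, h⟩⟩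

theorem om_pred (P : M → Prop) [h : Dfn L M P] : ∃ F : Finset (Set M), {x | P x} = ⋃₀ (F : Set (Set M)) ∧
      ∀ t ∈ F, (∃ a : M, t = {a}) ∨ (∃ a b : M, t = Set.Ioo a b) ∨
        (∃ a : M, t = Set.Ioi a) ∨ (∃ a : M, t = Set.Iio a) ∨ t = Set.univ := by
  apply OM.om (L := L)
  have := h.out.preimage_comp (fun _ : Unit => (0 : Fin 1))
  exact this

theorem finite_of_not_big (P : M → Prop) [h : Dfn L M P] (hB : ¬ Big P) : {x | P x}.Finite := by
  obtain ⟨F, hF, ht⟩ := om_pred L P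
  rw [hF]
  refine F.finite_toSet.sUnion fun t htF => ?_
  have hsub : ∀ x ∈ t, P x := fun x hx => by
    have : x ∈ {x | P x} := hF ▸ ⟨t, htF, hx⟩
    exact this
  obtain ⟨a, rfl⟩ | ⟨a, b, rfl⟩ | ⟨a, rfl⟩ | ⟨a, rfl⟩ | rfl := ht t htF
  · exact finite_singleton a
  · rw [Set.Ioo_eq_empty]; exact finite_empty
    exact fun hab => hB ⟨a, b, hab, fun c h1 h2 => hsub c ⟨h1, h2⟩⟩
  · obtain ⟨b, hb⟩ := exists_gt a
    exact (hB ⟨a, b, hb, fun c h1 h2 => hsub c h1⟩).elim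
  · obtain ⟨b, hb⟩ := exists_lt a
    exact (hB ⟨b, a, hb, fun c h1 h2 => hsub c h2⟩).elim
  · obtain ⟨a⟩ := ‹Nonempty M›
    obtain ⟨b, hb⟩ := exists_lt a
    exact (hB ⟨b, a, hb, fun c h1 h2 => hsub c trivial⟩).elim

theorem big_of_infinite (P : M → Prop) [h : Dfn L M P] (hi : {x | P x}.Infinite) : Big P := by
  by_contra hB; exact hi (finite_of_not_big L P hB)

theorem big_or (P Q : M → Prop) [Dfn L M P] [Dfn L M Q] (h : Big (fun x => P x ∨ Q x)) :
    Big P ∨ Big Q := by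
  by_contra hn
  push Not at hn
  exact h.infinite ((finite_of_not_big L P hn.1).union (finite_of_not_big L Q hn.2))

/-- boundary points -/
def Bd (a : M) (P : M → Prop) : Prop := ¬ Near a P ∧ ¬ Near a (fun e => ¬ P e)

variable {L} in
instance dfnBd (P : X → M → Prop) [h : Dfn L M (fun p : X × M => P p.1 p.2)] (f : X → M) [DMap L M f] :
    Dfn L M (fun x => Bd (f x) (P x)) := by
  have : Dfn2 L M P := ⟨h⟩
  unfold Bd; infer_instance

theorem not_big_bd (P : M → Prop) [h : Dfn L M P] : ¬ Big (fun a => Bd a P) := by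
  have : Dfn1 L M P := ⟨h⟩
  rintro ⟨a, b, hab, h⟩
  have : Big (fun x => (P x ∧ a < x ∧ x < b) ∨ (¬ P x ∧ a < x ∧ x < b)) :=
    ⟨a, b, hab, fun c h1 h2 => by tauto⟩
  rcases big_or L _ _ this with h1 | h1
  · obtain ⟨c, hc⟩ := h1.near
    exact (h c hc.self.2.1 hc.self.2.2).1 (hc.mono fun x hx => hx.1)
  · obtain ⟨c, hc⟩ := h1.near
    exact (h c hc.self.2.1 hc.self.2.2).2 (hc.mono fun x hx => hx.1)

theorem bd_finite (P : M → Prop) [h : Dfn L M P] : {a | Bd a P}.Finite := by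
  have : Dfn1 L M P := ⟨h⟩
  exact finite_of_not_big L (fun a => Bd a P) (not_big_bd L P)

theorem exists_lub (P : M → Prop) [h : Dfn L M P] (hne : ∃ x, P x) (hb : ∃ b, ∀ x, P x → x ≤ b) :
    ∃ s, IsLUB {x | P x} s := by
  obtain ⟨F, hF, ht⟩ := om_pred L P
  have hb' : BddAbove {x | P x} := hb
  have hne' : {x | P x}.Nonempty := hne
  rw [hF] at hb' hne' ⊢
  clear hF
  induction F using Finset.induction_on with
  | empty => simp at hne'
  | insert t F htF ih =>
    simp only [Finset.coe_insert, sUnion_insert] at hb' hne' ⊢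
    have ht' := ht t (Finset.mem_insert_self _ _)
    have ih' := ih (fun t h => ht t (Finset.mem_insert_of_mem h)) (hb'.mono subset_union_right)
    have h1 : t.Nonempty → ∃ s, IsLUB t s := by
      intro hn
      have hbt : BddAbove t := hb'.mono subset_union_left
      obtain ⟨a, rfl⟩ | ⟨a, b, rfl⟩ | ⟨a, rfl⟩ | ⟨a, rfl⟩ | rfl := ht'
      · exact ⟨a, isLUB_singleton⟩
      · exact ⟨b, isLUB_Ioo (nonempty_Ioo.1 hn)⟩
      · exact (not_bddAbove_Ioi a hbt).elim
      · exact ⟨a, isLUB_Iio⟩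
      · exact (not_bddAbove_univ hbt).elim
    rcases t.eq_empty_or_nonempty with rfl | hn
    · simpa using ih' (by simpa using hne')
    · obtain ⟨s, hs⟩ := h1 hn
      rcases (⋃₀ (F : Set (Set M))).eq_empty_or_nonempty with he | he
      · exact ⟨s, by rw [he]; simpa using hs⟩
      · obtain ⟨s', hs'⟩ := ih' he
        exact ⟨_, hs.union hs'⟩

theorem conn (P : M → Prop) [h : Dfn L M P] (u v : M) (huv : u ≤ v)
    (hn : ∀ b, u ≤ b → b ≤ v → Near b P ∨ Near b (fun e => ¬ P e)) (hu : P u) : P v := by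
  have : Dfn1 L M P := ⟨h⟩
  obtain ⟨s, hs⟩ := exists_lub L (fun x => u ≤ x ∧ x ≤ v ∧ ∀ y, u ≤ y → y ≤ x → P y)
    ⟨u, le_rfl, huv, fun y h1 h2 => le_antisymm h2 h1 ▸ hu⟩ ⟨v, fun x hx => hx.2.1⟩
  have hus : u ≤ s := hs.1 ⟨le_rfl, huv, fun y h1 h2 => le_antisymm h2 h1 ▸ hu⟩
  have hsv : s ≤ v := hs.2 fun x hx => hx.2.1
  rcases hn s hus hsv with ⟨c, d, hc, hd, hP⟩ | ⟨c, d, hc, hd, hP⟩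
  · have hle : ∀ y, u ≤ y → y ≤ s → P y := by
      intro y h1 h2
      rcases h2.eq_or_lt with rfl | h2
      · exact hP _ hc hd
      · obtain ⟨x, hx, hyx⟩ := (lt_isLUB_iff hs).1 h2
        exact hx.2.2 y h1 hyx.le
    rcases hsv.eq_or_lt with rfl | hsv
    · exact hP _ hc hd
    · obtain ⟨e, he1, he2⟩ := exists_between (lt_min hsv hd)
      have : e ≤ s := hs.1 ⟨hus.trans he1.le, he2.le.trans (min_le_left _ _), fun y h1 h2 => by
        rcases le_or_gt y s with h3 | h3
        · exact hle y h1 h3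
        · exact hP y (hc.trans h3) (h2.trans_lt (he2.trans_le (min_le_right _ _)))⟩
      exact absurd this he1.not_ge
  · obtain ⟨x, hx, hyx⟩ := (lt_isLUB_iff hs).1 hc
    exact (hP x hyx ((hs.1 hx).trans_lt hd) (hx.2.2 x hx.1 le_rfl)).elim

theorem FL (G : M → M → Prop) [Dfn2 L M G] (hG : ∀ a b b', G a b → G a b' → b = b') :
    ¬ Big (fun b => Big (fun a => G a b)) := by
  intro hB
  let V : M → Prop := fun a => ∃ b, G a b ∧ Near a (fun e => G e b)
  have hV : Dfn1 L M V := ⟨by infer_instance⟩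
  have hex : ∀ b, Big (fun a => G a b) → ∃ a, Near a (fun e => G e b) := fun b hb => hb.near
  choose! α hα using hex
  refine hB.infinite (Set.Finite.of_injOn (f := fun b => {x | Bd x V} ∩ Iio (α b))
    (t := {s | s ⊆ {x | Bd x V}}) (fun b _ => inter_subset_left) ?_ (bd_finite L V).finite_subsets)
  have key : ∀ b b', Big (fun a => G a b) → Big (fun a => G a b') →
      {x | Bd x V} ∩ Iio (α b) = {x | Bd x V} ∩ Iio (α b') → α b ≤ α b' → b = b' := by
    intro b b' hb hb' he hle
    have hVn : ∀ b, Big (fun a => G a b) → Near (α b) V := fun b hb =>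
      (hα b hb).near.mono fun x hx => ⟨b, hx.self, hx⟩
    have hnb : ∀ c, α b ≤ c → c ≤ α b' → Near c V ∨ Near c (fun e => ¬ V e) := by
      intro c h1 h2
      by_contra hc
      push Not at hc
      rcases h2.eq_or_lt with rfl | h2
      · exact hc.1 (hVn _ hb')
      · have : c ∈ {x | Bd x V} ∩ Iio (α b) := he ▸ ⟨hc, h2⟩
        exact absurd this.2 (not_lt.2 h1)
    have hall : ∀ c, α b ≤ c → c ≤ α b' → V c := fun c h1 h2 =>
      conn L V (α b) c h1 (fun d h3 h4 => hnb d h3 (h4.trans h2)) (hVn _ hb).self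
    have : G (α b') b := by
      refine conn L (fun a => G a b) (α b) (α b') hle (fun c h1 h2 => ?_) (hα b hb).self
      obtain ⟨d, hd1, hd2⟩ := hall c h1 h2
      by_cases hdb : d = b
      · subst hdb; exact Or.inl hd2
      · exact Or.inr (hd2.mono fun x hx hx' => hdb (hG _ _ _ hx hx'))
    exact hG _ _ _ this (hα b' hb').self
  intro b hb b' hb' he
  rcases le_total (α b) (α b') with h | h
  · exact key b b' hb hb' he h
  · exact (key b' b hb' hb he.symm h).symm

theorem SL (G : M → M → Prop) [Dfn2 L M G] (hG : ∀ a b b', G a b → G a b' → b = b') (a : M)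
    (hB : Big (fun c => ∃ d, G c d)) (ha : ∀ c d, G c d → d < a) :
    ∃ p', p' < a ∧ Big (fun c => ∃ d, d ≤ p' ∧ G c d) := by
  by_cases hI : Big (fun d => ∃ c, G c d)
  · obtain ⟨s, t, hst, h⟩ := hI
    obtain ⟨m, h1, h2⟩ := exists_between hst
    obtain ⟨c, hc⟩ := h m h1 h2
    refine ⟨m, ha c m hc, ?_⟩
    apply big_of_infinite L
    intro hfin
    have hsub : Ioo s m ⊆ ⋃ c ∈ {c | ∃ d, d ≤ m ∧ G c d}, {d | G c d} := by
      intro d hd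
      obtain ⟨c, hc⟩ := h d hd.1 (hd.2.trans h2)
      simp only [mem_iUnion]
      exact ⟨c, ⟨d, hd.2.le, hc⟩, hc⟩
    refine Set.Ioo_infinite h1 ((hfin.biUnion fun c _ => ?_).subset hsub)
    exact Set.Subsingleton.finite fun x hx y hy => hG c x y hx hy
  · have hf := finite_of_not_big L _ hI
    obtain ⟨c, d, hcd⟩ := hB.exists
    obtain ⟨m, hm, hmax⟩ := Set.exists_max_image _ id hf ⟨d, c, hcd⟩
    obtain ⟨c', hc'⟩ := hm
    exact ⟨m, ha _ _ hc', hB.mono fun c ⟨d, hd⟩ => ⟨d, hmax d ⟨c, hd⟩, hd⟩⟩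

end one
end OMin

end
section
set_option synthInstance.maxHeartbeats 400000
set_option synthInstance.maxSize 40000
set_option linter.unusedVariables false
set_option linter.unusedSectionVars false
set_option linter.style.haveILetI false
namespace OMin
section two
variable (L : FirstOrder.Language.{u1,u2}) {M : Type u} [L.Structure M] [LinearOrder M] [OM L M]
  [DenselyOrdered M] [NoMinOrder M] [NoMaxOrder M] [Nonempty M]
variable {X Y Z W : Type u} [hX : MSp M X] [hY : MSp M Y] [hZ : MSp M Z] [hW : MSp M W]

theorem F2 (R : M → M → Prop) [hd : Dfn2 L M R] (hB : Big (fun a => Big (fun c => R a c))) :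
    ∃ c, Big (fun a => R a c) := by
  by_contra hcon
  push Not at hcon
  have hfin : ∀ c, {a | R a c}.Finite := fun c => finite_of_not_big L _ (hcon c)
  obtain ⟨p, q, hpq, hI⟩ := hB
  let E : M → M → Prop := fun p' a => p < p' ∧ p' < a ∧ a < q ∧
    Big (fun c => R a c ∧ ∀ e, p' < e → e < a → ¬ R e c)
  have hE : Dfn2 L M E := ⟨by infer_instance⟩
  have ha : ∀ p', {a | E p' a}.Finite := by
    intro p'
    apply finite_of_not_big L
    intro hb
    let G : M → M → Prop := fun c a => R a c ∧ p' < a ∧ ∀ e, p' < e → e < a → ¬ R e c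
    have hGd : Dfn2 L M G := ⟨by infer_instance⟩
    refine FL L G ?_ (hb.mono fun a ha => ?_)
    · rintro c a a' ⟨h1, h2, h3⟩ ⟨h1', h2', h3'⟩
      by_contra hne
      rcases lt_or_gt_of_ne hne with h | h
      · exact h3' a h2 h h1
      · exact h3 a' h2' h h1'
    · exact ha.2.2.2.mono fun c hc => ⟨hc.1, ha.2.1, hc.2⟩
  have hb : ∀ a, p < a → a < q → ∃ η, η < a ∧ ∀ p', η < p' → p' < a → E p' a := by
    intro a hpa haq
    have hRa := hI a hpa haq
    by_cases hH : Big (fun c => R a c ∧ ∃ e, p < e ∧ e < a ∧ R e c)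
    · let G : M → M → Prop := fun c d => R a c ∧ (p < d ∧ d < a ∧ R d c) ∧
        ∀ e, p < e → e < a → R e c → e ≤ d
      have hGd : Dfn2 L M G := ⟨by infer_instance⟩
      obtain ⟨p1, hp1, hB1⟩ := SL L G
        (by
          rintro c d d' ⟨_, ⟨h1, h2, h3⟩, h4⟩ ⟨_, ⟨h1', h2', h3'⟩, h4'⟩
          exact le_antisymm (h4' _ h1 h2 h3) (h4 _ h1' h2' h3')) a
        (hH.mono (by
          rintro c ⟨hc, e, he⟩
          obtain ⟨m, hm, hmax⟩ := Set.exists_max_image {e | p < e ∧ e < a ∧ R e c} id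
            ((hfin c).subset fun x hx => hx.2.2) ⟨e, he⟩
          exact ⟨m, hc, hm, fun e h1 h2 h3 => hmax e ⟨h1, h2, h3⟩⟩))
        (fun c d h => h.2.1.2.1)
      refine ⟨p1, hp1, fun p' h1 h2 => ⟨?_, h2, haq, hB1.mono ?_⟩⟩
      · obtain ⟨c, d, hd, hG⟩ := hB1.exists
        exact (hG.2.1.1.trans_le hd).trans h1
      · rintro c ⟨d, hd, hG⟩
        refine ⟨hG.1, fun e he1 he2 hR => ?_⟩
        have hpe : p < e := ((hG.2.1.1.trans_le hd).trans h1).trans he1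
        have := hG.2.2 e hpe he2 hR
        exact absurd (he1.trans_le this) (not_lt.2 (hd.trans h1.le))
    · refine ⟨p, hpa, fun p' h1 h2 => ⟨h1, h2, haq, ?_⟩⟩
      have : Big (fun c => (R a c ∧ ∃ e, p < e ∧ e < a ∧ R e c) ∨ (R a c ∧ ¬ ∃ e, p < e ∧ e < a ∧ R e c)) :=
        hRa.mono fun c hc => by rw [← and_or_left]; exact ⟨hc, em _⟩
      rcases big_or L _ _ this with h | h
      · exact (hH h).elim
      · exact h.mono fun c hc => ⟨hc.1, fun e he1 he2 hR => hc.2 ⟨e, h1.trans he1, he2, hR⟩⟩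
  have hc : ∀ p1 p2 a, E p1 a → p1 < p2 → p2 < a → E p2 a := by
    rintro p1 p2 a ⟨h1, h2, h3, h4⟩ h h'
    exact ⟨h1.trans h, h', h3, h4.mono fun c hc => ⟨hc.1, fun e he1 => hc.2 e (h.trans he1)⟩⟩
  let T : M → M → Prop := fun a p' => p' < a ∧ (∃ x, E p' x) ∧ ∀ x, E p' x → a < x
  have hT : Dfn2 L M T := ⟨by infer_instance⟩
  have hTf : ∀ a, {p' | T a p'}.Finite := by
    intro a
    apply finite_of_not_big L
    rintro ⟨s, t, hst, h⟩
    obtain ⟨a', h1, h2⟩ := exists_between hst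
    obtain ⟨ha1, ⟨x, hx⟩, ha3⟩ := h a' h1 h2
    obtain ⟨η, hη, hη'⟩ := hb a' hx.1 (hx.2.1.trans hx.2.2.1)
    obtain ⟨p', h3, h4⟩ := exists_between (max_lt hη h1)
    have h5 := hη' p' ((le_max_left _ _).trans_lt h3) h4
    have h6 := h p' ((le_max_right _ _).trans_lt h3) (h4.trans h2)
    exact absurd (h6.2.2 _ h5) (not_lt.2 ha1.le)
  let G : M → M → Prop := fun a p' => T a p' ∧ ∀ p'', T a p'' → p'' ≤ p'
  have hGd : Dfn2 L M G := ⟨by infer_instance⟩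
  have claim : ∀ p' x, T x p' → ∃ a, p' < a ∧ a ≤ x ∧ G a p' := by
    intro p' x hx
    by_cases hmax : ∃ p'', T x p'' ∧ p' < p''
    · obtain ⟨p0, hp0⟩ := hmax
      obtain ⟨p1, ⟨hp1, hp1'⟩, hmin⟩ := Set.exists_min_image {p'' | T x p'' ∧ p' < p''} id
            ((hTf x).subset fun x hx => hx.1) ⟨p0, hp0⟩
      refine ⟨p1, hp1', hp1.1.le, ⟨hp1', hx.2.1, fun y hy => hp1.1.trans (hx.2.2 y hy)⟩, ?_⟩
      intro p2 hp2
      by_contra hlt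
      rw [not_le] at hlt
      have : T x p2 := by
        refine ⟨hp2.1.trans hp1.1, hp2.2.1, fun y hy => ?_⟩
        by_contra hyx
        rw [not_lt] at hyx
        have h1 := hp2.2.2 y hy
        exact absurd (hp1.2.2 y (hc _ _ _ hy hp2.1 h1)) (not_lt.2 hyx)
      exact absurd hp2.1 (not_lt.2 (hmin p2 ⟨this, hlt⟩))
    · push Not at hmax
      exact ⟨x, hx.1, le_rfl, hx, hmax⟩
  have hGB : ∀ p', (∃ x, E p' x) → Big (fun a => G a p') := by
    rintro p' ⟨x, hx⟩
    apply big_of_infinite L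
    intro hf
    obtain ⟨y, hy, hymin⟩ := Set.exists_min_image _ id (ha p') ⟨x, hx⟩
    have hT0 : ∀ z, p' < z → z < y → T z p' := fun z h1 h2 =>
      ⟨h1, ⟨x, hx⟩, fun w hw => h2.trans_le (hymin w hw)⟩
    obtain ⟨z, hz1, hz2⟩ := exists_between hy.2.1
    obtain ⟨a, _, _, hGa⟩ := claim p' z (hT0 z hz1 hz2)
    obtain ⟨m, hm, hmmin⟩ := Set.exists_min_image _ id hf ⟨a, hGa⟩
    obtain ⟨w, hw1, hw2⟩ := exists_between (lt_min hm.1.1 hy.2.1)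
    obtain ⟨a', h1, h2, hGa'⟩ := claim p' w (hT0 w hw1 (hw2.trans_le (min_le_right _ _)))
    exact absurd (h2.trans_lt (hw2.trans_le (min_le_left _ _))) (not_lt.2 (hmmin a' hGa'))
  refine FL L G ?_ ?_
  · intro a b b' h h'
    exact le_antisymm (h'.2 _ h.1) (h.2 _ h'.1)
  · obtain ⟨a, h1, h2⟩ := exists_between hpq
    obtain ⟨η, hη, hη'⟩ := hb a h1 h2
    exact ⟨η, a, hη, fun p' h1 h2 => hGB p' ⟨a, hη' p' h1 h2⟩⟩

/-- definable selection on a big set -/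
theorem DS (Q : M → M → Prop) [hd : Dfn2 L M Q] (hB : Big (fun a => ∃ b, Q a b)) :
    ∃ G : M → M → Prop, Dfn2 L M G ∧ (∀ a b b', G a b → G a b' → b = b') ∧
      (∀ a b, G a b → Q a b) ∧ Big (fun a => ∃ b, G a b) := by
  have : Big (fun a => (Big (fun b => Q a b)) ∨ ((∃ b, Q a b) ∧ ¬ Big (fun b => Q a b))) :=
    hB.mono fun a ha => by tauto
  rcases big_or L _ _ this with h | h
  · obtain ⟨c, hc⟩ := F2 L Q h
    exact ⟨fun a b => b = c ∧ Q a b, ⟨by infer_instance⟩, fun a b b' h h' => h.1.trans h'.1.symm,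
      fun a b h => h.2, hc.mono fun a ha => ⟨c, rfl, ha⟩⟩
  · refine ⟨fun a b => Q a b ∧ ¬ Big (fun b => Q a b) ∧ ∀ b', Q a b' → b ≤ b', ⟨by infer_instance⟩,
      fun a b b' h h' => le_antisymm (h.2.2 _ h'.1) (h'.2.2 _ h.1), fun a b h => h.1, h.mono ?_⟩
    rintro a ⟨⟨b, hb⟩, hn⟩
    obtain ⟨m, hm, hmin⟩ := Set.exists_min_image _ id (finite_of_not_big L _ hn) ⟨b, hb⟩
    exact ⟨m, hm, hn, hmin⟩
end two
end OMin

end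
section
set_option synthInstance.maxHeartbeats 400000
set_option synthInstance.maxSize 40000
set_option linter.unusedVariables false
set_option linter.unusedSectionVars false
set_option linter.style.haveILetI false
namespace OMin
section three
variable (L : FirstOrder.Language.{u1,u2}) {M : Type u} [L.Structure M] [LinearOrder M] [OM L M]
  [DenselyOrdered M] [NoMinOrder M] [NoMaxOrder M] [Nonempty M]
variable {X Y Z W : Type u} [hX : MSp M X] [hY : MSp M Y] [hZ : MSp M Z] [hW : MSp M W]

theorem Big.avoid {P Q : M → Prop} (h : Big P) (hQ : ¬ Big Q) [Dfn L M P] [Dfn L M Q] :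
    Big (fun a => P a ∧ ¬ Q a) := by
  have : Big (fun a => Q a ∨ (P a ∧ ¬ Q a)) := h.mono fun a ha => by tauto
  exact (big_or L _ _ this).resolve_left hQ

/-- continuity of a definable partial function given by its graph -/
def Cont (a : M) (G : M → M → Prop) : Prop :=
  (∀ b b1 b2, G a b → b1 < b → b < b2 → Near a (fun e => ∃ b', G e b' ∧ b1 < b' ∧ b' < b2)) ∧
  ((∃ b, G a b) ∨ Near a (fun e => ¬ ∃ b, G e b))

variable {L} in
instance dfnCont (f : X → M) [DMap L M f] (P : X → M → M → Prop)
    [h : Dfn L M (fun p : X × M × M => P p.1 p.2.1 p.2.2)] :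
    Dfn L M (fun x => Cont (f x) (P x)) := by
  have : Dfn3 L M P := ⟨h⟩
  unfold Cont; infer_instance

theorem GCup (G : M → M → Prop) [Dfn2 L M G] (hG : ∀ a b b', G a b → G a b' → b = b') :
    ¬ Big (fun a => ∃ b, G a b ∧ ∃ b1, b1 < b ∧ ¬ Near a (fun e => ∃ b', G e b' ∧ b1 < b')) := by
  intro hB
  have : Big (fun a => Big (fun b1 => ∃ b, G a b ∧ b1 < b ∧
      ¬ Near a (fun e => ∃ b', G e b' ∧ b1 < b'))) := hB.mono (by
    rintro a ⟨b, hb, b1, h1, hn⟩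
    exact ⟨b1, b, h1, fun c hc1 hc2 => ⟨b, hb, hc2, fun hN => hn (hN.mono fun e ⟨b', h, h'⟩ =>
      ⟨b', h, hc1.trans h'⟩)⟩⟩)
  obtain ⟨c, hc⟩ := F2 L (fun a b1 => ∃ b, G a b ∧ b1 < b ∧
      ¬ Near a (fun e => ∃ b', G e b' ∧ b1 < b')) (hd := ⟨by infer_instance⟩) this
  obtain ⟨a, ha⟩ := hc.near
  obtain ⟨b, hb, h1, hn⟩ := ha.self
  exact hn (ha.mono fun e ⟨b', h, h', _⟩ => ⟨b', h, h'⟩)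

theorem GCdown (G : M → M → Prop) [Dfn2 L M G] (hG : ∀ a b b', G a b → G a b' → b = b') :
    ¬ Big (fun a => ∃ b, G a b ∧ ∃ b1, b < b1 ∧ ¬ Near a (fun e => ∃ b', G e b' ∧ b' < b1)) := by
  intro hB
  have : Big (fun a => Big (fun b1 => ∃ b, G a b ∧ b < b1 ∧
      ¬ Near a (fun e => ∃ b', G e b' ∧ b' < b1))) := hB.mono (by
    rintro a ⟨b, hb, b1, h1, hn⟩
    exact ⟨b, b1, h1, fun c hc1 hc2 => ⟨b, hb, hc1, fun hN => hn (hN.mono fun e ⟨b', h, h'⟩ =>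
      ⟨b', h, h'.trans hc2⟩)⟩⟩)
  obtain ⟨c, hc⟩ := F2 L (fun a b1 => ∃ b, G a b ∧ b < b1 ∧
      ¬ Near a (fun e => ∃ b', G e b' ∧ b' < b1)) (hd := ⟨by infer_instance⟩) this
  obtain ⟨a, ha⟩ := hc.near
  obtain ⟨b, hb, h1, hn⟩ := ha.self
  exact hn (ha.mono fun e ⟨b', h, h', _⟩ => ⟨b', h, h'⟩)

theorem not_big_not_cont (G : M → M → Prop) [hd : Dfn2 L M G] (hG : ∀ a b b', G a b → G a b' → b = b') :
    ¬ Big (fun a => ¬ Cont a G) := by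
  intro hB
  have h1 := (hB.avoid L (GCup L G hG)).avoid L (GCdown L G hG)
  have h2 := h1.avoid L (not_big_bd L (fun a => ∃ b, G a b))
  obtain ⟨a, ⟨⟨h1, h2⟩, h3⟩, h4⟩ := h2.exists
  apply h1
  constructor
  · intro b b1 b2 hb hb1 hb2
    have h5 : Near a (fun e => ∃ b', G e b' ∧ b1 < b') := by
      by_contra h; exact h2 ⟨b, hb, b1, hb1, h⟩
    have h6 : Near a (fun e => ∃ b', G e b' ∧ b' < b2) := by
      by_contra h; exact h3 ⟨b, hb, b2, hb2, h⟩
    refine (h5.and h6).mono ?_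
    rintro e ⟨⟨x, hx, hx'⟩, y, hy, hy'⟩
    obtain rfl := hG _ _ _ hx hy
    exact ⟨x, hx, hx', hy'⟩
  · by_contra h
    push Not at h
    exact h4 ⟨fun hn => by obtain ⟨b, hb⟩ := hn.self; exact h.1 b hb, by simpa using h.2⟩

/-- `a` is a good point for the family `D` of finite sets. -/
structure Good (a : M) (D : M → M → Prop) : Prop where
  up : ∃ c, Near a (fun e => ∀ y, D e y → y < c)
  down : ∃ c, Near a (fun e => ∀ y, D e y → c < y)
  out : ∀ b, ¬ D a b → ∃ b1 b2, b1 < b ∧ b < b2 ∧ Near a (fun e => ∀ y, b1 < y → y < b2 → ¬ D e y)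
  inn : ∀ b, D a b → ∃ c1 c2, c1 < b ∧ b < c2 ∧ ∀ b1 b2, c1 ≤ b1 → b1 < b → b < b2 → b2 ≤ c2 →
    Near a (fun e => ∃ y, b1 < y ∧ y < b2 ∧ D e y ∧ ∀ y', b1 < y' → y' < b2 → D e y' → y' = y)

theorem good_iff (a : M) (D : M → M → Prop) : Good a D ↔
  (∃ c, Near a (fun e => ∀ y, D e y → y < c)) ∧
  (∃ c, Near a (fun e => ∀ y, D e y → c < y)) ∧
  (∀ b, ¬ D a b → ∃ b1 b2, b1 < b ∧ b < b2 ∧ Near a (fun e => ∀ y, b1 < y → y < b2 → ¬ D e y)) ∧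
  (∀ b, D a b → ∃ c1 c2, c1 < b ∧ b < c2 ∧ ∀ b1 b2, c1 ≤ b1 → b1 < b → b < b2 → b2 ≤ c2 →
    Near a (fun e => ∃ y, b1 < y ∧ y < b2 ∧ D e y ∧ ∀ y', b1 < y' → y' < b2 → D e y' → y' = y)) :=
  ⟨fun h => ⟨h.1, h.2, h.3, h.4⟩, fun h => ⟨h.1, h.2.1, h.2.2.1, h.2.2.2⟩⟩

variable {L} in
instance dfnGood (f : X → M) [DMap L M f] (P : X → M → M → Prop)
    [h : Dfn L M (fun p : X × M × M => P p.1 p.2.1 p.2.2)] :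
    Dfn L M (fun x => Good (f x) (P x)) := by
  have : Dfn3 L M P := ⟨h⟩
  have : Dfn L M (fun p : X × M => Good p.2 (P p.1)) := by
    simp only [good_iff]
    have h1 : Dfn4 L M (fun (x : X) (e b1 b2 : M) => ∃ y, b1 < y ∧ y < b2 ∧ P x e y ∧
        ∀ y', b1 < y' → y' < b2 → P x e y' → y' = y) := ⟨by infer_instance⟩
    have h2 : Dfn4 L M (fun (x : X) (a b1 b2 : M) => Near a (fun e => ∃ y, b1 < y ∧ y < b2 ∧ P x e y ∧
        ∀ y', b1 < y' → y' < b2 → P x e y' → y' = y)) := ⟨by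
          have := fun (X : Type u) [MSp M X] (f : X → _) [DMap L M f] => h1.out.comp f
          infer_instance⟩
    have h3 := fun (W : Type u) [MSp M W] (f : W → X) (g k l : W → M) [DMap L M f] [DMap L M g]
      [DMap L M k] [DMap L M l] => h2.out.comp (fun w => (f w, g w, k w, l w))
    dsimp only at h3
    have h4 : Dfn L M (fun p : X × M => ∀ b, P p.1 p.2 b → ∃ c1 c2, c1 < b ∧ b < c2 ∧ ∀ b1 b2, c1 ≤ b1 → b1 < b → b < b2 → b2 ≤ c2 →
       Near p.2 (fun e => ∃ y, b1 < y ∧ y < b2 ∧ P p.1 e y ∧ ∀ y', b1 < y' → y' < b2 → P p.1 e y' → y' = y)) := by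
      infer_instance
    have h5 : Dfn L M (fun p : X × M => ∀ b, ¬ P p.1 p.2 b → ∃ b1 b2, b1 < b ∧ b < b2 ∧
      Near p.2 (fun e => ∀ y, b1 < y → y < b2 → ¬ P p.1 e y)) := by
      infer_instance
    infer_instance
  exact this.comp (fun x => (x, f x))

theorem exists_max_of_finite {P : M → Prop} (hf : {x | P x}.Finite) (hne : ∃ x, P x) :
    ∃ m, P m ∧ ∀ x, P x → x ≤ m := by
  obtain ⟨m, hm, h⟩ := Set.exists_max_image _ id hf hne
  exact ⟨m, hm, h⟩
theorem exists_min_of_finite {P : M → Prop} (hf : {x | P x}.Finite) (hne : ∃ x, P x) :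
    ∃ m, P m ∧ ∀ x, P x → m ≤ x := by
  obtain ⟨m, hm, h⟩ := Set.exists_min_image _ id hf hne
  exact ⟨m, hm, h⟩

section good

theorem bad_up (D : M → M → Prop) [hD : Dfn2 L M D] (hf : ∀ a, {b | D a b}.Finite) : ¬ Big (fun a => ¬ ∃ c, Near a (fun e => ∀ y, D e y → y < c)) := by
  intro hB
  have h := hB.avoid L (not_big_not_cont L (fun a b => D a b ∧ ∀ y, D a y → y ≤ b) (hd := ⟨by infer_instance⟩)
    (fun a b b' h h' => le_antisymm (h'.2 _ h.1) (h.2 _ h'.1)))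
  obtain ⟨a, h1, h2⟩ := h.exists
  rw [not_not] at h2
  apply h1
  rcases h2.2 with ⟨b, hb⟩ | hn
  · obtain ⟨c, hc⟩ := exists_gt b
    obtain ⟨d, hd⟩ := exists_lt b
    exact ⟨c, (h2.1 b d c hb hd hc).mono fun e ⟨b', hb', _, hc'⟩ y hy => (hb'.2 y hy).trans_lt hc'⟩
  · refine ⟨a, hn.mono fun e he y hy => ?_⟩
    obtain ⟨m, hm⟩ := exists_max_of_finite (hf e) ⟨y, hy⟩
    exact (he ⟨m, hm⟩).elim

theorem bad_down (D : M → M → Prop) [hD : Dfn2 L M D] (hf : ∀ a, {b | D a b}.Finite) : ¬ Big (fun a => ¬ ∃ c, Near a (fun e => ∀ y, D e y → c < y)) := by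
  intro hB
  have h := hB.avoid L (not_big_not_cont L (fun a b => D a b ∧ ∀ y, D a y → b ≤ y) (hd := ⟨by infer_instance⟩)
    (fun a b b' h h' => le_antisymm (h.2 _ h'.1) (h'.2 _ h.1)))
  obtain ⟨a, h1, h2⟩ := h.exists
  rw [not_not] at h2
  apply h1
  rcases h2.2 with ⟨b, hb⟩ | hn
  · obtain ⟨c, hc⟩ := exists_gt b
    obtain ⟨d, hd⟩ := exists_lt b
    exact ⟨d, (h2.1 b d c hb hd hc).mono fun e ⟨b', hb', hc', _⟩ y hy => hc'.trans_le (hb'.2 y hy)⟩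
  · refine ⟨a, hn.mono fun e he y hy => ?_⟩
    obtain ⟨m, hm⟩ := exists_min_of_finite (hf e) ⟨y, hy⟩
    exact (he ⟨m, hm⟩).elim

/-- main generic statement: a definable partial function avoids its neighbours in `D` -/
theorem gap (D : M → M → Prop) [hD : Dfn2 L M D] (hf : ∀ a, {b | D a b}.Finite) (G : M → M → Prop) [Dfn2 L M G] (hG : ∀ a b b', G a b → G a b' → b = b')
    (hB : Big (fun a => ∃ b, G a b)) :
    Big (fun a => ∃ b, G a b ∧ ∃ c1 c2, c1 < b ∧ b < c2 ∧ ∀ b1 b2, c1 ≤ b1 → b1 < b → b < b2 → b2 ≤ c2 →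
      Near a (fun e => ∃ b', G e b' ∧ b1 < b' ∧ b' < b2 ∧ ∀ y, b1 < y → y < b2 → D e y → y = b')) := by
  let G1 : M → M → Prop := fun a b' => ∃ b, G a b ∧ (D a b' ∧ b' < b) ∧ ∀ y, D a y ∧ y < b → y ≤ b'
  let G2 : M → M → Prop := fun a b' => ∃ b, G a b ∧ (D a b' ∧ b < b') ∧ ∀ y, D a y ∧ b < y → b' ≤ y
  have : Dfn2 L M G1 := ⟨by infer_instance⟩
  have : Dfn2 L M G2 := ⟨by infer_instance⟩
  have hG1 : ∀ a b b', G1 a b → G1 a b' → b = b' := by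
    rintro a b b' ⟨x, hx, h1, h2⟩ ⟨x', hx', h1', h2'⟩
    obtain rfl := hG _ _ _ hx hx'
    exact le_antisymm (h2' _ h1) (h2 _ h1')
  have hG2 : ∀ a b b', G2 a b → G2 a b' → b = b' := by
    rintro a b b' ⟨x, hx, h1, h2⟩ ⟨x', hx', h1', h2'⟩
    obtain rfl := hG _ _ _ hx hx'
    exact le_antisymm (h2 _ h1') (h2' _ h1)
  have h := ((hB.avoid L (not_big_not_cont L G hG)).avoid L (not_big_not_cont L G1 hG1)).avoid L
    (not_big_not_cont L G2 hG2)
  refine h.mono ?_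
  rintro a ⟨⟨⟨⟨b, hb⟩, hc⟩, hc1⟩, hc2⟩
  rw [not_not] at hc hc1 hc2
  refine ⟨b, hb, ?_⟩
  have L1 : ∃ c1, c1 < b ∧ Near a (fun e => ∀ b', G e b' → ∀ y, c1 < y → y < b' → ¬ D e y) := by
    rcases hc1.2 with ⟨b', hb'⟩ | hn
    · have hb'b : b' < b := by
        obtain ⟨b0, h0, h1, h2⟩ := hb'
        obtain rfl := hG _ _ _ hb h0
        exact h1.2
      obtain ⟨c1, h1, h2⟩ := exists_between hb'b
      obtain ⟨d, hd⟩ := exists_lt b'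
      refine ⟨c1, h2, (hc1.1 b' d c1 hb' hd h1).mono ?_⟩
      rintro e ⟨z, ⟨b0, h0, h3, h4⟩, hz1, hz2⟩ w hw y hy1 hy2 hD
      obtain rfl := hG _ _ _ hw h0
      exact absurd (h4 y ⟨hD, hy2⟩) (not_le.2 (hz2.trans hy1))
    · obtain ⟨c1, h1⟩ := exists_lt b
      refine ⟨c1, h1, hn.mono ?_⟩
      intro e he w hw y hy1 hy2 hD
      obtain ⟨m, hm, hmax⟩ := exists_max_of_finite (P := fun y => D e y ∧ y < w)
        ((hf e).subset fun x hx => hx.1) ⟨y, hD, hy2⟩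
      exact he ⟨m, w, hw, hm, hmax⟩
  have L2 : ∃ c1, b < c1 ∧ Near a (fun e => ∀ b', G e b' → ∀ y, b' < y → y < c1 → ¬ D e y) := by
    rcases hc2.2 with ⟨b', hb'⟩ | hn
    · have hb'b : b < b' := by
        obtain ⟨b0, h0, h1, h2⟩ := hb'
        obtain rfl := hG _ _ _ hb h0
        exact h1.2
      obtain ⟨c1, h1, h2⟩ := exists_between hb'b
      obtain ⟨d, hd⟩ := exists_gt b'
      refine ⟨c1, h1, (hc2.1 b' c1 d hb' h2 hd).mono ?_⟩
      rintro e ⟨z, ⟨b0, h0, h3, h4⟩, hz1, hz2⟩ w hw y hy1 hy2 hD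
      obtain rfl := hG _ _ _ hw h0
      exact absurd (h4 y ⟨hD, hy1⟩) (not_le.2 (hy2.trans hz1))
    · obtain ⟨c1, h1⟩ := exists_gt b
      refine ⟨c1, h1, hn.mono ?_⟩
      intro e he w hw y hy1 hy2 hD
      obtain ⟨m, hm, hmax⟩ := exists_min_of_finite (P := fun y => D e y ∧ w < y)
        ((hf e).subset fun x hx => hx.1) ⟨y, hD, hy1⟩
      exact he ⟨m, w, hw, hm, hmax⟩
  obtain ⟨c1, h1, hN1⟩ := L1
  obtain ⟨c2, h2, hN2⟩ := L2
  refine ⟨c1, c2, h1, h2, fun b1 b2 hb1 hb1' hb2 hb2' => ?_⟩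
  refine ((hc.1 b b1 b2 hb hb1' hb2).and (hN1.and hN2)).mono ?_
  rintro e ⟨⟨b', hb', hlt1, hlt2⟩, hA, hB⟩
  refine ⟨b', hb', hlt1, hlt2, fun y hy1 hy2 hD => ?_⟩
  by_contra hne
  rcases lt_or_gt_of_ne hne with h | h
  · exact hA b' hb' y (hb1.trans_lt hy1) h hD
  · exact hB b' hb' y h (hy2.trans_le hb2') hD

theorem bad_out (D : M → M → Prop) [hD : Dfn2 L M D] (hf : ∀ a, {b | D a b}.Finite) : ¬ Big (fun a => ¬ ∀ b, ¬ D a b → ∃ b1 b2, b1 < b ∧ b < b2 ∧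
    Near a (fun e => ∀ y, b1 < y → y < b2 → ¬ D e y)) := by
  intro hB
  obtain ⟨G, hGd, hG, hGQ, hGB⟩ := DS L (fun a b => ¬ D a b ∧ ¬ ∃ b1 b2, b1 < b ∧ b < b2 ∧
    Near a (fun e => ∀ y, b1 < y → y < b2 → ¬ D e y)) (hd := ⟨by infer_instance⟩) (hB.mono (by
      intro a ha; push Not at ha ⊢; exact ha))
  obtain ⟨a, b, hb, c1, c2, h1, h2, hN⟩ := (gap L D hf G hG hGB).exists
  obtain ⟨h3, h4⟩ := hGQ a b hb
  refine h4 ⟨c1, c2, h1, h2, (hN c1 c2 le_rfl h1 h2 le_rfl).mono ?_⟩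
  rintro e ⟨b', hb', _, _, h⟩ y hy1 hy2 hD
  obtain rfl := h y hy1 hy2 hD
  exact (hGQ e _ hb').1 hD

theorem bad_inn (D : M → M → Prop) [hD : Dfn2 L M D] (hf : ∀ a, {b | D a b}.Finite) : ¬ Big (fun a => ¬ ∀ b, D a b → ∃ c1 c2, c1 < b ∧ b < c2 ∧
    ∀ b1 b2, c1 ≤ b1 → b1 < b → b < b2 → b2 ≤ c2 →
    Near a (fun e => ∃ y, b1 < y ∧ y < b2 ∧ D e y ∧ ∀ y', b1 < y' → y' < b2 → D e y' → y' = y)) := by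
  intro hB
  obtain ⟨G, hGd, hG, hGQ, hGB⟩ := DS L (fun a b => D a b ∧ ¬ ∃ c1 c2, c1 < b ∧ b < c2 ∧
    ∀ b1 b2, c1 ≤ b1 → b1 < b → b < b2 → b2 ≤ c2 →
    Near a (fun e => ∃ y, b1 < y ∧ y < b2 ∧ D e y ∧ ∀ y', b1 < y' → y' < b2 → D e y' → y' = y))
    (hd := ⟨by infer_instance⟩) (hB.mono (by
      intro a ha; push Not at ha ⊢; exact ha))
  obtain ⟨a, b, hb, c1, c2, h1, h2, hN⟩ := (gap L D hf G hG hGB).exists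
  obtain ⟨h3, h4⟩ := hGQ a b hb
  refine h4 ⟨c1, c2, h1, h2, fun b1 b2 hb1 hb1' hb2 hb2' => (hN b1 b2 hb1 hb1' hb2 hb2').mono ?_⟩
  rintro e ⟨b', hb', h5, h6, h⟩
  exact ⟨b', h5, h6, (hGQ e _ hb').1, h⟩

theorem not_big_bad (D : M → M → Prop) [hD : Dfn2 L M D] (hf : ∀ a, {b | D a b}.Finite) : ¬ Big (fun a => ¬ Good a D) := by
  intro hB
  have h := (((hB.avoid L (bad_up L D hf)).avoid L (bad_down L D hf)).avoid L (bad_out L D hf)).avoid L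
    (bad_inn L D hf)
  obtain ⟨a, ⟨⟨⟨h1, h2⟩, h3⟩, h4⟩, h5⟩ := h.exists
  exact h1 ⟨not_not.1 h2, not_not.1 h3, not_not.1 h4, not_not.1 h5⟩

theorem lemK (D : M → M → Prop) [hD : Dfn2 L M D] {a : M} (ha : Good a D) (u v : M) (huv : u ≤ v) (hD : ∀ y, u ≤ y → y ≤ v → ¬ D a y) :
    Near a (fun e => ∀ y, u ≤ y → y ≤ v → ¬ D e y) := by
  refine conn L (fun b => Near a (fun e => ∀ y, u ≤ y → y ≤ b → ¬ D e y)) u v huv ?_ ?_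
  · intro b h1 h2
    obtain ⟨b1, b2, hb1, hb2, hN⟩ := ha.out b (hD b h1 h2)
    have key : ∀ x x', b1 < x → x < b2 → b1 < x' → x' < b2 → Near a (fun e => ∀ y, u ≤ y → y ≤ x → ¬ D e y) →
        Near a (fun e => ∀ y, u ≤ y → y ≤ x' → ¬ D e y) := by
      intro x x' h1 h2 h3 h4 h
      refine (h.and hN).mono fun e ⟨he1, he2⟩ y hy1 hy2 => ?_
      rcases le_or_gt y x with h5 | h5
      · exact he1 y hy1 h5
      · exact he2 y (h1.trans h5) (hy2.trans_lt h4)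
    by_cases hP : Near a (fun e => ∀ y, u ≤ y → y ≤ b → ¬ D e y)
    · exact Or.inl ⟨b1, b2, hb1, hb2, fun e he1 he2 => key b e hb1 hb2 he1 he2 hP⟩
    · exact Or.inr ⟨b1, b2, hb1, hb2, fun e he1 he2 h => hP (key e b he1 he2 hb1 hb2 h)⟩
  · obtain ⟨b1, b2, hb1, hb2, hN⟩ := ha.out u (hD u le_rfl huv)
    exact hN.mono fun e he y hy1 hy2 => he y (hb1.trans_le hy1) (hy2.trans_lt hb2)

theorem lemF1' (D : M → M → Prop) [hD : Dfn2 L M D] (hf : ∀ a, {b | D a b}.Finite) {a : M} (ha : Good a D) (j : ℕ) : ∀ (u : M) (hu : ¬ D a u), ({y | D a y ∧ y < u}).ncard = j →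
    Near a (fun e => ({y | D e y ∧ y < u}).ncard = j) := by
  induction j with
  | zero =>
    intro u hu hc
    have hfin : ({y | D a y ∧ y < u}).Finite := (hf a).subset fun x hx => hx.1
    rw [Set.ncard_eq_zero hfin] at hc
    obtain ⟨c, hN⟩ := ha.down
    have h0 : Near a (fun e => ∀ y, c ≤ y → y ≤ u → ¬ D e y) := by
      rcases le_or_gt c u with h | h
      · apply lemK L D ha c u h
        intro y h1 h2 hD
        rcases h2.eq_or_lt with rfl | h2
        · exact hu hD
        · have : y ∈ {y | D a y ∧ y < u} := ⟨hD, h2⟩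
          rw [hc] at this; exact this
      · obtain ⟨v, hv⟩ := exists_lt a
        obtain ⟨w, hw⟩ := exists_gt a
        exact ⟨v, w, hv, hw, fun e _ _ y h1 h2 => absurd (h1.trans h2) (not_le.2 h)⟩
    refine (hN.and h0).mono fun e ⟨h1, h2⟩ => ?_
    rw [Set.ncard_eq_zero ((hf e).subset fun x hx => hx.1)]
    ext y
    simp only [mem_ofPred_eq, mem_empty_iff_false, iff_false, not_and]
    exact fun hD hlt => h2 y (h1 y hD).le hlt.le hD
  | succ j ih =>
    intro u hu hc
    have hfin : ({y | D a y ∧ y < u}).Finite := (hf a).subset fun x hx => hx.1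
    have hne : ∃ y, D a y ∧ y < u := by
      by_contra h
      push Not at h
      have : {y | D a y ∧ y < u} = ∅ := by
        ext y; simpa using h y
      rw [this] at hc; simp at hc
    obtain ⟨b, ⟨hb, hbu⟩, hmax⟩ := exists_max_of_finite hfin hne
    obtain ⟨c1, c2, hc1, hc2, hN⟩ := ha.inn b hb
    have h1 : ∃ b1, c1 < b1 ∧ b1 < b ∧ ∀ y, D a y → b1 ≤ y → b ≤ y := by
      by_cases hp : ∃ y, D a y ∧ y < b
      · obtain ⟨m, ⟨hm, hmb⟩, hmm⟩ := exists_max_of_finite (P := fun y => D a y ∧ y < b)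
          ((hf a).subset fun x hx => hx.1) hp
        obtain ⟨b1, h1, h2⟩ := exists_between (max_lt hc1 hmb)
        refine ⟨b1, (le_max_left _ _).trans_lt h1, h2, fun y hy hy1 => ?_⟩
        by_contra hlt
        rw [not_le] at hlt
        exact absurd (hmm y ⟨hy, hlt⟩) (not_le.2 (((le_max_right _ _).trans_lt h1).trans_le hy1))
      · obtain ⟨b1, h1, h2⟩ := exists_between hc1
        refine ⟨b1, h1, h2, fun y hy hy1 => ?_⟩
        by_contra hlt
        exact hp ⟨y, hy, not_le.1 hlt⟩
    obtain ⟨b1, hb1, hb1b, hgap⟩ := h1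
    obtain ⟨b2, hb2, hb2'⟩ := exists_between (lt_min hc2 hbu)
    have hb2u := hb2'.trans_le (min_le_right _ _)
    have hb1D : ¬ D a b1 := fun h => absurd (hgap b1 h le_rfl) (not_le.2 hb1b)
    have h3 := hN b1 b2 hb1.le hb1b hb2 (hb2'.le.trans (min_le_left _ _))
    have h4 := lemK L D ha b2 u hb2u.le (by
      intro y h1 h2 hD
      rcases h2.eq_or_lt with rfl | h2
      · exact hu hD
      · exact absurd (hmax y ⟨hD, h2⟩) (not_le.2 (hb2.trans_le h1)))
    have h4' := lemK L D ha b1 b1 le_rfl (by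
      intro y h1 h2 hD
      exact hb1D (le_antisymm h2 h1 ▸ hD))
    have hcard : ({y | D a y ∧ y < b1}).ncard = j := by
      have : {y | D a y ∧ y < u} = insert b {y | D a y ∧ y < b1} := by
        ext y
        simp only [mem_ofPred_eq, mem_insert_iff]
        constructor
        · rintro ⟨hD, hy⟩
          rcases lt_or_ge y b1 with h | h
          · exact Or.inr ⟨hD, h⟩
          · exact Or.inl (le_antisymm (hmax y ⟨hD, hy⟩) (hgap y hD h))
        · rintro (rfl | ⟨hD, hy⟩)
          · exact ⟨hb, hbu⟩
          · exact ⟨hD, hy.trans (hb1b.trans hbu)⟩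
      rw [this, Set.ncard_insert_of_notMem (fun h => absurd h.2 (not_lt.2 hb1b.le))
        ((hf a).subset fun x hx => hx.1)] at hc
      omega
    have h5 := ih b1 hb1D hcard
    refine (h3.and (h4.and (h4'.and h5))).mono ?_
    rintro e ⟨⟨y, hy1, hy2, hyD, hyu⟩, he4, he4', he5⟩
    have : {y | D e y ∧ y < u} = insert y {y | D e y ∧ y < b1} := by
      ext z
      simp only [mem_ofPred_eq, mem_insert_iff]
      constructor
      · rintro ⟨hD, hz⟩
        rcases lt_trichotomy z b1 with h | rfl | h
        · exact Or.inr ⟨hD, h⟩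
        · exact (he4' _ le_rfl le_rfl hD).elim
        · rcases lt_or_ge z b2 with h' | h'
          · exact Or.inl (hyu z h h' hD)
          · exact (he4 z h' hz.le hD).elim
      · rintro (rfl | ⟨hD, hy⟩)
        · exact ⟨hyD, hy2.trans hb2u⟩
        · exact ⟨hD, hy.trans (hb1b.trans hbu)⟩
    rw [this, Set.ncard_insert_of_notMem (fun h => absurd h.2 (not_lt.2 hy1.le))
        ((hf e).subset fun x hx => hx.1), he5]

theorem lemF1 (D : M → M → Prop) [hD : Dfn2 L M D] (hf : ∀ a, {b | D a b}.Finite) {a : M} (ha : Good a D) : Near a (fun e => ({y | D e y}).ncard = ({y | D a y}).ncard) := by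
  obtain ⟨c, hN⟩ := ha.up
  have h0 : ∀ e, (∀ y, D e y → y < c) → {y | D e y ∧ y < c} = {y | D e y} := by
    intro e he
    ext y
    exact ⟨fun h => h.1, fun h => ⟨h, he y h⟩⟩
  have h1 := lemF1' L D hf ha _ c (fun h => absurd (hN.self c h) (lt_irrefl _)) rfl
  refine (hN.and h1).mono fun e ⟨he1, he2⟩ => ?_
  rwa [h0 e he1, h0 a hN.self] at he2

end good
end three
end OMin

end
section
set_option synthInstance.maxHeartbeats 400000
set_option synthInstance.maxSize 40000
set_option linter.unusedVariables false
set_option linter.unusedSectionVars false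
set_option linter.style.haveILetI false
namespace OMin
section four
variable (L : FirstOrder.Language.{u1,u2}) {M : Type u} [L.Structure M] [LinearOrder M] [OM L M]
  [DenselyOrdered M] [NoMinOrder M] [NoMaxOrder M] [Nonempty M]
variable {X Y Z W : Type u} [hX : MSp M X] [hY : MSp M Y] [hZ : MSp M Z] [hW : MSp M W]

/-- `S` has at least `j` elements -/
def GEn : ℕ → (M → Prop) → Prop
  | 0, _ => True
  | j+1, S => ∃ b, S b ∧ GEn j (fun c => c < b ∧ S c)

theorem dfnGEn_aux (j : ℕ) : ∀ {X : Type u} [MSp M X] (P : X → M → Prop),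
    Dfn L M (fun p : X × M => P p.1 p.2) → Dfn L M (fun x => GEn j (P x)) := by
  induction j with
  | zero => intro X _ P h; exact dfnConst True
  | succ j ih =>
    intro X _ P h
    have : Dfn2 L M P := ⟨h⟩
    have := ih (fun (p : X × M) c => c < p.2 ∧ P p.1 c) inferInstance
    unfold GEn; infer_instance

theorem GEn_iff (j : ℕ) : ∀ (S : M → Prop), {x | S x}.Finite → (GEn j S ↔ j ≤ {x | S x}.ncard) := by
  induction j with
  | zero => intro S h; simp [GEn]
  | succ j ih =>
    intro S h
    have hfin : ∀ b, {x | x < b ∧ S x}.Finite := fun b => h.subset fun x hx => hx.2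
    constructor
    · rintro ⟨b, hb, h1⟩
      rw [ih _ (hfin b)] at h1
      have h2 : insert b {x | x < b ∧ S x} ⊆ {x | S x} := by
        rintro x (rfl | hx)
        · exact hb
        · exact hx.2
      have h3 := Set.ncard_le_ncard h2 h
      rw [Set.ncard_insert_of_notMem (fun h => absurd h.1 (lt_irrefl _)) (hfin b)] at h3
      omega
    · intro hj
      have hne : ∃ x, S x := by
        by_contra hne
        push Not at hne
        have : {x | S x} = ∅ := by ext x; simpa using hne x
        rw [this] at hj; simp at hj
      obtain ⟨b, hb, hmax⟩ := exists_max_of_finite h hne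
      refine ⟨b, hb, ?_⟩
      rw [ih _ (hfin b)]
      have h2 : {x | S x} = insert b {x | x < b ∧ S x} := by
        ext x
        constructor
        · intro hx
          rcases (hmax x hx).eq_or_lt with rfl | h
          · exact Or.inl rfl
          · exact Or.inr ⟨h, hx⟩
        · rintro (rfl | hx)
          · exact hb
          · exact hx.2
      rw [h2, Set.ncard_insert_of_notMem (fun h => absurd h.1 (lt_irrefl _)) (hfin b)] at hj
      omega

/-- `S` has exactly `j` elements -/
def Card (j : ℕ) (S : M → Prop) : Prop := GEn j S ∧ ¬ GEn (j+1) S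

theorem card_iff (j : ℕ) (S : M → Prop) (h : {x | S x}.Finite) : Card j S ↔ {x | S x}.ncard = j := by
  rw [Card, GEn_iff _ _ h, GEn_iff _ _ h]; omega

variable {L} in
instance dfnCard (j : ℕ) (P : X → M → Prop) [h : Dfn L M (fun p : X × M => P p.1 p.2)] :
    Dfn L M (fun x => Card j (P x)) := by
  have := dfnGEn_aux L j P h
  have := dfnGEn_aux L (j+1) P h
  unfold Card; infer_instance

/-- `e` has rank `j` with respect to the finite set `S` -/
def Rk (j : ℕ) (e : M) (S : M → Prop) : Prop := Card j (fun b => S b ∧ b < e)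

variable {L} in
instance dfnRk (j : ℕ) (f : X → M) [DMap L M f] (P : X → M → Prop) [h : Dfn L M (fun p : X × M => P p.1 p.2)] :
    Dfn L M (fun x => Rk j (f x) (P x)) := by
  have : Dfn2 L M P := ⟨h⟩
  unfold Rk; infer_instance

theorem rk_iff (j : ℕ) (e : M) (S : M → Prop) (h : {x | S x}.Finite) :
    Rk j e S ↔ {b | S b ∧ b < e}.ncard = j :=
  card_iff _ _ (h.subset fun x hx => hx.1)

theorem cell_near (S : M → Prop) (h : {x | S x}.Finite) (e : M) (he : ¬ S e) :
    Near e (fun e' => ¬ S e' ∧ {b | S b ∧ b < e'} = {b | S b ∧ b < e}) := by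
  have h1 : ∃ u, u < e ∧ ∀ b, S b → b < e → b ≤ u := by
    by_cases hp : ∃ b, S b ∧ b < e
    · obtain ⟨m, hm, hmax⟩ := exists_max_of_finite (P := fun b => S b ∧ b < e) (h.subset fun x hx => hx.1) hp
      exact ⟨m, hm.2, fun b hb hbe => hmax b ⟨hb, hbe⟩⟩
    · obtain ⟨u, hu⟩ := exists_lt e
      exact ⟨u, hu, fun b hb hbe => (hp ⟨b, hb, hbe⟩).elim⟩
  have h2 : ∃ u, e < u ∧ ∀ b, S b → e < b → u ≤ b := by
    by_cases hp : ∃ b, S b ∧ e < b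
    · obtain ⟨m, hm, hmax⟩ := exists_min_of_finite (P := fun b => S b ∧ e < b) (h.subset fun x hx => hx.1) hp
      exact ⟨m, hm.2, fun b hb hbe => hmax b ⟨hb, hbe⟩⟩
    · obtain ⟨u, hu⟩ := exists_gt e
      exact ⟨u, hu, fun b hb hbe => (hp ⟨b, hb, hbe⟩).elim⟩
  obtain ⟨u, hu, hu'⟩ := h1
  obtain ⟨v, hv, hv'⟩ := h2
  have key : ∀ b, S b → b ≤ u ∨ v ≤ b := by
    intro b hb
    rcases lt_trichotomy b e with h | rfl | h
    · exact Or.inl (hu' b hb h)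
    · exact (he hb).elim
    · exact Or.inr (hv' b hb h)
  refine ⟨u, v, hu, hv, fun e' h1 h2 => ⟨fun hS => ?_, ?_⟩⟩
  · rcases key _ hS with h | h
    · exact absurd h (not_le.2 h1)
    · exact absurd h (not_le.2 h2)
  · ext b
    constructor
    · rintro ⟨hb, hlt⟩
      refine ⟨hb, ?_⟩
      rcases key _ hb with h | h
      · exact h.trans_lt hu
      · exact absurd (h.trans_lt hlt) (not_lt.2 h2.le)
    · rintro ⟨hb, hlt⟩
      refine ⟨hb, ?_⟩
      rcases key _ hb with h | h
      · exact h.trans_lt h1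
      · exact absurd (h.trans_lt hlt) (not_lt.2 hv.le)

theorem same_rank (S : M → Prop) (h : {x | S x}.Finite) {j : ℕ} {e e' : M} (hee : e ≤ e')
    (h1 : Rk j e S) (h2 : Rk j e' S) : ∀ b, e ≤ b → b < e' → ¬ S b := by
  rw [rk_iff _ _ _ h] at h1 h2
  intro b hb hb' hS
  have h3 : {b | S b ∧ b < e} ⊂ {b | S b ∧ b < e'} := by
    refine ⟨fun x hx => ⟨hx.1, hx.2.trans_le hee⟩, fun hs => ?_⟩
    have := hs (show b ∈ {b | S b ∧ b < e'} from ⟨hS, hb'⟩)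
    exact absurd this.2 (not_lt.2 hb)
  have := Set.ncard_lt_ncard h3 (h.subset fun x hx => hx.1)
  omega

theorem rk_unique (S : M → Prop) (h : {x | S x}.Finite) {j : ℕ} {e e' : M} (he : S e) (he' : S e')
    (h1 : Rk j e S) (h2 : Rk j e' S) : e = e' := by
  rcases lt_trichotomy e e' with hlt | rfl | hlt
  · exact (same_rank S h hlt.le h1 h2 e le_rfl hlt he).elim
  · rfl
  · exact (same_rank S h hlt.le h2 h1 e' le_rfl hlt he').elim

theorem rk_exists (S : M → Prop) (h : {x | S x}.Finite) (e : M) : ∃ j, j ≤ {x | S x}.ncard ∧ Rk j e S :=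
  ⟨{b | S b ∧ b < e}.ncard, Set.ncard_le_ncard (fun x hx => hx.1) h, (rk_iff _ _ _ h).2 rfl⟩

variable (M) in
/-- uniform finiteness over a space -/
def UF (X : Type u) [MSp M X] : Prop := ∀ D : X → M → Prop, Dfn2 L M D → (∀ x, {b | D x b}.Finite) →
  ∃ K, ∀ x, {b | D x b}.ncard ≤ K

variable (M) in
structure FatStr (W : Type u) [MSp M W] (Fat : (W → Prop) → Prop) : Prop where
  dfn : ∀ {X : Type u} [MSp M X] (P : X → W → Prop), Dfn L M (fun p : X × W => P p.1 p.2) →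
    Dfn L M (fun x => Fat (P x))
  exch : ∀ R : M → W → Prop, Dfn2 L M R → Big (fun e => Fat (R e)) → ∃ w, Big (fun e => R e w)

variable (M) in
/-- the inductive statement -/
def QP (Y W : Type u) [MSp M Y] [MSp M W] : Prop :=
  ∀ Fat : (W → Prop) → Prop, FatStr L M W Fat → ∀ D : Y → W → M → Prop, Dfn3 L M D →
    (∀ y w, {b | D y w b}.Finite) → ∀ E : Y → W → Prop, Dfn2 L M E →
    (∀ y, (∃ w, E y w) → Fat (E y)) →
    (∀ y w w', E y w → E y w' → {b | D y w b}.ncard = {b | D y w' b}.ncard) →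
    ∃ K, ∀ y w, E y w → {b | D y w b}.ncard ≤ K

theorem fat_prod (Fat : (W → Prop) → Prop) (h : FatStr L M W Fat) :
    FatStr L M (M × W) (fun F => Big (fun a => Fat (fun w => F (a, w)))) where
  dfn := by
    intro X _ P hP
    have : Dfn2 L M P := ⟨hP⟩
    have := h.dfn (fun (p : X × M) w => P p.1 (p.2, w)) inferInstance
    infer_instance
  exch := by
    intro R hR hB
    have := h.dfn (fun (p : M × M) w => R p.1 (p.2, w)) inferInstance
    obtain ⟨a, ha⟩ := F2 L (fun e a => Fat (fun w => R e (a, w))) (hd := ⟨this⟩) hB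
    obtain ⟨w, hw⟩ := h.exch (fun e w => R e (a, w)) ⟨by infer_instance⟩ ha
    exact ⟨(a, w), hw⟩

theorem QP_unit : QP L M PUnit.{u+1} W := by
  intro Fat hF D hD hf E hE hEF hN
  by_cases h : ∃ w, E PUnit.unit w
  · obtain ⟨w0, h0⟩ := h
    exact ⟨{b | D PUnit.unit w0 b}.ncard, fun y w hw => (hN y w w0 hw h0).le⟩
  · exact ⟨0, fun y w hw => (h ⟨w, hw⟩).elim⟩

theorem finite_bound {P : ℕ → ℕ → Prop} (hP : ∀ j, ∃ K, P j K) (hm : ∀ j K K', K ≤ K' → P j K → P j K') (n : ℕ) :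
    ∃ K, ∀ j, j ≤ n → P j K := by
  induction n with
  | zero => obtain ⟨K, hK⟩ := hP 0; exact ⟨K, fun j hj => Nat.le_zero.1 hj ▸ hK⟩
  | succ n ih =>
    obtain ⟨K, hK⟩ := ih
    obtain ⟨K', hK'⟩ := hP (n+1)
    refine ⟨max K K', fun j hj => ?_⟩
    rcases Nat.lt_or_ge j (n+1) with h | h
    · exact hm _ _ _ (le_max_left _ _) (hK j (by omega))
    · obtain rfl : j = n+1 := by omega
      exact hm _ _ _ (le_max_right _ _) hK'

theorem QP_step (hUF1 : UF L M Y) (hUF2 : UF L M (Y × W)) (hQ : QP L M Y (M × W)) : QP L M (Y × M) W := by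
  intro Fat hF D0 hD0 hf0 E0 hE0 hEF0 hN0
  let D : Y → M → W → M → Prop := fun y e w b => D0 (y, e) w b
  let E : Y → M → W → Prop := fun y e w => E0 (y, e) w
  have hD : Dfn4 L M D := ⟨by infer_instance⟩
  have hE : Dfn3 L M E := ⟨by infer_instance⟩
  have hf : ∀ y e w, {b | D y e w b}.Finite := fun y e w => hf0 (y, e) w
  have hEF : ∀ y e, (∃ w, E y e w) → Fat (E y e) := fun y e => hEF0 (y, e)
  have hN : ∀ y e w w', E y e w → E y e w' → {b | D y e w b}.ncard = {b | D y e w' b}.ncard :=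
    fun y e => hN0 (y, e)
  suffices h : ∃ K, ∀ y e w, E y e w → {b | D y e w b}.ncard ≤ K by
    obtain ⟨K, hK⟩ := h
    exact ⟨K, fun y w h => hK y.1 y.2 w h⟩
  clear_value D E
  clear hD0 hf0 hE0 hEF0 hN0 D0 E0
  let dom : Y → M → Prop := fun y e => ∃ w, E y e w
  have hdom : Dfn2 L M dom := ⟨by infer_instance⟩
  let Gd : Y → M → Prop := fun y e => ∃ w, Near e (fun e' => E y e' w) ∧ Good e (fun e' => D y e' w)
  have hGd : Dfn2 L M Gd := ⟨by infer_instance⟩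
  let Br : Y → M → Prop := fun y e => Bd e (dom y) ∨ (dom y e ∧ ¬ Gd y e)
  have hBr : Dfn2 L M Br := ⟨by infer_instance⟩
  have hBrf : ∀ y, {e | Br y e}.Finite := by
    intro y
    have h1 : {e | Bd e (dom y)}.Finite := bd_finite L _
    have h2 : {e | dom y e ∧ ¬ Gd y e}.Finite := by
      apply finite_of_not_big L
      intro hB
      obtain ⟨w, hw⟩ := hF.exch (fun e w => E y e w ∧ ¬ Gd y e) ⟨by infer_instance⟩ (hB.mono (by
        rintro e ⟨h1, h2⟩
        simpa [h2] using hEF y e h1))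
      have h3 := (hw.near_big (Q := fun e => Near e (fun e => E y e w ∧ ¬ Gd y e)) fun x hx => hx).avoid L
        (not_big_bad L (fun e b => D y e w b) (hD := ⟨by infer_instance⟩) (fun e => hf y e w))
      obtain ⟨e, h4, h5⟩ := h3.exists
      exact h4.self.2 ⟨w, h4.mono fun x hx => hx.1, not_not.1 h5⟩
    exact (h1.union h2).subset fun x hx => hx
  obtain ⟨K0, hK0⟩ := hUF1 Br hBr hBrf
  -- bad part
  have hb : ∀ j, ∃ K, ∀ y e w, Br y e → Rk j e (Br y) → E y e w → {b | D y e w b}.ncard ≤ K := by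
    intro j
    have huq : ∀ (y : Y) (e e' : M), Br y e → Rk j e (Br y) → Br y e' → Rk j e' (Br y) → e = e' :=
      fun y e e' h1 h2 h3 h4 => rk_unique _ (hBrf y) h1 h3 h2 h4
    obtain ⟨K, hK⟩ := hUF2 (fun p b => ∃ e, Br p.1 e ∧ Rk j e (Br p.1) ∧ D p.1 e p.2 b) ⟨by infer_instance⟩ (by
      rintro ⟨y, w⟩
      by_cases h : ∃ e, Br y e ∧ Rk j e (Br y)
      · obtain ⟨e, h1, h2⟩ := h
        refine (hf y e w).subset ?_
        rintro b ⟨e', h3, h4, h5⟩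
        obtain rfl := huq y e e' h1 h2 h3 h4
        exact h5
      · refine Set.finite_empty.subset ?_
        rintro b ⟨e', h3, h4, h5⟩
        exact h ⟨e', h3, h4⟩)
    refine ⟨K, fun y e w h1 h2 h3 => ?_⟩
    refine le_trans (le_of_eq ?_) (hK (y, w))
    congr 1
    ext b
    constructor
    · intro hb; exact ⟨e, h1, h2, hb⟩
    · rintro ⟨e', h3, h4, h5⟩
      obtain rfl := huq y e e' h1 h2 h3 h4
      exact h5
  -- generic part
  have hg : ∀ j, ∃ K, ∀ y e w, ¬ Br y e → Rk j e (Br y) → E y e w → {b | D y e w b}.ncard ≤ K := by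
    intro j
    obtain ⟨K, hK⟩ := hQ _ (fat_prod L Fat hF) (fun y p b => D y p.1 p.2 b) ⟨by infer_instance⟩
      (fun y p => hf y p.1 p.2) (fun y p => ¬ Br y p.1 ∧ Rk j p.1 (Br y) ∧ E y p.1 p.2) ⟨by infer_instance⟩ (by
        rintro y ⟨⟨e, w⟩, h1, h2, h3⟩
        have h4 : Near e (dom y) := by
          by_contra h
          apply h1
          left
          exact ⟨h, fun hn => hn.self ⟨w, h3⟩⟩
        have h5 := h4.and (cell_near (Br y) (hBrf y) e h1)
        refine h5.big.mono ?_
        rintro e' ⟨h6, h7, h8⟩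
        have h9 : Rk j e' (Br y) := by
          rw [rk_iff _ _ _ (hBrf y)] at h2 ⊢; rw [h8, h2]
        simpa [h7, h9] using hEF y e' h6) (by
        have key : ∀ y e e' w w', e ≤ e' → ¬ Br y e → Rk j e (Br y) → E y e w →
            ¬ Br y e' → Rk j e' (Br y) → E y e' w' → {b | D y e w b}.ncard = {b | D y e' w' b}.ncard := by
          intro y e e' w w' hee h1 h2 h3 h1' h2' h3'
          have hnb : ∀ b, e ≤ b → b ≤ e' → ¬ Br y b := by
            intro b hb hb'
            rcases hb'.eq_or_lt with rfl | h
            · exact h1'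
            · exact same_rank _ (hBrf y) hee h2 h2' b hb h
          have hnd : ∀ b, e ≤ b → b ≤ e' → dom y b := by
            intro b hb hb'
            refine conn L (dom y) e b hb ?_ ⟨w, h3⟩
            intro c hc1 hc2
            have := hnb c hc1 (hc2.trans hb')
            by_contra hn
            push Not at hn
            exact this (Or.inl ⟨hn.1, hn.2⟩)
          have hc := conn L (fun x => ∃ v, E y x v ∧ Card ({b | D y e w b}.ncard) (D y x v)) e e' hee ?_
            ⟨w, h3, (card_iff _ _ (hf y e w)).2 rfl⟩
          · obtain ⟨v, hv1, hv2⟩ := hc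
            rw [card_iff _ _ (hf y e' v)] at hv2
            rw [← hv2]
            exact hN y e' _ _ hv1 h3'
          · intro b hb1 hb2
            have hg : Gd y b := by
              by_contra h
              exact hnb b hb1 hb2 (Or.inr ⟨hnd b hb1 hb2, h⟩)
            obtain ⟨v, hv1, hv2⟩ := hg
            have h6 := lemF1 L (fun e' b => D y e' v b) (hD := ⟨by infer_instance⟩) (fun e => hf y e v) hv2
            by_cases hcc : {c | D y b v c}.ncard = {b | D y e w b}.ncard
            · left
              refine (hv1.and h6).mono ?_
              rintro x ⟨hx1, hx2⟩
              exact ⟨v, hx1, (card_iff _ _ (hf y x v)).2 (hx2.trans hcc)⟩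
            · right
              refine (hv1.and h6).mono ?_
              rintro x ⟨hx1, hx2⟩ ⟨v', hx3, hx4⟩
              rw [card_iff _ _ (hf y x v')] at hx4
              apply hcc
              rw [← hx4, ← hx2]
              exact hN y x _ _ hx1 hx3
        rintro y ⟨e, w⟩ ⟨e', w'⟩ ⟨h1, h2, h3⟩ ⟨h1', h2', h3'⟩
        rcases le_total e e' with h | h
        · exact key y e e' w w' h h1 h2 h3 h1' h2' h3'
        · exact (key y e' e w' w h h1' h2' h3' h1 h2 h3).symm)
    exact ⟨K, fun y e w h1 h2 h3 => hK y (e, w) ⟨h1, h2, h3⟩⟩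
  obtain ⟨K1, hK1⟩ := finite_bound hb (fun j K K' h h' y e w h1 h2 h3 => (h' y e w h1 h2 h3).trans h) K0
  obtain ⟨K2, hK2⟩ := finite_bound hg (fun j K K' h h' y e w h1 h2 h3 => (h' y e w h1 h2 h3).trans h) K0
  refine ⟨max K1 K2, fun y e w h => ?_⟩
  obtain ⟨j, hj, hr⟩ := rk_exists (Br y) (hBrf y) e
  by_cases hbr : Br y e
  · exact (hK1 j (hj.trans (hK0 y)) y e w hbr hr h).trans (le_max_left _ _)
  · exact (hK2 j (hj.trans (hK0 y)) y e w hbr hr h).trans (le_max_right _ _)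

end four
end OMin

end
section
set_option synthInstance.maxHeartbeats 400000
set_option synthInstance.maxSize 40000
set_option linter.unusedVariables false
set_option linter.unusedSectionVars false
set_option linter.style.haveILetI false
namespace OMin
/-- powers of `M`, recursively -/
def Pw (M : Type u) : ℕ → Type u
  | 0 => PUnit.{u+1}
  | n+1 => Pw M n × M

instance mspPw (M : Type u) : (n : ℕ) → MSp M (Pw M n)
  | 0 => mspUnit M
  | n+1 => @mspProd M (Pw M n) M (mspPw M n) (mspSelf M)

/-- dimension of a space -/
noncomputable def dimS (M : Type u) (X : Type u) [h : MSp M X] : ℕ := Nat.card h.ι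

theorem dim_prod (M : Type u) (X Y : Type u) [hX : MSp M X] [hY : MSp M Y] :
    dimS M (X × Y) = dimS M X + dimS M Y := by
  have := hX.fin
  have := hY.fin
  exact Nat.card_sum

theorem dim_self (M : Type u) : dimS M M = 1 := Nat.card_unique (α := Unit)
theorem dim_unit (M : Type u) : dimS M PUnit.{u+1} = 0 := Nat.card_of_isEmpty (α := Empty)
theorem dim_pw (M : Type u) (n : ℕ) : dimS M (Pw M n) = n := by
  induction n with
  | zero => exact dim_unit M
  | succ n ih =>
    have := dim_prod M (Pw M n) M
    rw [ih, dim_self] at this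
    exact this

theorem exists_reindex {M : Type u} {X Y : Type u} [hX : MSp M X] [hY : MSp M Y] (h : dimS M X = dimS M Y) :
    ∃ f : X → Y, ∃ g : Y → X, CMap (M := M) f ∧ CMap (M := M) g ∧ (∀ x, g (f x) = x) ∧ (∀ y, f (g y) = y) := by
  have := hX.fin
  have := hY.fin
  have e : hY.ι ≃ hX.ι := (Finite.card_eq.1 h.symm).some
  refine ⟨fun x => hY.e.symm (hX.e x ∘ e), fun y => hX.e.symm (hY.e y ∘ e.symm), ⟨e, fun x => by simp⟩,
    ⟨e.symm, fun x => by simp⟩, fun x => ?_, fun x => ?_⟩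
  · simp [Function.comp_assoc]
  · simp [Function.comp_assoc]

section five
variable (L : FirstOrder.Language.{u1,u2}) {M : Type u} [L.Structure M] [LinearOrder M] [OM L M]
  [DenselyOrdered M] [NoMinOrder M] [NoMaxOrder M] [Nonempty M]
variable {X Y Z W : Type u} [hX : MSp M X] [hY : MSp M Y] [hZ : MSp M Z] [hW : MSp M W]

theorem UF_reindex (h : dimS M X = dimS M Y) (hu : UF L M X) : UF L M Y := by
  intro D hD hf
  obtain ⟨f, g, hf', hg', h1, h2⟩ := exists_reindex (M := M) h
  have : DMap L M f := hf'.dmap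
  obtain ⟨K, hK⟩ := hu (fun x b => D (f x) b) ⟨by infer_instance⟩ (fun x => hf _)
  exact ⟨K, fun y => by simpa [h2] using hK (g y)⟩

theorem QP_pw (i : ℕ) : ∀ (W : Type u) [MSp M W], (∀ (X : Type u) [MSp M X], dimS M X < i + dimS M W → UF L M X) →
    QP L M (Pw M i) W := by
  induction i with
  | zero => intro W _ h; exact QP_unit L
  | succ i ih =>
    intro W _ h
    refine QP_step L (Y := Pw M i) (h _ ?_) (h _ ?_) (ih (M × W) ?_)
    · rw [dim_pw]; omega
    · rw [dim_prod, dim_pw]; omega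
    · intro X _ hX
      apply h
      rw [dim_prod, dim_self] at hX; omega

theorem fat_unit : FatStr L M PUnit.{u+1} (fun F => F PUnit.unit) := by
  constructor
  · intro X _ P hP
    have h1 : DMap L M (fun _ : X => PUnit.unit.{u+1}) := dmapConst _
    have h2 : DMap L M (fun x : X => (x, PUnit.unit.{u+1})) := dmapPair (fun x => x) (fun _ => PUnit.unit)
    exact Dfn.comp (P := fun p : X × PUnit.{u+1} => P p.1 p.2) hP (fun x => (x, PUnit.unit))
  · intro R hR h
    exact ⟨PUnit.unit, h⟩

theorem UF_all (m : ℕ) : ∀ (X : Type u) [MSp M X], dimS M X = m → UF L M X := by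
  induction m using Nat.strong_induction_on with
  | _ m ih =>
    intro X _ hX
    apply UF_reindex L (X := Pw M m) (by rw [dim_pw, hX])
    intro D hD hf
    have hQ := QP_pw L (M := M) m PUnit.{u+1} (fun X _ hX => by
      rw [dim_unit] at hX; exact ih _ (by simpa using hX) X rfl)
    obtain ⟨K, hK⟩ := hQ (fun F => F PUnit.unit) (fat_unit L) (fun y _ b => D y b) ⟨by infer_instance⟩ (fun y _ => hf y)
      (fun _ _ => True) ⟨by infer_instance⟩ (fun _ _ => trivial) (fun _ _ _ _ _ => rfl)
    exact ⟨K, fun x => hK x PUnit.unit trivial⟩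

theorem convex_decomp (D : Y → M → Prop) [hD : Dfn2 L M D] :
    ∃ (J : Type) (_ : Finite J) (C : J → Y → M → Prop), (∀ j, Dfn2 L M (C j)) ∧
      (∀ j y a b c, C j y a → C j y c → a ≤ b → b ≤ c → C j y b) ∧ ∀ y b, D y b ↔ ∃ j, C j y b := by
  have hfin : ∀ y, {b | Bd b (D y)}.Finite := fun y => bd_finite L _
  obtain ⟨K, hK⟩ := UF_all L _ Y rfl (fun y b => Bd b (D y)) ⟨by infer_instance⟩ hfin
  refine ⟨Fin (K+1) × Bool, inferInstance, fun j y b => D y b ∧ (j.2 = true ↔ Bd b (D y)) ∧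
    Rk j.1 b (fun b => Bd b (D y)), fun j => ⟨by infer_instance⟩, ?_, ?_⟩
  · rintro ⟨j, t⟩ y a b c ⟨h1, h2, h3⟩ ⟨h1', h2', h3'⟩ hab hbc
    dsimp only at *
    have hs := same_rank _ (hfin y) (hab.trans hbc) h3 h3'
    cases t with
    | true =>
      simp only [true_iff] at h2 h2'
      have := rk_unique _ (hfin y) h2 h2' h3 h3'
      subst this
      obtain rfl := le_antisymm hab hbc
      simp [*]
    | false =>
      simp only [Bool.false_eq_true, false_iff] at h2 h2' ⊢
      rcases hbc.eq_or_lt with rfl | hbc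
      · exact ⟨h1', h2', h3'⟩
      have hb := hs b hab hbc
      refine ⟨conn L (D y) a b hab ?_ h1, hb, ?_⟩
      · intro d hd1 hd2
        have := hs d hd1 (hd2.trans_lt hbc)
        by_contra hn
        push Not at hn
        exact this hn
      · rw [rk_iff _ _ _ (hfin y)] at h3 ⊢
        rw [← h3]
        congr 1
        ext d
        constructor
        · rintro ⟨hd1, hd2⟩
          refine ⟨hd1, ?_⟩
          by_contra hn
          exact hs d (not_lt.1 hn) (hd2.trans hbc) hd1
        · rintro ⟨hd1, hd2⟩
          exact ⟨hd1, hd2.trans_le hab⟩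
  · intro y b
    constructor
    · intro h
      obtain ⟨j, hj, hr⟩ := rk_exists _ (hfin y) b
      by_cases hb : Bd b (D y)
      · exact ⟨(⟨j, Nat.lt_succ_of_le (hj.trans (hK y))⟩, true), h, by simpa using hb, hr⟩
      · exact ⟨(⟨j, Nat.lt_succ_of_le (hj.trans (hK y))⟩, false), h, by simpa using hb, hr⟩
    · rintro ⟨j, h, _⟩; exact h

end five
end OMin

end
section
set_option synthInstance.maxHeartbeats 400000
set_option synthInstance.maxSize 40000
set_option linter.unusedVariables false
set_option linter.unusedSectionVars false
set_option linter.style.haveILetI false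
namespace OMin
open Filter in
/-- uniformly definable families of definable types, as filters -/
class UT (L : FirstOrder.Language.{u1,u2}) (M : Type u) [L.Structure M] {Z X : Type u} [MSp M Z] [MSp M X]
    (q : Z → Filter X) : Prop where
  ne : ∀ z, ¬ ∀ᶠ x in q z, False
  ultra : ∀ z (P : X → Prop), Dfn L M P → (∀ᶠ x in q z, P x) ∨ (∀ᶠ x in q z, ¬ P x)
  dfn : ∀ {Y : Type u} [MSp M Y] (g : Y → Z) (P : Y → X → Prop), DMap L M g →
    Dfn L M (fun p : Y × X => P p.1 p.2) → Dfn L M (fun y => ∀ᶠ x in q (g y), P y x)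

section six
open Filter
variable (L : FirstOrder.Language.{u1,u2}) {M : Type u} [L.Structure M] 
variable {X Y Z W V : Type u} [hX : MSp M X] [hY : MSp M Y] [hZ : MSp M Z] [hW : MSp M W] [hV : MSp M V]

instance dfnEv {L : FirstOrder.Language.{u1,u2}} [L.Structure M] (q : Z → Filter X) [h : UT L M q] (g : Y → Z) [hg : DMap L M g] (P : Y → X → Prop)
    [hP : Dfn L M (fun p : Y × X => P p.1 p.2)] : Dfn L M (fun y => ∀ᶠ x in q (g y), P y x) :=
  h.dfn g P hg hP

theorem UT.not_iff {q : Z → Filter X} (h : UT L M q) (z : Z) (P : X → Prop) [hP : Dfn L M P] :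
    (∀ᶠ x in q z, ¬ P x) ↔ ¬ ∀ᶠ x in q z, P x := by
  constructor
  · intro h1 h2
    exact h.ne z ((h1.and h2).mono fun x hx => hx.1 hx.2)
  · intro h1
    exact (h.ultra z P hP).resolve_left h1

theorem UT.bind {t : Z → Filter X} {s : Z × X → Filter Y} (ht : UT L M t) (hs : UT L M s) :
    UT L M (fun z => (t z).bind (fun x => s (z, x))) where
  ne z h := by
    rw [eventually_bind] at h
    exact ht.ne z (h.mono fun x hx => hs.ne _ hx)
  ultra z P hP := by
    simp only [eventually_bind]
    have : Dfn1 L M P := ⟨hP⟩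
    rcases ht.ultra z (fun x => ∀ᶠ y in s (z, x), P y) inferInstance with h | h
    · exact Or.inl h
    · exact Or.inr (h.mono fun x hx => (hs.not_iff L (z, x) P).2 hx)
  dfn := by
    intro W _ g P hg hP
    have : Dfn2 L M P := ⟨hP⟩
    simp only [eventually_bind]
    infer_instance

theorem UT.map {t : Z → Filter X} (ht : UT L M t) (f : Z → X → Y)
    (hf : DMap L M (fun p : Z × X => f p.1 p.2)) : UT L M (fun z => (t z).map (f z)) where
  ne z h := ht.ne z (by simpa only [eventually_map] using h)
  ultra z P hP := by
    simp only [eventually_map]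
    refine ht.ultra z (fun x => P (f z x)) ?_
    exact hP.comp (fun x => f z x) (hf := DMap.comp' (f := fun x => (z, x)) inferInstance hf)
  dfn := by
    intro W _ g P hg hP
    have : Dfn2 L M P := ⟨hP⟩
    simp only [eventually_map]
    refine ht.dfn g (fun y x => P y (f (g y) x)) hg ?_
    have h2 : DMap L M (fun p : W × X => f (g p.1) p.2) :=
      DMap.comp' (f := fun p : W × X => (g p.1, p.2)) inferInstance hf
    exact dfn2 P (fun p : W × X => p.1) (fun p : W × X => f (g p.1) p.2)

theorem UT.comp {t : Z → Filter X} (ht : UT L M t) (f : W → Z) [hf : DMap L M f] :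
    UT L M (fun w => t (f w)) where
  ne w := ht.ne (f w)
  ultra w := ht.ultra (f w)
  dfn := by
    intro Y _ g P hg hP
    exact ht.dfn (fun y => f (g y)) P (hg.comp' hf) hP

theorem ut_basis (I : Z → V → Prop) (F : Z → V → X → Prop) [hI : Dfn2 L M I] [hF : Dfn3 L M F]
    (hne : ∀ z, ∃ v, I z v) (hFne : ∀ z v, I z v → ∃ x, F z v x)
    (hdir : ∀ z v v', I z v → I z v' → ∃ v'', I z v'' ∧ ∀ x, F z v'' x → F z v x ∧ F z v' x)
    (hu : ∀ z (P : X → Prop), Dfn L M P → ∃ v, I z v ∧ ((∀ x, F z v x → P x) ∨ (∀ x, F z v x → ¬ P x))) :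
    ∃ q : Z → Filter X, UT L M q ∧ ∀ z (P : X → Prop), (∀ᶠ x in q z, P x) ↔ ∃ v, I z v ∧ ∀ x, F z v x → P x := by
  let q : Z → Filter X := fun z =>
    { sets := {A | ∃ v, I z v ∧ ∀ x, F z v x → x ∈ A}
      univ_sets := by
        obtain ⟨v, hv⟩ := hne z
        exact ⟨v, hv, fun x _ => mem_univ x⟩
      sets_of_superset := by
        rintro A B ⟨v, hv, h⟩ hAB
        exact ⟨v, hv, fun x hx => hAB (h x hx)⟩
      inter_sets := by
        rintro A B ⟨v, hv, h⟩ ⟨v', hv', h'⟩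
        obtain ⟨w, hw, hw'⟩ := hdir z v v' hv hv'
        exact ⟨w, hw, fun x hx => ⟨h x (hw' x hx).1, h' x (hw' x hx).2⟩⟩ }
  have hq : ∀ z (P : X → Prop), (∀ᶠ x in q z, P x) ↔ ∃ v, I z v ∧ ∀ x, F z v x → P x := fun z P => Iff.rfl
  clear_value q
  refine ⟨q, ?_, hq⟩
  constructor
  · intro z h
    rw [hq] at h
    obtain ⟨v, hv, h⟩ := h
    obtain ⟨x, hx⟩ := hFne z v hv
    exact h x hx
  · intro z P hP
    obtain ⟨v, hv, h | h⟩ := hu z P hP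
    · left; rw [hq]; exact ⟨v, hv, h⟩
    · right; rw [hq]; exact ⟨v, hv, h⟩
  · intro Y _ g P hg hP
    have : Dfn2 L M P := ⟨hP⟩
    simp only [hq]
    infer_instance

variable [LinearOrder M] [OM L M] [DenselyOrdered M] [NoMinOrder M] [NoMaxOrder M] [Nonempty M]

theorem end_ultra (S P : M → Prop) [hS : Dfn L M S] [hP : Dfn L M P] (hne : ∃ x, S x) :
    ∃ c, S c ∧ ((∀ y, S y → c ≤ y → P y) ∨ (∀ y, S y → c ≤ y → ¬ P y)) := by
  have : Dfn1 L M S := ⟨hS⟩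
  have : Dfn1 L M P := ⟨hP⟩
  by_cases hmax : ∃ m, S m ∧ ∀ y, S y → y ≤ m
  · obtain ⟨m, hm, h⟩ := hmax
    by_cases hPm : P m
    · exact ⟨m, hm, Or.inl fun y hy hmy => le_antisymm hmy (h y hy) ▸ hPm⟩
    · exact ⟨m, hm, Or.inr fun y hy hmy => le_antisymm hmy (h y hy) ▸ hPm⟩
  push Not at hmax
  let B : M → Prop := fun b => (Bd b (fun x => S x ∧ P x) ∨ Bd b (fun x => S x ∧ ¬ P x)) ∧ ∃ s, S s ∧ b < s
  have hB : {b | B b}.Finite :=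
    ((bd_finite L (fun x => S x ∧ P x)).union (bd_finite L (fun x => S x ∧ ¬ P x))).subset fun x hx => hx.1
  have hs : ∃ s, S s ∧ ∀ b, B b → b < s := by
    by_cases hBn : ∃ b, B b
    · obtain ⟨m, hm, hmm⟩ := exists_max_of_finite hB hBn
      obtain ⟨s, hs, hms⟩ := hm.2
      exact ⟨s, hs, fun b hb => (hmm b hb).trans_lt hms⟩
    · obtain ⟨s, hs⟩ := hne
      exact ⟨s, hs, fun b hb => (hBn ⟨b, hb⟩).elim⟩
  obtain ⟨s, hs, hsB⟩ := hs
  have key : ∀ y, S y → s ≤ y → ∀ b, s ≤ b → b ≤ y → ¬ B b := fun y hy hsy b hb1 hb2 hBb =>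
    absurd (hsB b hBb) (not_lt.2 hb1)
  have key2 : ∀ y, S y → s ≤ y → ∀ b, s ≤ b → b ≤ y → ¬ (Bd b (fun x => S x ∧ P x) ∨ Bd b (fun x => S x ∧ ¬ P x)) := by
    intro y hy hsy b hb1 hb2 h
    obtain ⟨y', hy', hyy⟩ := hmax y hy
    exact key y hy hsy b hb1 hb2 ⟨h, y', hy', hb2.trans_lt hyy⟩
  refine ⟨s, hs, ?_⟩
  by_cases hPs : P s
  · left
    intro y hy hsy
    refine (conn L (fun x => S x ∧ P x) s y hsy ?_ ⟨hs, hPs⟩).2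
    intro b hb1 hb2
    by_contra hn
    push Not at hn
    exact key2 y hy hsy b hb1 hb2 (Or.inl ⟨hn.1, by simpa using hn.2⟩)
  · right
    intro y hy hsy
    refine (conn L (fun x => S x ∧ ¬ P x) s y hsy ?_ ⟨hs, hPs⟩).2
    intro b hb1 hb2
    by_contra hn
    push Not at hn
    exact key2 y hy hsy b hb1 hb2 (Or.inr ⟨hn.1, by simpa using hn.2⟩)

theorem start_ultra (S P : M → Prop) [hS : Dfn L M S] [hP : Dfn L M P] (hne : ∃ x, S x) :
    ∃ c, S c ∧ ((∀ y, S y → y ≤ c → P y) ∨ (∀ y, S y → y ≤ c → ¬ P y)) := by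
  have : Dfn1 L M S := ⟨hS⟩
  have : Dfn1 L M P := ⟨hP⟩
  by_cases hmin : ∃ m, S m ∧ ∀ y, S y → m ≤ y
  · obtain ⟨m, hm, h⟩ := hmin
    by_cases hPm : P m
    · exact ⟨m, hm, Or.inl fun y hy hmy => le_antisymm hmy (h y hy) ▸ hPm⟩
    · exact ⟨m, hm, Or.inr fun y hy hmy => le_antisymm hmy (h y hy) ▸ hPm⟩
  push Not at hmin
  let B : M → Prop := fun b => (Bd b (fun x => ¬ (S x ∧ P x)) ∨ Bd b (fun x => ¬ (S x ∧ ¬ P x))) ∧ ∃ s, S s ∧ s < b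
  have hB : {b | B b}.Finite :=
    ((bd_finite L (fun x => ¬ (S x ∧ P x))).union (bd_finite L (fun x => ¬ (S x ∧ ¬ P x)))).subset fun x hx => hx.1
  have hs : ∃ s, S s ∧ ∀ b, B b → s < b := by
    by_cases hBn : ∃ b, B b
    · obtain ⟨m, hm, hmm⟩ := exists_min_of_finite hB hBn
      obtain ⟨s, hs, hms⟩ := hm.2
      exact ⟨s, hs, fun b hb => hms.trans_le (hmm b hb)⟩
    · obtain ⟨s, hs⟩ := hne
      exact ⟨s, hs, fun b hb => (hBn ⟨b, hb⟩).elim⟩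
  obtain ⟨s, hs, hsB⟩ := hs
  have key2 : ∀ y, S y → y ≤ s → ∀ b, y ≤ b → b ≤ s → ¬ (Bd b (fun x => ¬ (S x ∧ P x)) ∨ Bd b (fun x => ¬ (S x ∧ ¬ P x))) := by
    intro y hy hsy b hb1 hb2 h
    obtain ⟨y', hy', hyy⟩ := hmin y hy
    exact absurd (hsB b ⟨h, y', hy', hyy.trans_le hb1⟩) (not_lt.2 hb2)
  refine ⟨s, hs, ?_⟩
  by_cases hPs : P s
  · left
    intro y hy hsy
    by_contra hPy
    refine conn L (fun x => ¬ (S x ∧ P x)) y s hsy ?_ (fun h => hPy h.2) ⟨hs, hPs⟩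
    intro b hb1 hb2
    by_contra hn
    rw [not_or] at hn
    exact key2 y hy hsy b hb1 hb2 (Or.inl hn)
  · right
    intro y hy hsy hPy
    refine conn L (fun x => ¬ (S x ∧ ¬ P x)) y s hsy ?_ (fun h => h.2 hPy) ⟨hs, hPs⟩
    intro b hb1 hb2
    by_contra hn
    rw [not_or] at hn
    exact key2 y hy hsy b hb1 hb2 (Or.inr hn)

theorem exists_end (S : Z → M → Prop) [hS : Dfn2 L M S] : ∃ q : Z → Filter M, UT L M q ∧
    ∀ z, (∃ x, S z x) → ∀ P : M → Prop, (∀ᶠ x in q z, P x) ↔ ∃ c, S z c ∧ ∀ y, S z y → c ≤ y → P y := by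
  let S' : Z → M → Prop := fun z x => S z x ∨ ¬ ∃ x, S z x
  have hS' : Dfn2 L M S' := ⟨by infer_instance⟩
  have hne : ∀ z, ∃ x, S' z x := by
    intro z
    by_cases h : ∃ x, S z x
    · obtain ⟨x, hx⟩ := h; exact ⟨x, Or.inl hx⟩
    · exact ⟨Classical.arbitrary M, Or.inr h⟩
  have hF : Dfn3 L M (fun (z : Z) (c y : M) => S' z y ∧ c ≤ y) := ⟨by infer_instance⟩
  obtain ⟨q, hq, hqi⟩ := ut_basis (X := M) (hX := mspSelf M) L S' (fun z c y => S' z y ∧ c ≤ y) hne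
    (fun z c hc => ⟨c, hc, le_rfl⟩) (by
      intro z v v' hv hv'
      rcases le_total v v' with h | h
      · exact ⟨v', hv', fun x hx => ⟨⟨hx.1, h.trans hx.2⟩, hx⟩⟩
      · exact ⟨v, hv, fun x hx => ⟨hx, hx.1, h.trans hx.2⟩⟩) (by
      intro z P hP
      obtain ⟨c, hc, h⟩ := end_ultra L (S' z) P (hP := hP) (hne z)
      exact ⟨c, hc, h.imp (fun h x hx => h x hx.1 hx.2) (fun h x hx => h x hx.1 hx.2)⟩)
  refine ⟨q, hq, fun z hz P => ?_⟩
  have : S' z = S z := by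
    ext x
    exact ⟨fun h => h.resolve_right (not_not.2 hz), Or.inl⟩
  rw [hqi, this]
  simp only [and_imp]

variable (M) in
/-- existence of cofinal types -/
def CofP (X : Type u) [MSp M X] : Prop := ∀ {Z : Type u} [MSp M Z] (Ω : Z → X → Prop) (le : Z → X → X → Prop),
  Dfn2 L M Ω → Dfn3 L M le → (∀ z x y, le z x y ∨ le z y x) → (∀ z a b c, le z a b → le z b c → le z a c) →
  ∃ r : Z → Filter X, UT L M r ∧ ∀ z, ∀ x, Ω z x → ∀ᶠ y in r z, Ω z y ∧ le z x y

theorem cof_self : CofP L M M := by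
  intro Z _ Ω0 le hΩ0 hle htot htr
  let Ω : Z → M → Prop := fun z x => Ω0 z x ∨ ¬ ∃ x, Ω0 z x
  have hΩ : Dfn2 L M Ω := ⟨by infer_instance⟩
  have hne : ∀ z, ∃ x, Ω z x := by
    intro z
    by_cases h : ∃ x, Ω0 z x
    · obtain ⟨x, hx⟩ := h; exact ⟨x, Or.inl hx⟩
    · exact ⟨Classical.arbitrary M, Or.inr h⟩
  let U : Z → M → M → Prop := fun z x y => Ω z y ∧ le z x y
  have hU : Dfn3 L M U := ⟨by infer_instance⟩
  have hUself : ∀ z x, Ω z x → U z x x := fun z x hx => ⟨hx, (htot z x x).elim id id⟩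
  have hUmono : ∀ z x x', le z x x' → ∀ y, U z x' y → U z x y := fun z x x' h y hy => ⟨hy.1, htr z _ _ _ h hy.2⟩
  let K : Z → M → Prop := fun z x => Ω z x ∧ ∀ x', Ω z x' → le z x x' → ∀ y, U z x y → ∃ y', U z x' y' ∧ y' ≤ y
  have hK : Dfn2 L M K := ⟨by infer_instance⟩
  let B : Z → M → Prop := fun z y => ∃ x, Ω z x ∧ ∀ u, U z x u → y < u
  have hB : Dfn2 L M B := ⟨by infer_instance⟩
  have hBne : ∀ z, ¬ (∃ x, K z x) → ∃ y, B z y := by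
    intro z h
    obtain ⟨x, hx⟩ := hne z
    have : ¬ K z x := fun hk => h ⟨x, hk⟩
    simp only [K, not_and, not_forall] at this
    obtain ⟨x', hx', hl, y, hy, hn⟩ := this hx
    push Not at hn
    exact ⟨y, x', hx', hn⟩
  have hcof : ∀ z, ¬ (∃ x, K z x) → ∀ x, Ω z x → ∀ b, B z b → ∃ y, B z y ∧ U z x y ∧ b < y := by
    rintro z h x hx b ⟨x1, hx1, hb⟩
    have : ∃ x2, Ω z x2 ∧ le z x x2 ∧ le z x1 x2 := by
      rcases htot z x x1 with h | h
      · exact ⟨x1, hx1, h, (htot z x1 x1).elim id id⟩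
      · exact ⟨x, hx, (htot z x x).elim id id, h⟩
    obtain ⟨x2, hx2, h1, h2⟩ := this
    have : ¬ K z x2 := fun hk => h ⟨x2, hk⟩
    simp only [K, not_and, not_forall] at this
    obtain ⟨x', hx', hl, y, hy, hn⟩ := this hx2
    push Not at hn
    exact ⟨y, ⟨x', hx', hn⟩, hUmono z x x2 h1 y hy, hb y (hUmono z x1 x2 h2 y hy)⟩
  let I : Z → M × M → Prop := fun z v => (K z v.1 ∧ U z v.1 v.2) ∨ (¬ (∃ x, K z x) ∧ B z v.2)
  let F : Z → M × M → M → Prop := fun z v y => ((∃ x, K z x) ∧ U z v.1 y ∧ y ≤ v.2) ∨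
    (¬ (∃ x, K z x) ∧ B z y ∧ v.2 ≤ y)
  have hI : Dfn2 L M I := ⟨by infer_instance⟩
  have hKE : Dfn1 L M (fun z => ∃ x, K z x) := ⟨by infer_instance⟩
  have hF : Dfn3 L M F := by
    have f1 : Dfn L M (fun p : Z × (M × M) × M => ∃ x, K p.1 x) := hKE.out.comp (fun p : Z × (M × M) × M => p.1)
    have f2 : Dfn L M (fun p : Z × (M × M) × M => U p.1 p.2.1.1 p.2.2) := dfn3 U _ _ _
    have f3 : Dfn L M (fun p : Z × (M × M) × M => B p.1 p.2.2) := dfn2 B _ _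
    exact ⟨dfnOr _ _ (h := dfnAnd _ _ (h := f1) (h' := dfnAnd _ _ (h := f2)))
      (h' := dfnAnd _ _ (h := dfnNot _ (h := f1)) (h' := dfnAnd _ _ (h := f3)))⟩
  obtain ⟨q, hq, hqi⟩ := ut_basis (X := M) (hX := mspSelf M) L I F (by
      intro z
      by_cases h : ∃ x, K z x
      · obtain ⟨x, hx⟩ := h
        exact ⟨(x, x), Or.inl ⟨hx, hUself z x hx.1⟩⟩
      · obtain ⟨y, hy⟩ := hBne z h
        exact ⟨(y, y), Or.inr ⟨h, hy⟩⟩) (by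
      rintro z v (⟨h1, h2⟩ | ⟨h1, h2⟩)
      · exact ⟨v.2, Or.inl ⟨⟨_, h1⟩, h2, le_rfl⟩⟩
      · exact ⟨v.2, Or.inr ⟨h1, h2, le_rfl⟩⟩) (by
      have aux : ∀ z x c x' c', K z x → U z x c → K z x' → U z x' c' → le z x x' →
          ∃ v'', I z v'' ∧ ∀ y, F z v'' y → F z (x, c) y ∧ F z (x', c') y := by
        intro z x c x' c' h1 h2 h1' h2' hl
        obtain ⟨y', hy', hyc⟩ := h1.2 x' h1'.1 hl c h2
        have hex : ∃ x, K z x := ⟨x, h1⟩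
        refine ⟨(x', min y' c'), Or.inl ⟨h1', ?_⟩, ?_⟩
        · dsimp only
          rcases min_choice y' c' with h | h <;> rw [h] <;> assumption
        · rintro y (⟨_, h3, h4⟩ | ⟨h3, _⟩)
          · dsimp only at h3 h4
            exact ⟨Or.inl ⟨hex, hUmono z _ _ hl y h3, h4.trans ((min_le_left _ _).trans hyc)⟩,
              Or.inl ⟨hex, h3, h4.trans (min_le_right _ _)⟩⟩
          · exact (h3 hex).elim
      rintro z ⟨x, c⟩ ⟨x', c'⟩ (⟨h1, h2⟩ | ⟨h1, h2⟩) (⟨h1', h2'⟩ | ⟨h1', h2'⟩)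
      · rcases htot z x x' with h | h
        · exact aux z x c x' c' h1 h2 h1' h2' h
        · obtain ⟨v, hv, hv'⟩ := aux z x' c' x c h1' h2' h1 h2 h
          exact ⟨v, hv, fun y hy => (hv' y hy).symm⟩
      · exact (h1' ⟨_, h1⟩).elim
      · exact (h1 ⟨_, h1'⟩).elim
      · refine ⟨(x, max c c'), Or.inr ⟨h1, ?_⟩, ?_⟩
        · dsimp only at h2 h2' ⊢
          rcases max_choice c c' with h | h <;> rw [h] <;> assumption
        · rintro y (⟨h3, _⟩ | ⟨_, h3, h4⟩)
          · exact (h1 h3).elim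
          · exact ⟨Or.inr ⟨h1, h3, (le_max_left _ _).trans h4⟩, Or.inr ⟨h1, h3, (le_max_right _ _).trans h4⟩⟩) (by
      intro z P hP
      by_cases h : ∃ x, K z x
      · obtain ⟨x, hx⟩ := h
        obtain ⟨c, hc, hcP⟩ := start_ultra L (U z x) P (hP := hP) ⟨x, hUself z x hx.1⟩
        have h : ∃ x, K z x := ⟨x, hx⟩
        refine ⟨(x, c), Or.inl ⟨hx, hc⟩, ?_⟩
        exact hcP.imp (fun h' y hy => hy.elim (fun hy => h' y hy.2.1 hy.2.2) (fun hy => (hy.1 h).elim))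
          (fun h' y hy => hy.elim (fun hy => h' y hy.2.1 hy.2.2) (fun hy => (hy.1 h).elim))
      · obtain ⟨c, hc, hcP⟩ := end_ultra L (B z) P (hP := hP) (hBne z h)
        refine ⟨(c, c), Or.inr ⟨h, hc⟩, ?_⟩
        exact hcP.imp (fun h' y hy => hy.elim (fun hy => (h hy.1).elim) (fun hy => h' y hy.2.1 hy.2.2))
          (fun h' y hy => hy.elim (fun hy => (h hy.1).elim) (fun hy => h' y hy.2.1 hy.2.2)))
  refine ⟨q, hq, fun z x hx0 => ?_⟩
  have hΩe : ∀ x, Ω z x ↔ Ω0 z x := fun y => ⟨fun h => h.resolve_right (fun hn => hn ⟨x, hx0⟩), Or.inl⟩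
  have hx : Ω z x := Or.inl hx0
  suffices h : ∀ᶠ y in q z, U z x y from h.mono fun y hy => ⟨(hΩe y).1 hy.1, hy.2⟩
  by_contra hcon
  rw [← hq.not_iff, hqi] at hcon
  obtain ⟨⟨x', c⟩, (⟨h1, h2⟩ | ⟨h1, h2⟩), hc⟩ := hcon
  · have hex : ∃ x, K z x := ⟨x', h1⟩
    rcases htot z x x' with h | h
    · exact hc c (Or.inl ⟨hex, h2, le_rfl⟩) (hUmono z _ _ h _ h2)
    · obtain ⟨y', hy', hyc⟩ := h1.2 x hx h c h2
      exact hc y' (Or.inl ⟨hex, hUmono z _ _ h _ hy', hyc⟩) hy'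
  · obtain ⟨y, h3, h4, h5⟩ := hcof z h1 x hx c h2
    exact hc y (Or.inr ⟨h1, h3, h5.le⟩) h4

theorem cof_prod (h1 : CofP L M X) (h2 : CofP L M Y) : CofP L M (X × Y) := by
  intro Z _ Ω le hΩ hle htot htr
  obtain ⟨r1, hr1, hc1⟩ := h1 (fun (z : Z) x => ∃ u, Ω z (x, u))
    (fun z x x' => ∀ u, Ω z (x, u) → ∃ v, Ω z (x', v) ∧ le z (x, u) (x', v)) ⟨by infer_instance⟩ ⟨by infer_instance⟩
    (by
      intro z x x'
      by_cases h : ∀ u, Ω z (x, u) → ∃ v, Ω z (x', v) ∧ le z (x, u) (x', v)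
      · exact Or.inl h
      · push Not at h
        obtain ⟨u, hu, h⟩ := h
        exact Or.inr fun v hv => ⟨u, hu, (htot z _ _).resolve_left (h v hv)⟩) (by
      intro z a b c hab hbc u hu
      obtain ⟨v, hv, h1⟩ := hab u hu
      obtain ⟨w, hw, h2⟩ := hbc v hv
      exact ⟨w, hw, htr _ _ _ _ h1 h2⟩)
  obtain ⟨r2, hr2, hc2⟩ := h2 (fun (p : Z × X) u => Ω p.1 (p.2, u)) (fun p u v => le p.1 (p.2, u) (p.2, v))
    ⟨by infer_instance⟩ ⟨by infer_instance⟩ (fun p u v => htot _ _ _) (fun p a b c => htr _ _ _ _)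
  have hm := hr2.map L (fun (p : Z × X) (u : Y) => (p.2, u)) inferInstance
  refine ⟨_, hr1.bind L hm, ?_⟩
  rintro z ⟨x0, u0⟩ h0
  simp only [eventually_bind, eventually_map]
  refine (hc1 z x0 ⟨u0, h0⟩).mono ?_
  rintro x ⟨⟨u, hu⟩, hx⟩
  obtain ⟨v0, hv0, hl⟩ := hx u0 h0
  exact (hc2 (z, x) v0 hv0).mono fun v hv => ⟨hv.1, htr _ _ _ _ hl hv.2⟩

theorem cof_unit : CofP L M PUnit.{u+1} := by
  intro Z _ Ω le hΩ hle htot htr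
  refine ⟨fun z => pure PUnit.unit, ⟨fun z h => ?_, fun z P hP => ?_, fun {Y} _ g P hg hP => ?_⟩, fun z x hx => ?_⟩
  · exact eventually_pure.1 h
  · simp only [eventually_pure]; exact Classical.em _
  · simp only [eventually_pure]
    have h2 : DMap L M (fun x : Y => (x, PUnit.unit.{u+1})) := @dmapPair L M _ Y Y PUnit.{u+1} _ _ _ (fun x => x) (fun _ => PUnit.unit) dmapId (dmapConst _)
    exact Dfn.comp (P := fun p : Y × PUnit.{u+1} => P p.1 p.2) hP (fun x => (x, PUnit.unit))
  · rw [eventually_pure]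
    exact ⟨hx, (htot z _ _).elim id id⟩

theorem cof_pw (n : ℕ) : CofP L M (Pw M n) := by
  induction n with
  | zero => exact cof_unit L
  | succ n ih => exact cof_prod L ih (cof_self L)

theorem cof_all : CofP L M X := by
  intro Z _ Ω le hΩ hle htot htr
  obtain ⟨f, g, hf, hg, h1, h2⟩ := exists_reindex (M := M) (X := Pw M (dimS M X)) (Y := X) (dim_pw _ _)
  have : DMap L M f := hf.dmap
  obtain ⟨r, hr, hc⟩ := cof_pw L (M := M) (dimS M X) (fun (z : Z) x => Ω z (f x)) (fun z x y => le z (f x) (f y))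
    ⟨by infer_instance⟩ ⟨by infer_instance⟩ (fun _ _ _ => htot _ _ _) (fun _ _ _ _ => htr _ _ _ _)
  refine ⟨_, hr.map L (fun _ x => f x) (DMap.comp' (f := fun p : Z × _ => p.2) inferInstance this), fun z x hx => ?_⟩
  rw [eventually_map]
  simpa [h2] using hc z (g x) (by simpa [h2] using hx)

end six
end OMin

end
section
set_option synthInstance.maxHeartbeats 400000
set_option synthInstance.maxSize 40000
set_option linter.unusedVariables false
set_option linter.unusedSectionVars false
set_option linter.style.haveILetI false
namespace OMin
open Filter in
/-- a definable type as a filter -/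
class DT (L : FirstOrder.Language.{u1,u2}) (M : Type u) [L.Structure M] {X : Type u} [MSp M X]
    (q : Filter X) : Prop where
  ne : ¬ ∀ᶠ x in q, False
  ultra : ∀ (P : X → Prop), Dfn L M P → (∀ᶠ x in q, P x) ∨ (∀ᶠ x in q, ¬ P x)
  dfn : ∀ {Y : Type u} [MSp M Y] (P : Y → X → Prop),
    Dfn L M (fun p : Y × X => P p.1 p.2) → Dfn L M (fun y => ∀ᶠ x in q, P y x)

section seven
open Filter
variable (L : FirstOrder.Language.{u1,u2}) {M : Type u} [L.Structure M] 
variable {X Y Z W V U : Type u} [hX : MSp M X] [hY : MSp M Y] [hZ : MSp M Z] [hW : MSp M W] [hV : MSp M V] [hU : MSp M U]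

theorem DT.ut {q : Filter X} (h : DT L M q) : UT L M (fun _ : Z => q) :=
  ⟨fun _ => h.ne, fun _ => h.ultra, fun _ P _ hP => h.dfn P hP⟩

theorem UT.dt {q : Z → Filter X} (h : UT L M q) (z : Z) : DT L M (q z) :=
  ⟨h.ne z, h.ultra z, fun {Y} _ P hP => h.dfn (fun _ => z) P inferInstance hP⟩

theorem DT.not_iff {q : Filter X} (h : DT L M q) (P : X → Prop) [hP : Dfn L M P] :
    (∀ᶠ x in q, ¬ P x) ↔ ¬ ∀ᶠ x in q, P x := by
  constructor
  · intro h1 h2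
    exact h.ne ((h1.and h2).mono fun x hx => hx.1 hx.2)
  · intro h1
    exact (h.ultra P hP).resolve_left h1

theorem dfnFinEx {L : FirstOrder.Language.{u1,u2}} [L.Structure M] {ι : Type} [Finite ι] (P : ι → X → Prop) (h : ∀ i, Dfn L M (P i)) :
    Dfn L M (fun x => ∃ i, P i x) := by
  constructor
  have := definable_iUnion_of_finite (fun i => (h i).out)
  convert this using 1
  ext v; simp

theorem DT.exists_fin {q : Filter X} (h : DT L M q) {ι : Type} [Finite ι] (P : ι → X → Prop)
    (hP : ∀ i, Dfn L M (P i)) (hex : ∀ᶠ x in q, ∃ i, P i x) : ∃ i, ∀ᶠ x in q, P i x := by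
  by_contra hcon
  push Not at hcon
  have h2 : ∀ i, ∀ᶠ x in q, ¬ P i x := fun i => (h.not_iff L (P i) (hP := hP i)).2 (by simpa using hcon i)
  have h3 := eventually_all.2 h2
  exact h.ne ((h3.and hex).mono fun x hx => by obtain ⟨i, hi⟩ := hx.2; exact hx.1 i hi)

instance dfnDT {L : FirstOrder.Language.{u1,u2}} [L.Structure M] (q : Filter X) [h : DT L M q] (P : Y → X → Prop)
    [hP : Dfn L M (fun p : Y × X => P p.1 p.2)] : Dfn L M (fun y => ∀ᶠ x in q, P y x) :=
  h.dfn P hP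

variable [LinearOrder M] [OM L M] [DenselyOrdered M] [NoMinOrder M] [NoMaxOrder M] [Nonempty M]

theorem tracks {T : Type} (p : T → Filter X) [hp : ∀ t, DT L M (p t)] (A : T → U → X → M → Prop)
    (B : T → V → X → M → Prop) [hA : ∀ t, Dfn3 L M (A t)] [hB : ∀ t, Dfn3 L M (B t)]
    (cA : ∀ t u x a b c, A t u x a → A t u x c → a ≤ b → b ≤ c → A t u x b)
    (cB : ∀ t u x a b c, B t u x a → B t u x c → a ≤ b → b ≤ c → B t u x b) (T' : List T) :
    ∀ {Z : Type u} [MSp M Z] (ΩA : Z → U → Prop) (ΩB : Z → V → Prop), Dfn2 L M ΩA → Dfn2 L M ΩB →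
      (∀ z u v, ΩA z u → ΩB z v → ∃ t ∈ T', ∀ᶠ x in p t, ∃ y, A t u x y ∧ B t v x y) →
      ∃ (ι : Type) (_ : Finite ι) (q : ι → Z → Filter (X × M)) (τ : ι → T), (∀ i, UT L M (q i)) ∧
        ∀ z, (∀ u, ΩA z u → ∃ i, ∀ᶠ s in q i z, A (τ i) u s.1 s.2) ∨
          (∀ v, ΩB z v → ∃ i, ∀ᶠ s in q i z, B (τ i) v s.1 s.2) := by
  induction T' with
  | nil =>
    intro Z _ ΩA ΩB _ _ h
    refine ⟨Empty, inferInstance, fun e => e.elim, fun e => e.elim, fun e => e.elim, fun z => ?_⟩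
    by_cases h1 : ∃ u, ΩA z u
    · obtain ⟨u, hu⟩ := h1
      right
      intro v hv
      obtain ⟨t, ht, _⟩ := h z u v hu hv
      simp at ht
    · left
      intro u hu
      exact (h1 ⟨u, hu⟩).elim
  | cons t0 T' ih =>
    intro Z _ ΩA ΩB hΩA hΩB hyp
    let lef : U → U → Prop := fun u w => ∀ᶠ x in p t0, ∀ a, A t0 u x a → ∃ a', A t0 w x a' ∧ a ≤ a'
    let gt : V → U → Prop := fun v w => ∀ᶠ x in p t0, ∀ b, B t0 v x b → ∀ a, A t0 w x a → a < b
    have hlef : Dfn2 L M lef := ⟨by infer_instance⟩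
    have hgt : Dfn2 L M gt := ⟨by infer_instance⟩
    have lrefl : ∀ u, lef u u := fun u => Eventually.of_forall fun x a ha => ⟨a, ha, le_rfl⟩
    have ltr : ∀ a b c, lef a b → lef b c → lef a c := by
      intro u v w h1 h2
      refine (h1.and h2).mono fun x hx a ha => ?_
      obtain ⟨a', h3, h4⟩ := hx.1 a ha
      obtain ⟨a'', h5, h6⟩ := hx.2 a' h3
      exact ⟨a'', h5, h4.trans h6⟩
    have ltot : ∀ a b, lef a b ∨ lef b a := by
      intro u v
      by_cases h : lef u v
      · exact Or.inl h
      · right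
        have h2 := ((hp t0).not_iff L (fun x => ∀ a, A t0 u x a → ∃ a', A t0 v x a' ∧ a ≤ a')).2 h
        refine h2.mono fun x hx b hb => ?_
        push Not at hx
        obtain ⟨a, ha, hx⟩ := hx
        exact ⟨a, ha, (hx b hb).le⟩
    have gtl : ∀ v w w', gt v w → lef w' w → gt v w' := by
      intro v w w' h1 h2
      refine (h1.and h2).mono fun x hx b hb a ha => ?_
      obtain ⟨a', h3, h4⟩ := hx.2 a ha
      exact h4.trans_lt (hx.1 b hb a' h3)
    obtain ⟨ι1, hι1, q1, τ1, hq1, hit1⟩ := ih (Z := Z × U) (fun zw u => ΩA zw.1 u ∧ lef u zw.2)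
      (fun zw v => ΩB zw.1 v ∧ gt v zw.2) ⟨by infer_instance⟩ ⟨by infer_instance⟩ (by
        rintro ⟨z, w⟩ u v ⟨hu, hl⟩ ⟨hv, hg⟩
        obtain ⟨t, ht, h⟩ := hyp z u v hu hv
        rcases List.mem_cons.1 ht with rfl | ht
        · refine ((hp t).ne ?_).elim
          refine ((h.and hl).and hg).mono fun x hx => ?_
          obtain ⟨⟨⟨y, h1, h2⟩, h3⟩, h4⟩ := hx
          obtain ⟨a', h5, h6⟩ := h3 y h1
          exact absurd (h4 y h2 a' h5) (not_lt.2 h6)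
        · exact ⟨t, ht, h⟩)
    let HA : Z → U → U → Prop := fun z w u => ∃ i, ∀ᶠ s in q1 i (z, w), A (τ1 i) u s.1 s.2
    have hHA : Dfn3 L M HA := ⟨dfnFinEx _ fun i => by infer_instance⟩
    let ZA : Z → U → Prop := fun z w => ∀ u, ΩA z u ∧ lef u w → HA z w u
    have hZA : Dfn2 L M ZA := ⟨by infer_instance⟩
    let Low : Z → U → Prop := fun z u => ∃ w, (ΩA z w ∧ ZA z w) ∧ lef u w
    have hLow : Dfn2 L M Low := ⟨by infer_instance⟩
    let High : Z → U → Prop := fun z u => ΩA z u ∧ ¬ Low z u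
    have hHigh : Dfn2 L M High := ⟨by infer_instance⟩
    obtain ⟨r, hr, hrc⟩ := cof_all L (M := M) (X := U) (fun z w => ΩA z w ∧ ZA z w) (fun (_ : Z) => lef)
      ⟨by infer_instance⟩ ⟨by infer_instance⟩ (fun _ => ltot) (fun _ => ltr)
    obtain ⟨s, hs, hsc⟩ := cof_all L (M := M) (X := U) High (fun (_ : Z) a b => lef b a)
      ⟨by infer_instance⟩ ⟨by infer_instance⟩ (fun _ a b => ltot b a) (fun _ a b c h1 h2 => ltr _ _ _ h2 h1)
    have hS : Dfn2 L M (fun (wx : U × X) y => A t0 wx.1 wx.2 y) := ⟨by infer_instance⟩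
    obtain ⟨e, he, hei⟩ := exists_end L (fun (wx : U × X) y => A t0 wx.1 wx.2 y)
    have he1 : UT L M (fun k : (Z × U) × X => e (k.1.2, k.2)) := he.comp L (fun k : (Z × U) × X => (k.1.2, k.2))
    have he2 := he1.map L (fun (k : (Z × U) × X) (y : M) => (k.2, y)) inferInstance
    have he3 := UT.bind L ((hp t0).ut L (Z := Z × U)) he2
    have he4 := UT.bind L hs he3
    obtain ⟨qs, hqs, hqsi⟩ : ∃ qs : Z → Filter (X × M), UT L M qs ∧ ∀ z (P : X × M → Prop), (∀ᶠ k in qs z, P k) ↔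
        ∀ᶠ w in s z, ∀ᶠ x in p t0, ∀ᶠ y in e (w, x), P (x, y) := by
      refine ⟨_, he4, fun z P => ?_⟩
      simp only [eventually_bind, eventually_map]
    have rq : ∀ i, UT L M (fun z => (r z).bind (fun w => q1 i (z, w))) := fun i => hr.bind L (hq1 i)
    have sq : ∀ i, UT L M (fun z => (s z).bind (fun w => q1 i (z, w))) := fun i => hs.bind L (hq1 i)
    have hlow : ∀ z u, ΩA z u → Low z u → ∃ i, ∀ᶠ k in (r z).bind (fun w => q1 i (z, w)), A (τ1 i) u k.1 k.2 := by
      rintro z u hu ⟨w0, hw0, hl0⟩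
      simp only [eventually_bind]
      refine (hr.dt L z).exists_fin L (fun i w => ∀ᶠ k in q1 i (z, w), A (τ1 i) u k.1 k.2) (fun i => by infer_instance) ?_
      exact (hrc z w0 hw0).mono fun w hw => hw.1.2 u ⟨hu, ltr _ _ _ hl0 hw.2⟩
    have hhigh : ∀ z v, ΩB z v → (∃ w, High z w ∧ gt v w) → ∃ i, ∀ᶠ k in (s z).bind (fun w => q1 i (z, w)), B (τ1 i) v k.1 k.2 := by
      rintro z v hv ⟨w0, hw0, hl0⟩
      simp only [eventually_bind]
      refine (hs.dt L z).exists_fin L (fun i w => ∀ᶠ k in q1 i (z, w), B (τ1 i) v k.1 k.2) (fun i => by infer_instance) ?_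
      refine (hsc z w0 hw0).mono fun w hw => ?_
      have hnz : ¬ ZA z w := fun h => hw.1.2 ⟨w, ⟨hw.1.1, h⟩, lrefl w⟩
      exact (hit1 (z, w)).resolve_left hnz v ⟨hv, gtl _ _ _ hl0 hw.2⟩
    obtain ⟨ι2, hι2, q2, τ2, hq2, hit2⟩ := ih (Z := Z)
      (fun z u => High z u ∧ ¬ ∀ᶠ k in qs z, A t0 u k.1 k.2)
      (fun z v => ΩB z v ∧ (¬ ∃ w, High z w ∧ gt v w) ∧ ¬ ∀ᶠ k in qs z, B t0 v k.1 k.2)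
      ⟨by infer_instance⟩ ⟨by infer_instance⟩ (by
        rintro z u v ⟨hu, hl⟩ ⟨hv, hg, hb⟩
        obtain ⟨t, ht, h⟩ := hyp z u v hu.1 hv
        rcases List.mem_cons.1 ht with rfl | ht
        · exfalso
          rw [← hqs.not_iff, hqsi] at hl hb
          have h1 := (hl.and hb).and (hsc z u hu)
          refine hs.ne z (h1.mono fun w hw => ?_)
          obtain ⟨⟨h2, h3⟩, h4, h5⟩ := hw
          have h6 : ∀ᶠ x in p t, ¬ ∀ b, B t v x b → ∀ a, A t w x a → a < b :=
            ((hp t).not_iff L _).2 fun h => hg ⟨w, h4, h⟩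
          refine (hp t).ne ((((h2.and h3).and (h5.and h6)).and h).mono fun x hx => ?_)
          obtain ⟨⟨⟨h7, h8⟩, h9, h10⟩, y, hy1, hy2⟩ := hx
          push Not at h10
          obtain ⟨b, hb, a, ha, hab⟩ := h10
          rw [hei (w, x) ⟨a, ha⟩] at h7 h8
          obtain ⟨c, hc, h7⟩ := h7
          obtain ⟨c', hc', h8⟩ := h8
          by_cases hc1 : ∀ a', A t w x a' → a' ≤ y
          · have hm : A t w x (max c' a) := by rcases max_choice c' a with h | h <;> rw [h] <;> assumption
            exact h8 _ hm (le_max_left _ _) (cB t v x b _ y hb hy2 (hab.trans (le_max_right _ _)) (hc1 _ hm))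
          · push Not at hc1
            obtain ⟨a2, ha2, hya⟩ := hc1
            have hm : A t w x (max c a2) := by rcases max_choice c a2 with h | h <;> rw [h] <;> assumption
            obtain ⟨a', ha', hma⟩ := h9 _ hm
            exact h7 _ hm (le_max_left _ _) (cA t u x y _ a' hy1 ha' (hya.le.trans (le_max_right _ _)) hma)
        · exact ⟨t, ht, h⟩)
    refine ⟨(ι1 ⊕ ι1) ⊕ (Unit ⊕ ι2), inferInstance, 
      Sum.elim (Sum.elim (fun i z => (r z).bind (fun w => q1 i (z, w))) (fun i z => (s z).bind (fun w => q1 i (z, w))))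
        (Sum.elim (fun _ => qs) q2), Sum.elim (Sum.elim τ1 τ1) (Sum.elim (fun _ => t0) τ2), ?_, ?_⟩
    · rintro ((i | i) | (i | i))
      · exact rq i
      · exact sq i
      · exact hqs
      · exact hq2 i
    · intro z
      refine (hit2 z).imp (fun h u hu => ?_) (fun h v hv => ?_)
      · by_cases h1 : Low z u
        · obtain ⟨i, hi⟩ := hlow z u hu h1
          exact ⟨Sum.inl (Sum.inl i), hi⟩
        · by_cases h2 : ∀ᶠ k in qs z, A t0 u k.1 k.2
          · exact ⟨Sum.inr (Sum.inl ()), h2⟩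
          · obtain ⟨i, hi⟩ := h u ⟨⟨hu, h1⟩, h2⟩
            exact ⟨Sum.inr (Sum.inr i), hi⟩
      · by_cases h1 : ∃ w, High z w ∧ gt v w
        · obtain ⟨i, hi⟩ := hhigh z v hv h1
          exact ⟨Sum.inl (Sum.inr i), hi⟩
        · by_cases h2 : ∀ᶠ k in qs z, B t0 v k.1 k.2
          · exact ⟨Sum.inr (Sum.inl ()), h2⟩
          · obtain ⟨i, hi⟩ := h v ⟨hv, h1, h2⟩
            exact ⟨Sum.inr (Sum.inr i), hi⟩

end seven
end OMin

end
section
set_option synthInstance.maxHeartbeats 400000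
set_option synthInstance.maxSize 40000
set_option linter.unusedVariables false
set_option linter.unusedSectionVars false
set_option linter.style.haveILetI false
namespace OMin
section eight
open Filter
variable (L : FirstOrder.Language.{u1,u2}) {M : Type u} [L.Structure M] 
variable [LinearOrder M] [OM L M] [DenselyOrdered M] [NoMinOrder M] [NoMaxOrder M] [Nonempty M]

theorem main_ind (n : ℕ) : ∀ {U : Type u} [MSp M U] (Ω : U → Prop) (S : U → Pw M n → Prop),
    Dfn1 L M Ω → Dfn2 L M S →
    (∀ (κ : Type) [Fintype κ], Fintype.card κ = 2 ^ n → ∀ u : κ → U, (∀ i, Ω (u i)) → ∃ x, ∀ i, S (u i) x) →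
    ∃ (ι : Type) (_ : Finite ι) (q : ι → Filter (Pw M n)), (∀ i, DT L M (q i)) ∧
      ∀ u, Ω u → ∃ i, ∀ᶠ x in q i, S u x := by
  induction n with
  | zero =>
    intro U _ Ω S hΩ hS hyp
    obtain ⟨r, hr, -⟩ := cof_unit L (M := M) (Z := M) (fun _ _ => True) (fun _ _ _ => True) ⟨dfnConst _⟩ ⟨dfnConst _⟩
      (fun _ _ _ => Or.inl trivial) (fun _ _ _ _ _ _ => trivial)
    refine ⟨Unit, inferInstance, fun _ => r (Classical.arbitrary M), fun _ => hr.dt L _, fun u hu => ⟨(), ?_⟩⟩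
    obtain ⟨x, hx⟩ := hyp Unit (by simp) (fun _ => u) (fun _ => hu)
    exact Eventually.of_forall fun y => hx ()
  | succ n ih =>
    intro U _ Ω S hΩ hS hyp
    have hS3 : Dfn3 L M (fun (u : U) (x : Pw M n) (y : M) => S u (x, y)) :=
      ⟨hS.out⟩
    let S3 : U → Pw M n → M → Prop := fun u x y => S u (x, y)
    have hS3' : Dfn3 L M S3 := hS3
    obtain ⟨ι, hι, q, hq, hcov⟩ := ih (U := U × U) (fun w => Ω w.1 ∧ Ω w.2) (fun w x => ∃ y, S3 w.1 x y ∧ S3 w.2 x y)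
      ⟨by infer_instance⟩ ⟨by infer_instance⟩ (by
        intro κ _ hκ w hw
        obtain ⟨⟨x, y⟩, hx⟩ := hyp (κ × Bool) (by simp [hκ, pow_succ])
          (fun k => if k.2 then (w k.1).1 else (w k.1).2) (by
            rintro ⟨k, b⟩
            cases b
            · exact (hw k).2
            · exact (hw k).1)
        exact ⟨x, fun i => ⟨y, hx (i, true), hx (i, false)⟩⟩)
    obtain ⟨J, hJ, C, hC, cC, hCD⟩ := convex_decomp L (fun (k : U × Pw M n) y => S3 k.1 k.2 y) (hD := ⟨by infer_instance⟩)
    have := Fintype.ofFinite (ι × J × J)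
    obtain ⟨κ, hκ, Q, τ, hQ, hit⟩ := tracks L (T := ι × J × J) (fun t => q t.1) (hp := fun t => hq t.1)
      (fun t u x y => C t.2.1 (u, x) y) (fun t u x y => C t.2.2 (u, x) y)
      (hA := fun t => ⟨by have := hC t.2.1; infer_instance⟩) (hB := fun t => ⟨by have := hC t.2.2; infer_instance⟩)
      (fun t u x => cC _ _) (fun t u x => cC _ _) Finset.univ.toList (Z := M) (fun _ u => Ω u) (fun _ u => Ω u)
      ⟨by infer_instance⟩ ⟨by infer_instance⟩ (by
        intro _ u v hu hv
        obtain ⟨i, hi⟩ := hcov (u, v) ⟨hu, hv⟩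
        obtain ⟨⟨j, j'⟩, hj⟩ := (hq i).exists_fin L (ι := J × J)
          (fun j x => ∃ y, C j.1 (u, x) y ∧ C j.2 (v, x) y) (fun j => by
            have := hC j.1; have := hC j.2; infer_instance) (hi.mono fun x hx => by
            obtain ⟨y, h1, h2⟩ := hx
            obtain ⟨j, hj⟩ := (hCD (u, x) y).1 h1
            obtain ⟨j', hj'⟩ := (hCD (v, x) y).1 h2
            exact ⟨(j, j'), y, hj, hj'⟩)
        exact ⟨(i, j, j'), by simp, hj⟩)
    refine ⟨κ, hκ, fun k => Q k (Classical.arbitrary M), fun k => (hQ k).dt L _, ?_⟩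
    rcases hit (Classical.arbitrary M) with h | h
    · intro u hu
      obtain ⟨i, hi⟩ := h u hu
      exact ⟨i, hi.mono fun x hx => (hCD (u, x.1) x.2).2 ⟨_, hx⟩⟩
    · intro u hu
      obtain ⟨i, hi⟩ := h u hu
      exact ⟨i, hi.mono fun x hx => (hCD (u, x.1) x.2).2 ⟨_, hx⟩⟩

theorem main_fin (n : ℕ) {U : Type u} [MSp M U] (Ω : U → Prop) (S : U → (Fin n → M) → Prop)
    (hΩ : Dfn1 L M Ω) (hS : Dfn2 L M S)
    (hyp : ∀ (κ : Type) [Fintype κ], Fintype.card κ = 2 ^ n → ∀ u : κ → U, (∀ i, Ω (u i)) → ∃ x, ∀ i, S (u i) x) :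
    ∃ (ι : Type) (_ : Finite ι) (q : ι → Filter (Fin n → M)), (∀ i, DT L M (q i)) ∧
      ∀ u, Ω u → ∃ i, ∀ᶠ x in q i, S u x := by
  have hd : dimS M (Fin n → M) = n := by simp [dimS, MSp.ι]
  obtain ⟨f, g, hf, hg, h1, h2⟩ := exists_reindex (M := M) (X := Pw M n) (Y := Fin n → M) (by rw [hd, dim_pw])
  have hf' : DMap L M f := hf.dmap
  obtain ⟨ι, hι, q, hq, hc⟩ := main_ind L n Ω (fun u x => S u (f x)) hΩ ⟨by infer_instance⟩ (by
    intro κ _ hκ u hu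
    obtain ⟨x, hx⟩ := hyp κ hκ u hu
    exact ⟨g x, fun i => by simpa [h2] using hx i⟩)
  refine ⟨ι, hι, fun i => (q i).map f, fun i => ?_, fun u hu => ?_⟩
  · have := UT.map L ((hq i).ut L (Z := M)) (fun _ x => f x) (DMap.comp' (f := fun p : M × _ => p.2) inferInstance hf')
    exact this.dt L (Classical.arbitrary M)
  · simpa only [eventually_map] using hc u hu

end eight
end OMin

end

/-- a `2^n`-consistent definable family of subsets of `M^n` has a finite tame
transversal. -/
theorem statement7 (L : FirstOrder.Language) (M : Type*) [L.Structure M] [LinearOrder M]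
    (hM : IsOMinimal L M) (n : ℕ) (S : Set (Set (Fin n → M)))
    (hS : IsDefFamily L (Set.univ : Set M) n S)
    (hcons : ∀ F : Finset (Set (Fin n → M)), ↑F ⊆ S → F.card ≤ 2 ^ n →
      (⋂₀ (F : Set (Set (Fin n → M)))).Nonempty) :
    HasFTT L n S := by
  classical
  obtain ⟨h1, h2, h3, h4, hlt, hom⟩ := hM
  have hOM : OMin.OM L M := by
    refine ⟨⟨?_⟩, hom⟩
    have := (hlt.mono (Set.empty_subset (Set.univ : Set M))).preimage_comp
      (fun j : Fin 2 => if j = 0 then (Sum.inl () : Unit ⊕ Unit) else Sum.inr ())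
    exact this
  obtain ⟨m, Ω, D, hΩ, hD, rfl⟩ := hS
  have hD2 : OMin.Dfn2 L M (fun (u : Fin m → M) (v : Fin n → M) => v ∈ famFiber D u) := by
    refine ⟨⟨?_⟩⟩
    have h6 : Set.Definable (Set.univ : Set M) L
        {v : Fin m ⊕ Fin n → M | Sum.elim (v ∘ Sum.inl) (v ∘ Sum.inr) ∈ D} := by
      simp only [Sum.elim_comp_inl_inr]
      exact hD
    exact h6
  obtain ⟨ι, hι, q, hq, hc⟩ := OMin.main_fin L n (fun u : Fin m → M => u ∈ Ω)
    (fun u v => v ∈ famFiber D u) ⟨⟨hΩ⟩⟩ hD2 (by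
      intro κ _ hκ u hu
      obtain ⟨x, hx⟩ := hcons (Finset.univ.image fun k => famFiber D (u k)) (by
        intro A hA
        simp only [Finset.coe_image, Finset.coe_univ, Set.image_univ, Set.mem_range] at hA
        obtain ⟨k, rfl⟩ := hA
        exact ⟨u k, hu k, rfl⟩) (Finset.card_image_le.trans (by simp [hκ]))
      exact ⟨x, fun i => hx _ (by simp)⟩)
  obtain ⟨N, ⟨e⟩⟩ := Finite.exists_equiv_fin ι
  refine ⟨N, fun i => {A | Set.Definable (Set.univ : Set M) L A ∧ ∀ᶠ x in q (e.symm i), x ∈ A}, fun i => ⟨⟨?_, ?_, ?_, ?_, ?_⟩, ?_⟩, ?_⟩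
  · exact fun A hA => hA.1
  · exact fun h => (hq (e.symm i)).ne (h.2.mono fun x hx => hx)
  · exact fun A hA B hB => ⟨hA.1.inter hB.1, hA.2.and hB.2⟩
  · exact fun A hA B hB hAB => ⟨hB, hA.2.mono fun x hx => hAB hx⟩
  · intro A hA
    rcases (hq (e.symm i)).ultra (fun x => x ∈ A) ⟨hA⟩ with h | h
    · exact Or.inl ⟨hA, h⟩
    · exact Or.inr ⟨hA.compl, h⟩
  · intro m' D' hD'
    have hD3 : OMin.Dfn2 L M (fun (u : Fin m' → M) (v : Fin n → M) => v ∈ famFiber D' u) := by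
      refine ⟨⟨?_⟩⟩
      have h6 : Set.Definable (Set.univ : Set M) L
          {v : Fin m' ⊕ Fin n → M | Sum.elim (v ∘ Sum.inl) (v ∘ Sum.inr) ∈ D'} := by
        simp only [Sum.elim_comp_inl_inr]
        exact hD'.mono (Set.empty_subset (Set.univ : Set M))
      exact h6
    have h5 := ((hq (e.symm i)).dfn (fun (u : Fin m' → M) (v : Fin n → M) => v ∈ famFiber D' u) hD3.out).out
    have h6 : Set.Definable (Set.univ : Set M) L
        {u : Fin m' → M | ∀ᶠ v in q (e.symm i), v ∈ famFiber D' u} := h5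
    convert h6 using 1
    ext u
    refine ⟨fun h => h.2, fun h => ⟨?_, h⟩⟩
    exact (OMin.dfn2Eta (fun (u : Fin m' → M) (v : Fin n → M) => v ∈ famFiber D' u) u).out
  · rintro A ⟨u, hu, rfl⟩
    obtain ⟨i, hi⟩ := hc u hu
    refine ⟨e i, (OMin.dfn2Eta (fun (u : Fin m → M) (v : Fin n → M) => v ∈ famFiber D u) u).out, ?_⟩
    simpa using hi
end

section
/- Let M be an o-minimal structure, let S be a definable family of subsets of M, and let k be such that every member of S is a union of at most k intervals and points (with endpoints in M ∪ {−∞,+∞}). If S is (k+1)-consistent, then at least one of the following holds: (i) S has a finite transversal contained in M; (ii) S extends to a definable 1-type over M. -/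
open FirstOrder Set

/-- The fiber over `u` of `D ⊆ M^{m+1}`, as a subset of `M`. -/
def famFiber₁ {M : Type*} {m : ℕ} (D : Set (Fin m ⊕ Fin 1 → M)) (u : Fin m → M) : Set M :=
  {x | Sum.elim u (fun _ => x) ∈ D}

/-- An `A`-definable family of subsets of `M`. -/
def IsDefFamily₁ (L : FirstOrder.Language) {M : Type*} [L.Structure M] (A : Set M)
    (S : Set (Set M)) : Prop :=
  ∃ (m : ℕ) (Ω : Set (Fin m → M)) (D : Set (Fin m ⊕ Fin 1 → M)),
    Set.Definable A L Ω ∧ Set.Definable A L D ∧ S = famFiber₁ D '' Ω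

/-- A (complete) `1`-type over `M`, as an ultrafilter on the Boolean algebra of definable
subsets of `M`. -/
def IsTypeOn₁ (L : FirstOrder.Language) {M : Type*} [L.Structure M] (p : Set (Set M)) : Prop :=
  (∀ X ∈ p, Set.Definable₁ (Set.univ : Set M) L X) ∧
  ∅ ∉ p ∧
  (∀ X ∈ p, ∀ Y ∈ p, X ∩ Y ∈ p) ∧
  (∀ X ∈ p, ∀ Y : Set M, Set.Definable₁ (Set.univ : Set M) L Y → X ⊆ Y → Y ∈ p) ∧
  (∀ X : Set M, Set.Definable₁ (Set.univ : Set M) L X → X ∈ p ∨ Xᶜ ∈ p)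

/-- A `1`-type is `A`-definable if the parameter sets of its restrictions to `∅`-definable
families are `A`-definable. -/
def IsDefTypeOver₁ (L : FirstOrder.Language) {M : Type*} [L.Structure M] (A : Set M)
    (p : Set (Set M)) : Prop :=
  ∀ (m : ℕ) (D : Set (Fin m ⊕ Fin 1 → M)), Set.Definable (∅ : Set M) L D →
    Set.Definable A L {u : Fin m → M | famFiber₁ D u ∈ p}

/-- A point or an interval in a linear order, with endpoints in `M ∪ {±∞}`. -/
def IsPointOrInterval {M : Type*} [LinearOrder M] (s : Set M) : Prop :=
  (∃ a : M, s = {a}) ∨ (∃ a b : M, s = Set.Icc a b) ∨ (∃ a b : M, s = Set.Ico a b) ∨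
  (∃ a b : M, s = Set.Ioc a b) ∨ (∃ a b : M, s = Set.Ioo a b) ∨ (∃ a : M, s = Set.Ici a) ∨
  (∃ a : M, s = Set.Iic a) ∨ (∃ a : M, s = Set.Ioi a) ∨ (∃ a : M, s = Set.Iio a) ∨
  s = Set.univ


section helpers

universe uu vv ww

variable {L : FirstOrder.Language.{uu, vv}} {M : Type ww} [L.Structure M] [LinearOrder M]

/-- Comparison of definable functions is definable. -/
lemma om_lt_def (hlt : Set.Definable (∅ : Set M) L {v : Fin 2 → M | v 0 < v 1})
    {α : Type*} {f g : (α → M) → M} (hf : (Set.univ : Set M).DefinableFun L f)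
    (hg : (Set.univ : Set M).DefinableFun L g) :
    Set.Definable (Set.univ : Set M) L {v : α → M | f v < g v} := by
  have h := (hlt.mono (Set.empty_subset (Set.univ : Set M)))
  have hF : (Set.univ : Set M).DefinableMap L (fun v : α → M => (![f v, g v] : Fin 2 → M)) := by
    intro i
    fin_cases i
    · exact hf
    · exact hg
  exact h.preimage_map hF

lemma om_proj {α : Type*} (i : α) : (Set.univ : Set M).DefinableFun L (fun v : α → M => v i) :=
  Set.DefinableFun.proj L

lemma om_const {α : Type*} (a : M) : (Set.univ : Set M).DefinableFun L (fun _ : α → M => a) :=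
  FirstOrder.Language.definableFun_const L _ (Set.mem_univ a)

/-- A basis deciding all rays decides all definable sets. -/
lemma om_decides (hM : IsOMinimal L M) (B : Set M) (R : M → M → Prop)
    (hne : B.Nonempty)
    (hdir : ∀ b ∈ B, ∀ b' ∈ B, ∃ c ∈ B, ∀ x, R c x → R b x ∧ R b' x)
    (hdec : ∀ c, (∃ b ∈ B, ∀ x, R b x → x < c) ∨ (∃ b ∈ B, ∀ x, R b x → c < x))
    (X : Set M) (hX : Set.Definable₁ (Set.univ : Set M) L X) :
    (∃ b ∈ B, ∀ x, R b x → x ∈ X) ∨ (∃ b ∈ B, ∀ x, R b x → x ∉ X) := by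
  obtain ⟨-, -, -, -, -, hom⟩ := hM
  obtain ⟨F, rfl, hF⟩ := hom X hX
  have key : ∀ t ∈ F, (∃ b ∈ B, ∀ x, R b x → x ∈ t) ∨ (∃ b ∈ B, ∀ x, R b x → x ∉ t) := by
    intro t ht
    rcases hF t ht with ⟨a, rfl⟩ | ⟨a, b, rfl⟩ | ⟨a, rfl⟩ | ⟨a, rfl⟩ | rfl
    · right
      rcases hdec a with ⟨b, hb, h⟩ | ⟨b, hb, h⟩
      · exact ⟨b, hb, fun x hx => (h x hx).ne⟩
      · exact ⟨b, hb, fun x hx => (h x hx).ne'⟩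
    · rcases hdec a with ⟨c, hc, h⟩ | ⟨c, hc, h⟩
      · exact Or.inr ⟨c, hc, fun x hx hx' => lt_asymm (h x hx) hx'.1⟩
      · rcases hdec b with ⟨d, hd, h'⟩ | ⟨d, hd, h'⟩
        · obtain ⟨e, he, h''⟩ := hdir c hc d hd
          exact Or.inl ⟨e, he, fun x hx => ⟨h x (h'' x hx).1, h' x (h'' x hx).2⟩⟩
        · exact Or.inr ⟨d, hd, fun x hx hx' => lt_asymm (h' x hx) hx'.2⟩
    · rcases hdec a with ⟨c, hc, h⟩ | ⟨c, hc, h⟩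
      · exact Or.inr ⟨c, hc, fun x hx hx' => lt_asymm (h x hx) hx'⟩
      · exact Or.inl ⟨c, hc, h⟩
    · rcases hdec a with ⟨c, hc, h⟩ | ⟨c, hc, h⟩
      · exact Or.inl ⟨c, hc, h⟩
      · exact Or.inr ⟨c, hc, fun x hx hx' => lt_asymm (h x hx) hx'⟩
    · obtain ⟨b, hb⟩ := hne
      exact Or.inl ⟨b, hb, fun x _ => Set.mem_univ x⟩
  clear hF hX
  classical
  induction F using Finset.induction_on with
  | empty =>
    obtain ⟨b, hb⟩ := hne
    exact Or.inr ⟨b, hb, fun x _ => by simp⟩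
  | insert t F _ ih =>
    rcases key t (Finset.mem_insert_self _ _) with ⟨b, hb, h⟩ | ⟨b, hb, h⟩
    · exact Or.inl ⟨b, hb, fun x hx => ⟨t, by simp, h x hx⟩⟩
    · rcases ih (fun t ht => key t (Finset.mem_insert_of_mem ht)) with ⟨c, hc, h'⟩ | ⟨c, hc, h'⟩
      · refine Or.inl ⟨c, hc, fun x hx => ?_⟩
        obtain ⟨s, hs, hxs⟩ := h' x hx
        exact ⟨s, by simpa using Or.inr hs, hxs⟩
      · obtain ⟨e, he, h''⟩ := hdir b hb c hc
        refine Or.inr ⟨e, he, fun x hx => ?_⟩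
        rintro ⟨s, hs, hxs⟩
        rcases Finset.mem_insert.1 (Finset.mem_coe.1 hs) with rfl | hs
        · exact h x (h'' x hx).1 hxs
        · exact h' x (h'' x hx).2 ⟨s, hs, hxs⟩

/-- A definable basis deciding all rays yields a definable type. -/
lemma om_type (hM : IsOMinimal L M) (S : Set (Set M))
    (hSdef : ∀ X ∈ S, Set.Definable₁ (Set.univ : Set M) L X)
    (B : Set M) (R : M → M → Prop)
    (hBdef : Set.Definable (Set.univ : Set M) L {v : Fin 1 → M | v 0 ∈ B})
    (hRdef : Set.Definable (Set.univ : Set M) L {v : Fin 2 → M | R (v 0) (v 1)})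
    (hne : B.Nonempty) (hRne : ∀ b ∈ B, ∃ x, R b x)
    (hdir : ∀ b ∈ B, ∀ b' ∈ B, ∃ c ∈ B, ∀ x, R c x → R b x ∧ R b' x)
    (hdec : ∀ c, (∃ b ∈ B, ∀ x, R b x → x < c) ∨ (∃ b ∈ B, ∀ x, R b x → c < x))
    (hgood : ∀ b ∈ B, ∀ X ∈ S, ∃ x ∈ X, R b x) :
    ∃ p, IsTypeOn₁ L p ∧ IsDefTypeOver₁ L (Set.univ : Set M) p ∧ S ⊆ p := by
  have dec := om_decides hM B R hne hdir hdec
  refine ⟨{X | Set.Definable₁ (Set.univ : Set M) L X ∧ ∃ b ∈ B, ∀ x, R b x → x ∈ X},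
    ⟨fun X hX => hX.1, ?_, ?_, ?_, ?_⟩, ?_, ?_⟩
  · rintro ⟨-, b, hb, h⟩
    obtain ⟨x, hx⟩ := hRne b hb
    exact h x hx
  · rintro X ⟨hX, b, hb, h⟩ Y ⟨hY, c, hc, h'⟩
    obtain ⟨e, he, h''⟩ := hdir b hb c hc
    exact ⟨Set.Definable.inter hX hY, e, he, fun x hx => ⟨h x (h'' x hx).1, h' x (h'' x hx).2⟩⟩
  · rintro X ⟨hX, b, hb, h⟩ Y hY hXY
    exact ⟨hY, b, hb, fun x hx => hXY (h x hx)⟩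
  · intro X hX
    rcases dec X hX with h | h
    · exact Or.inl ⟨hX, h⟩
    · exact Or.inr ⟨Set.Definable.compl hX, h⟩
  · intro m D hD
    have hD' := hD.mono (Set.empty_subset (Set.univ : Set M))
    have hfib : ∀ u : Fin m → M, Set.Definable₁ (Set.univ : Set M) L (famFiber₁ D u) := by
      intro u
      have hF : (Set.univ : Set M).DefinableMap L
          (fun v : Fin 1 → M => (Sum.elim u (fun _ => v 0) : Fin m ⊕ Fin 1 → M)) := by
        rintro (i | i)
        · exact om_const (u i)
        · exact om_proj 0
      exact hD'.preimage_map hF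
    have h1 : Set.Definable (Set.univ : Set M) L
        {w : ((Fin m ⊕ Fin 1) ⊕ Fin 1) → M |
          (R (w (.inl (.inr 0))) (w (.inr 0)))ᶜ ∨
            Sum.elim (fun i => w (.inl (.inl i))) (fun _ => w (.inr 0)) ∈ D} := by
      have h0 : Set.Definable (Set.univ : Set M) L
          {w : ((Fin m ⊕ Fin 1) ⊕ Fin 1) → M |
            Sum.elim (fun i => w (.inl (.inl i))) (fun _ => w (.inr 0)) ∈ D} := by
        convert! hD'.preimage_comp
          (Sum.elim (fun i => .inl (.inl i)) (fun _ => .inr 0) :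
            Fin m ⊕ Fin 1 → ((Fin m ⊕ Fin 1) ⊕ Fin 1)) using 1
        ext w
        simp only [Set.mem_preimage, Set.mem_ofPred_eq, Sum.comp_elim]
        rfl
      exact Set.Definable.union (Set.Definable.compl (hRdef.preimage_comp
        (![.inl (.inr 0), .inr 0] : Fin 2 → ((Fin m ⊕ Fin 1) ⊕ Fin 1)))) h0
    have h2 := (Set.Definable.inter (hBdef.preimage_comp
      (fun _ => .inr 0 : Fin 1 → (Fin m ⊕ Fin 1))) h1.forall_of_finite).exists_of_finite
    convert! h2 using 1
    ext u
    constructor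
    · rintro ⟨-, b, hb, h⟩
      refine ⟨fun _ => b, hb, fun x => ?_⟩
      by_cases hx : R b (x 0)
      · exact Or.inr (h (x 0) hx)
      · exact Or.inl hx
    · rintro ⟨b, hb, h⟩
      refine ⟨hfib u, b 0, hb, fun x hx => ?_⟩
      rcases h (fun _ => x) with h | h
      · exact absurd hx h
      · exact h
  · intro X hX
    refine ⟨hSdef X hX, ?_⟩
    rcases dec X (hSdef X hX) with h | ⟨b, hb, h⟩
    · exact h
    · obtain ⟨x, hx, hR⟩ := hgood b hb X hX
      exact absurd hx (h x hR)

/-- Definable nonempty sets bounded below have a greatest lower bound. -/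
lemma om_glb (hM : IsOMinimal L M) (T : Set M) (hT : Set.Definable₁ (Set.univ : Set M) L T)
    (hne : T.Nonempty) (hbd : BddBelow T) : ∃ a, IsGLB T a := by
  obtain ⟨-, hd, hmin, hmax, -, hom⟩ := hM
  obtain ⟨F, rfl, hF⟩ := hom T hT
  clear hT
  classical
  induction F using Finset.induction_on with
  | empty => simp at hne
  | insert t F _ ih =>
    have e : (⋃₀ ((insert t F : Finset (Set M)) : Set (Set M))) = t ∪ ⋃₀ (F : Set (Set M)) := by
      simp
    rw [e] at hne hbd ⊢
    have hb1 : BddBelow t := hbd.mono Set.subset_union_left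
    have hb2 := hbd.mono (Set.subset_union_right (s := t) (t := ⋃₀ (F : Set (Set M))))
    have h1 : t.Nonempty → ∃ a, IsGLB t a := by
      intro htne
      rcases hF t (Finset.mem_insert_self _ _) with ⟨a, rfl⟩ | ⟨a, b, rfl⟩ | ⟨a, rfl⟩ | ⟨a, rfl⟩ | rfl
      · exact ⟨a, isGLB_singleton⟩
      · exact ⟨a, isGLB_Ioo (by obtain ⟨x, hx⟩ := htne; exact hx.1.trans hx.2)⟩
      · exact ⟨a, isGLB_Ioi⟩
      · obtain ⟨m, hm⟩ := hb1
        obtain ⟨y, hy⟩ := exists_lt (min m a)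
        exact absurd (hm (show y ∈ Set.Iio a from hy.trans_le (min_le_right _ _)))
          (not_le.2 (hy.trans_le (min_le_left _ _)))
      · exact absurd hb1 not_bddBelow_univ
    have h2 := fun h => ih (fun t ht => hF t (Finset.mem_insert_of_mem ht)) h hb2
    rcases t.eq_empty_or_nonempty with rfl | ht
    · rw [Set.empty_union] at hne ⊢
      exact h2 hne
    · rcases (⋃₀ (F : Set (Set M))).eq_empty_or_nonempty with h0 | hF0
      · rw [h0, Set.union_empty]; exact h1 ht
      · obtain ⟨a, ha⟩ := h1 ht
        obtain ⟨b, hb⟩ := h2 hF0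
        exact ⟨a ⊓ b, ha.union hb⟩

lemma om_ordConnected {s : Set M} (h : IsPointOrInterval s) : s.OrdConnected := by
  rcases h with ⟨a, rfl⟩ | ⟨a, b, rfl⟩ | ⟨a, b, rfl⟩ | ⟨a, b, rfl⟩ | ⟨a, b, rfl⟩ | ⟨a, rfl⟩ |
    ⟨a, rfl⟩ | ⟨a, rfl⟩ | ⟨a, rfl⟩ | rfl <;> infer_instance

/-- A convex set missing `c` lies on one side of `c`. -/
lemma om_side {s : Set M} (h : s.OrdConnected) {c : M} (hc : c ∉ s) :
    s ⊆ Set.Iio c ∨ s ⊆ Set.Ioi c := by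
  by_contra hcon
  push Not at hcon
  obtain ⟨h1, h2⟩ := hcon
  obtain ⟨x, hx, hx'⟩ := Set.not_subset.1 h1
  obtain ⟨y, hy, hy'⟩ := Set.not_subset.1 h2
  have hmem : c ∈ Set.Icc y x := ⟨not_lt.1 hy', not_lt.1 hx'⟩
  exact hc (h.out hy hx hmem)

/-- A set meeting every member of the family. -/
def OmGood (S : Set (Set M)) (C : Set M) : Prop := ∀ X ∈ S, ∃ x ∈ X, x ∈ C

lemma OmGood.mono {S : Set (Set M)} {C D : Set M} (h : OmGood S C) (hCD : C ⊆ D) : OmGood S D :=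
  fun X hX => let ⟨x, hx, hxC⟩ := h X hX; ⟨x, hx, hCD hxC⟩

/-- The set of `t` such that `(b,t]` is good is definable. -/
lemma om_T_def (hlt : Set.Definable (∅ : Set M) L {v : Fin 2 → M | v 0 < v 1})
    (S : Set (Set M)) (hS : IsDefFamily₁ L (Set.univ : Set M) S) (b : M) :
    Set.Definable₁ (Set.univ : Set M) L {t | OmGood S (Set.Ioc b t)} := by
  obtain ⟨m, Ω, D, hΩ, hD, rfl⟩ := hS
  have h1 : Set.Definable (Set.univ : Set M) L
      {w : ((Fin 1 ⊕ Fin m) ⊕ Fin 1) → M |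
        Sum.elim (fun i => w (.inl (.inr i))) (fun _ => w (.inr 0)) ∈ D} := by
    convert! hD.preimage_comp
      (Sum.elim (fun i => .inl (.inr i)) (fun _ => .inr 0) :
        Fin m ⊕ Fin 1 → ((Fin 1 ⊕ Fin m) ⊕ Fin 1)) using 1
    ext w
    simp only [Set.mem_preimage, Set.mem_ofPred_eq, Sum.comp_elim]
    rfl
  have h2 : Set.Definable (Set.univ : Set M) L
      {w : ((Fin 1 ⊕ Fin m) ⊕ Fin 1) → M | b < w (.inr 0)} :=
    om_lt_def hlt (om_const b) (om_proj _)
  have h3 : Set.Definable (Set.univ : Set M) L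
      {w : ((Fin 1 ⊕ Fin m) ⊕ Fin 1) → M | w (.inl (.inl 0)) < w (.inr 0)} :=
    om_lt_def hlt (om_proj _) (om_proj _)
  have h4 := (h1.inter (h2.inter h3.compl)).exists_of_finite
  have h5 := (((hΩ.preimage_comp (Sum.inr : Fin m → Fin 1 ⊕ Fin m)).compl).union h4).forall_of_finite
  unfold Set.Definable₁
  convert! h5 using 1
  ext t
  constructor
  · intro h u
    by_cases hu : u ∈ Ω
    · obtain ⟨x, hx, hx'⟩ := h _ ⟨u, hu, rfl⟩
      exact Or.inr ⟨fun _ => x, hx, hx'.1, not_lt.2 hx'.2⟩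
    · exact Or.inl hu
  · rintro h _ ⟨u, hu, rfl⟩
    rcases h u with h | ⟨x, hx, hx1, hx2⟩
    · exact absurd hu h
    · exact ⟨x 0, hx, hx1, not_lt.1 hx2⟩

lemma om_fam_def (S : Set (Set M)) (hS : IsDefFamily₁ L (Set.univ : Set M) S) :
    ∀ X ∈ S, Set.Definable₁ (Set.univ : Set M) L X := by
  obtain ⟨m, Ω, D, hΩ, hD, rfl⟩ := hS
  rintro _ ⟨u, -, rfl⟩
  have hF : (Set.univ : Set M).DefinableMap L
      (fun v : Fin 1 → M => (Sum.elim u (fun _ => v 0) : Fin m ⊕ Fin 1 → M)) := by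
    rintro (i | i)
    · exact om_const (u i)
    · exact om_proj 0
  exact hD.preimage_map hF

/-- If the family is not in a definable type, then at each definable cut some convex
neighbourhood is not good. -/
lemma om_not_good (hM : IsOMinimal L M) (S : Set (Set M))
    (hS : IsDefFamily₁ L (Set.univ : Set M) S)
    (hno : ¬ ∃ p, IsTypeOn₁ L p ∧ IsDefTypeOver₁ L (Set.univ : Set M) p ∧ S ⊆ p) :
    (∃ c, ¬ OmGood S (Set.Iio c)) ∧ (∃ c, ¬ OmGood S (Set.Ioi c)) ∧
    (∀ a, ∃ c < a, ¬ OmGood S (Set.Ioo c a)) ∧ (∀ a, ∃ c > a, ¬ OmGood S (Set.Ioo a c)) := by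
  have hSd := om_fam_def S hS
  have hM' := hM
  obtain ⟨hne, hd, hmin, hmax, hlt, -⟩ := hM'
  have hu : Set.Definable (Set.univ : Set M) L {v : Fin 1 → M | v 0 ∈ (Set.univ : Set M)} := by
    convert! Set.definable_univ using 1
  refine ⟨?_, ?_, fun a => ?_, fun a => ?_⟩
  · by_contra! hcon
    refine hno (om_type hM S hSd Set.univ (fun b x => x < b) hu
      (om_lt_def hlt (om_proj _) (om_proj _)) Set.univ_nonempty (fun b _ => exists_lt b)
      (fun b _ c _ => ⟨min b c, trivial, fun x hx => lt_min_iff.1 hx⟩)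
      (fun c => Or.inl ⟨c, trivial, fun x hx => hx⟩) (fun b _ X hX => hcon b X hX))
  · by_contra! hcon
    refine hno (om_type hM S hSd Set.univ (fun b x => b < x) hu
      (om_lt_def hlt (om_proj _) (om_proj _)) Set.univ_nonempty (fun b _ => exists_gt b)
      (fun b _ c _ => ⟨max b c, trivial, fun x hx => max_lt_iff.1 hx⟩)
      (fun c => Or.inr ⟨c, trivial, fun x hx => hx⟩) (fun b _ X hX => hcon b X hX))
  · by_contra! hcon
    refine hno (om_type hM S hSd (Set.Iio a) (fun b x => b < x ∧ x < a)
      (om_lt_def hlt (om_proj _) (om_const _))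
      ((om_lt_def hlt (om_proj _) (om_proj _)).inter (om_lt_def hlt (om_proj _) (om_const _)))
      (exists_lt a) (fun b hb => exists_between hb)
      (fun b hb c hc => ⟨max b c, max_lt hb hc, fun x hx =>
        ⟨⟨(max_lt_iff.1 hx.1).1, hx.2⟩, ⟨(max_lt_iff.1 hx.1).2, hx.2⟩⟩⟩)
      (fun c => ?_) (fun b hb X hX => hcon b hb X hX))
    rcases lt_or_ge c a with h | h
    · exact Or.inr ⟨c, h, fun x hx => hx.1⟩
    · obtain ⟨b, hb⟩ := exists_lt a
      exact Or.inl ⟨b, hb, fun x hx => hx.2.trans_le h⟩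
  · by_contra! hcon
    refine hno (om_type hM S hSd (Set.Ioi a) (fun b x => a < x ∧ x < b)
      (om_lt_def hlt (om_const _) (om_proj _))
      ((om_lt_def hlt (om_const _) (om_proj _)).inter (om_lt_def hlt (om_proj _) (om_proj _)))
      (exists_gt a) (fun b hb => exists_between hb)
      (fun b hb c hc => ⟨min b c, lt_min hb hc, fun x hx =>
        ⟨⟨hx.1, (lt_min_iff.1 hx.2).1⟩, ⟨hx.1, (lt_min_iff.1 hx.2).2⟩⟩⟩)
      (fun c => ?_) (fun b hb X hX => hcon b hb X hX))
    rcases lt_or_ge a c with h | h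
    · exact Or.inl ⟨c, h, fun x hx => hx.2⟩
    · obtain ⟨b, hb⟩ := exists_gt a
      exact Or.inr ⟨b, hb, fun x hx => h.trans_lt hx.1⟩

/-- Finitely many points pierce all good convex sets that are not to the right of `b`. -/
def OmQ (S : Set (Set M)) (b : M) : Prop :=
  ∃ F : Finset M, ∀ C : Set M, C.OrdConnected → OmGood S C → (∃ x ∈ F, x ∈ C) ∨ C ⊆ Set.Ioi b

lemma om_step (hM : IsOMinimal L M) (S : Set (Set M)) (hne : S.Nonempty)
    (hS : IsDefFamily₁ L (Set.univ : Set M) S)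
    (hno : ¬ ∃ p, IsTypeOn₁ L p ∧ IsDefTypeOver₁ L (Set.univ : Set M) p ∧ S ⊆ p)
    (hnF : ¬ ∃ F : Finset M, ∀ C : Set M, C.OrdConnected → OmGood S C → ∃ x ∈ F, x ∈ C)
    (b : M) (hb : OmQ S b) : ∃ b', b < b' ∧ OmGood S (Set.Ioc b b') ∧ OmQ S b' := by
  classical
  obtain ⟨-, ⟨c, hc⟩, hleft, hright⟩ := om_not_good hM S hS hno
  obtain ⟨F, hF⟩ := hb
  have hlt := hM.2.2.2.2.1
  set T : Set M := {t | OmGood S (Set.Ioc b t)} with hTdef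
  have hTd : Set.Definable₁ (Set.univ : Set M) L T := om_T_def hlt S hS b
  have hTb : ∀ t ∈ T, b < t := by
    intro t ht
    obtain ⟨X, hX⟩ := hne
    obtain ⟨x, -, hx⟩ := ht X hX
    exact hx.1.trans_le hx.2
  have hTup : ∀ t ∈ T, ∀ t', t ≤ t' → t' ∈ T := fun t ht t' h =>
    OmGood.mono ht (Set.Ioc_subset_Ioc_right h)
  have hTC : ∀ C : Set M, OmGood S C → C ⊆ Set.Ioi b → ∀ t, C ⊆ Set.Iic t → t ∈ T :=
    fun C hC h1 t h2 => hC.mono (fun x hx => ⟨h1 hx, h2 hx⟩)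
  rcases T.eq_empty_or_nonempty with hT | hT
  · exfalso
    refine hnF ⟨insert c F, fun C hC hg => ?_⟩
    by_cases hcC : c ∈ C
    · exact ⟨c, by simp, hcC⟩
    rcases hF C hC hg with ⟨x, hx, hxC⟩ | hCb
    · exact ⟨x, by simp [hx], hxC⟩
    rcases om_side hC hcC with h | h
    · have : c ∈ T := hTC C hg hCb c (h.trans Set.Iio_subset_Iic_self)
      simp [hT] at this
    · exact absurd (hg.mono h) hc
  · obtain ⟨a, ha⟩ := om_glb hM T hTd hT ⟨b, fun t ht => (hTb t ht).le⟩
    by_cases haT : a ∈ T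
    · obtain ⟨c, hca, hc⟩ := hleft a
      refine ⟨a, hTb a haT, haT, insert a (insert c F), fun C hC hg => ?_⟩
      by_cases haC : a ∈ C
      · exact Or.inl ⟨a, by simp, haC⟩
      by_cases hcC : c ∈ C
      · exact Or.inl ⟨c, by simp, hcC⟩
      rcases hF C hC hg with ⟨x, hx, hxC⟩ | hCb
      · exact Or.inl ⟨x, by simp [hx], hxC⟩
      rcases om_side hC haC with h | h
      · exfalso
        rcases om_side hC hcC with h' | h'
        · exact absurd (ha.1 (hTC C hg hCb c (h'.trans Set.Iio_subset_Iic_self))) (not_le.2 hca)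
        · exact hc (hg.mono fun x hx => ⟨h' hx, h hx⟩)
      · exact Or.inr h
    · obtain ⟨t, hat, ht⟩ := hright a
      have hba : b ≤ a := ha.2 (fun t ht => (hTb t ht).le)
      have htT : t ∈ T := by
        obtain ⟨t', ht', h⟩ := (isGLB_lt_iff ha).1 hat
        exact hTup t' ht' t h.le
      refine ⟨t, hba.trans_lt hat, htT, insert a (insert t F), fun C hC hg => ?_⟩
      by_cases haC : a ∈ C
      · exact Or.inl ⟨a, by simp, haC⟩
      by_cases htC : t ∈ C
      · exact Or.inl ⟨t, by simp, htC⟩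
      rcases hF C hC hg with ⟨x, hx, hxC⟩ | hCb
      · exact Or.inl ⟨x, by simp [hx], hxC⟩
      rcases om_side hC htC with h | h
      · exfalso
        rcases om_side hC haC with h' | h'
        · exact haT (hTC C hg hCb a (h'.trans Set.Iio_subset_Iic_self))
        · exact ht (hg.mono fun x hx => ⟨h' hx, h hx⟩)
      · exact Or.inr h

/-- By `(k+1)`-consistency every member of the family has a good convex piece. -/
lemma om_piece (S : Set (Set M)) (k : ℕ)
    (hcons : ∀ F : Finset (Set M), ↑F ⊆ S → F.card ≤ k + 1 →
      (⋂₀ (F : Set (Set M))).Nonempty) (X : Set M) (hX : X ∈ S) (m : ℕ) (hm : m ≤ k)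
    (f : Fin m → Set M) (hf : X = ⋃ i, f i) : ∃ i, OmGood S (f i) := by
  classical
  by_contra! hcon
  have : ∀ i, ∃ Y ∈ S, ∀ x ∈ Y, x ∉ f i := by
    intro i
    have := hcon i
    unfold OmGood at this
    push Not at this
    exact this
  choose Y hY hYf using this
  obtain ⟨x, hx⟩ := hcons (insert X (Finset.univ.image Y))
    (by
      intro Z hZ
      rcases Finset.mem_insert.1 (Finset.mem_coe.1 hZ) with rfl | hZ
      · exact hX
      · obtain ⟨i, -, rfl⟩ := Finset.mem_image.1 hZ
        exact hY i)
    (by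
      refine (Finset.card_insert_le _ _).trans ?_
      have h : (Finset.univ.image Y).card ≤ m := by
        simpa using Finset.card_image_le (s := (Finset.univ : Finset (Fin m))) (f := Y)
      omega)
  have hxX : x ∈ X := hx X (by simp)
  rw [hf] at hxX
  obtain ⟨i, hi⟩ := Set.mem_iUnion.1 hxX
  exact hYf i x (hx (Y i) (by simp)) hi

end helpers

/-- a `(k+1)`-consistent definable family of subsets of `M`, each a union of at
most `k` intervals and points, has a finite transversal in `M` or extends to a definable
`1`-type. -/
theorem statement10 (L : FirstOrder.Language) (M : Type*) [L.Structure M] [LinearOrder M]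
    (hM : IsOMinimal L M) (S : Set (Set M)) (hS : IsDefFamily₁ L (Set.univ : Set M) S)
    (k : ℕ)
    (hint : ∀ X ∈ S, ∃ m ≤ k, ∃ f : Fin m → Set M,
      (∀ i, IsPointOrInterval (f i)) ∧ X = ⋃ i, f i)
    (hcons : ∀ F : Finset (Set M), ↑F ⊆ S → F.card ≤ k + 1 →
      (⋂₀ (F : Set (Set M))).Nonempty) :
    (∃ F : Finset M, ∀ X ∈ S, ∃ x ∈ F, x ∈ X) ∨
      (∃ p, IsTypeOn₁ L p ∧ IsDefTypeOver₁ L (Set.univ : Set M) p ∧ S ⊆ p) := by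
  classical
  by_cases hno : ∃ p, IsTypeOn₁ L p ∧ IsDefTypeOver₁ L (Set.univ : Set M) p ∧ S ⊆ p
  · exact Or.inr hno
  left
  rcases S.eq_empty_or_nonempty with rfl | hne
  · exact ⟨∅, by simp⟩
  by_cases hnF : ∃ F : Finset M, ∀ C : Set M, C.OrdConnected → OmGood S C → ∃ x ∈ F, x ∈ C
  · obtain ⟨F, hF⟩ := hnF
    refine ⟨F, fun X hX => ?_⟩
    obtain ⟨m, hm, f, hf, hXf⟩ := hint X hX
    obtain ⟨i, hi⟩ := om_piece S k hcons X hX m hm f hXf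
    obtain ⟨x, hxF, hx⟩ := hF _ (om_ordConnected (hf i)) hi
    exact ⟨x, hxF, by rw [hXf]; exact Set.mem_iUnion.2 ⟨i, hx⟩⟩
  have step := om_step hM S hne hS hno hnF
  obtain ⟨⟨c, hc⟩, -⟩ := om_not_good hM S hS hno
  have h0 : OmQ S c := by
    refine ⟨{c}, fun C hC hg => ?_⟩
    by_cases hcC : c ∈ C
    · exact Or.inl ⟨c, by simp, hcC⟩
    rcases om_side hC hcC with h | h
    · exact absurd (hg.mono h) hc
    · exact Or.inr h
  choose! g hg1 hg2 hg3 using step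
  have hQ : ∀ n, OmQ S (g^[n] c) := by
    intro n
    induction n with
    | zero => exact h0
    | succ n ih => rw [Function.iterate_succ_apply']; exact hg3 _ ih
  have hgood : ∀ n, OmGood S (Set.Ioc (g^[n] c) (g^[n + 1] c)) := by
    intro n
    rw [Function.iterate_succ_apply']; exact hg2 _ (hQ n)
  have hmono : StrictMono (fun n => g^[n] c) := by
    refine strictMono_nat_of_lt_succ fun n => ?_
    show g^[n] c < g^[n + 1] c
    rw [Function.iterate_succ_apply']; exact hg1 _ (hQ n)
  refine ⟨(Finset.range (k + 2)).image (fun n => g^[n] c), fun X hX => ?_⟩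
  obtain ⟨m, hm, f, hf, hXf⟩ := hint X hX
  have hpt : ∀ j : Fin (k + 1), ∃ x, ∃ i, x ∈ f i ∧
      x ∈ Set.Ioc (g^[(j : ℕ)] c) (g^[(j : ℕ) + 1] c) := by
    intro j
    obtain ⟨x, hx, hx'⟩ := hgood j X hX
    rw [hXf] at hx
    obtain ⟨i, hi⟩ := Set.mem_iUnion.1 hx
    exact ⟨x, i, hi, hx'⟩
  choose x i hxi hx using hpt
  have main : ∀ j j' : Fin (k + 1), j < j' → i j = i j' →
      ∃ y ∈ (Finset.range (k + 2)).image (fun n => g^[n] c), y ∈ X := by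
    intro j j' hjj' hii
    refine ⟨g^[(j : ℕ) + 1] c, Finset.mem_image.2 ⟨(j : ℕ) + 1, by simp; omega, rfl⟩, ?_⟩
    rw [hXf]
    refine Set.mem_iUnion.2 ⟨i j, (om_ordConnected (hf (i j))).out (hxi j)
      (by rw [hii]; exact hxi j') ⟨(hx j).2, ?_⟩⟩
    have hle : (j : ℕ) + 1 ≤ j' := hjj'
    exact (hmono.monotone hle).trans (hx j').1.le
  obtain ⟨j, j', hne', hij⟩ := Fintype.exists_ne_map_eq_of_card_lt i (by simp; omega)
  rcases lt_or_gt_of_ne hne' with h | h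
  · exact main j j' h hij
  · exact main j' j h hij.symm
end
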